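/- arXiv:0811.4068 — 10 statements merged into one kernel-verified Lean document; each statement's English description precedes it below -/
import Mathlib

section
/- Let T : ℝ → ℝ be 1-Lipschitz and let x₁ < x₂. The following two statements are equivalent: (a) every point of the open interval (x₁, x₂) is characteristic for T; (b) there exists x* ∈ [x₁, x₂] such that T(x) = T(x*) − |x − x*| for every x ∈ [x₁, x₂]. -/
/-- `x₀` is a non-characteristic point for the blow-up curve `T`: there exist
`δ ∈ (0,1)` and `ε > 0` such that `T x ≥ T x₀ - δ |x - x₀|` whenever `|x - x₀| ≤ ε`. -/
def NonCharacteristic (T : ℝ → ℝ) (x₀ : ℝ) : Prop :=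
  ∃ δ ∈ Set.Ioo (0:ℝ) 1, ∃ ε > (0:ℝ), ∀ x : ℝ, |x - x₀| ≤ ε → T x₀ - δ * |x - x₀| ≤ T x

/-- Characterization of open intervals consisting of characteristic points: every point of
`(x₁, x₂)` is characteristic for the 1-Lipschitz curve `T` if and only if `T` is a
"tent" `T x = T x* - |x - x*|` on `[x₁, x₂]` for some `x* ∈ [x₁, x₂]`. -/
theorem characterization_interior_S (T : ℝ → ℝ) (hT : LipschitzWith 1 T)
    (x₁ x₂ : ℝ) (hx : x₁ < x₂) :
    (∀ x ∈ Set.Ioo x₁ x₂, ¬ NonCharacteristic T x) ↔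
    (∃ xs ∈ Set.Icc x₁ x₂, ∀ x ∈ Set.Icc x₁ x₂, T x = T xs - |x - xs|) := by
  have hL : ∀ x y, T x ≤ T y + |x - y| := by
    intro x y
    have h := hT.dist_le_mul x y
    rw [Real.dist_eq, Real.dist_eq] at h
    have h2 := le_abs_self (T x - T y)
    simp only [NNReal.coe_one, one_mul] at h
    linarith
  constructor
  · intro hc
    have key : ∀ x ∈ Set.Icc x₁ x₂, T x₁ + (x - x₁) ≤ T x ∨ T x₂ + (x₂ - x) ≤ T x := by
      intro x0 hx0
      by_contra hcon
      push Not at hcon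
      obtain ⟨h1, h2⟩ := hcon
      have e1 : ∀ᶠ d : ℝ in nhds 1, T x0 < T x₁ + d * (x0 - x₁) := by
        have hcont : Continuous fun d : ℝ => T x₁ + d * (x0 - x₁) := by fun_prop
        exact (hcont.tendsto 1).eventually (lt_mem_nhds (by simpa using h1))
      have e2 : ∀ᶠ d : ℝ in nhds 1, T x0 < T x₂ + d * (x₂ - x0) := by
        have hcont : Continuous fun d : ℝ => T x₂ + d * (x₂ - x0) := by fun_prop
        exact (hcont.tendsto 1).eventually (lt_mem_nhds (by simpa using h2))
      have e3 : ∀ᶠ d : ℝ in nhds 1, 0 < d := lt_mem_nhds one_pos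
      have e4 := ((e1.and (e2.and e3)).filter_mono
        (nhdsWithin_le_nhds (s := Set.Iio 1))).and self_mem_nhdsWithin
      obtain ⟨d, ⟨hd1, hd2, hd0⟩, hdlt⟩ := e4.exists
      have hcont : ContinuousOn (fun x => T x + d * |x - x0|) (Set.Icc x₁ x₂) := by
        have := hT.continuous
        fun_prop
      obtain ⟨z, hz, hmin⟩ := isCompact_Icc.exists_isMinOn (Set.nonempty_Icc.2 hx.le) hcont
      have hmin' : ∀ x ∈ Set.Icc x₁ x₂, T z + d * |z - x0| ≤ T x + d * |x - x0| :=
        fun x hx => hmin hx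
      have hzx := hmin' x0 hx0
      simp only [sub_self, abs_zero, mul_zero, add_zero] at hzx
      have hz1 : z ≠ x₁ := by
        rintro rfl
        rw [abs_sub_comm, abs_of_nonneg (by linarith [hx0.1])] at hzx
        linarith
      have hz2 : z ≠ x₂ := by
        rintro rfl
        rw [abs_of_nonneg (by linarith [hx0.2])] at hzx
        linarith
      have l1 : x₁ < z := lt_of_le_of_ne hz.1 hz1.symm
      have l2 : z < x₂ := lt_of_le_of_ne hz.2 hz2
      refine hc z ⟨l1, l2⟩ ⟨d, ⟨hd0, hdlt⟩, min (z - x₁) (x₂ - z),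
        lt_min (by linarith) (by linarith), ?_⟩
      intro x hxz
      have a1 := abs_le.1 (hxz.trans (min_le_left _ _))
      have a2 := abs_le.1 (hxz.trans (min_le_right _ _))
      have h3 := hmin' x ⟨by linarith, by linarith⟩
      have h4 := mul_le_mul_of_nonneg_left (abs_sub_le x z x0) hd0.le
      linarith
    have tent : ∀ x ∈ Set.Icc x₁ x₂, T x = min (T x₁ + (x - x₁)) (T x₂ + (x₂ - x)) := by
      intro x hxx
      have u1 := hL x x₁
      have u2 := hL x x₂
      rw [abs_of_nonneg (by linarith [hxx.1])] at u1
      rw [abs_sub_comm, abs_of_nonneg (by linarith [hxx.2])] at u2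
      apply le_antisymm (le_min u1 u2)
      rcases key x hxx with h | h
      · exact (min_le_left _ _).trans h
      · exact (min_le_right _ _).trans h
    have v1 := hL x₁ x₂
    have v2 := hL x₂ x₁
    rw [abs_sub_comm, abs_of_nonneg (by linarith)] at v1
    rw [abs_of_nonneg (by linarith)] at v2
    have hs : (T x₂ - T x₁ + x₁ + x₂) / 2 ∈ Set.Icc x₁ x₂ :=
      ⟨by linarith, by linarith⟩
    refine ⟨_, hs, ?_⟩
    intro x hxx
    have ts := tent _ hs
    rw [min_eq_left (by linarith)] at ts
    rw [tent x hxx, ts]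
    rcases le_total x ((T x₂ - T x₁ + x₁ + x₂) / 2) with h | h
    · rw [min_eq_left (by linarith), abs_of_nonpos (by linarith)]; ring
    · rw [min_eq_right (by linarith), abs_of_nonneg (by linarith)]; ring
  · rintro ⟨s, hs, h⟩ x hxx ⟨d, ⟨hd0, hd1⟩, e, he, hN⟩
    have hx' := h x ⟨hxx.1.le, hxx.2.le⟩
    rcases le_total x s with hxs | hxs
    · have hp : 0 < min e (x - x₁) := lt_min he (by linarith [hxx.1])
      have m1 := min_le_left e (x - x₁)
      have m2 := min_le_right e (x - x₁)
      generalize min e (x - x₁) = r at *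
      have hr : |x - r - x| = r := by
        rw [show x - r - x = -r by ring, abs_neg, abs_of_pos hp]
      have h1 := hN (x - r) (by rw [hr]; exact m1)
      have h2 := h (x - r) ⟨by linarith, by linarith [hxx.2]⟩
      rw [hr] at h1
      rw [abs_of_nonpos (by linarith)] at h2 hx'
      nlinarith
    · have hp : 0 < min e (x₂ - x) := lt_min he (by linarith [hxx.2])
      have m1 := min_le_left e (x₂ - x)
      have m2 := min_le_right e (x₂ - x)
      generalize min e (x₂ - x) = r at *
      have hr : |x + r - x| = r := by
        rw [show x + r - x = r by ring, abs_of_pos hp]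
      have h1 := hN (x + r) (by rw [hr]; exact m1)
      have h2 := h (x + r) ⟨by linarith [hxx.1], by linarith⟩
      rw [hr] at h1
      rw [abs_of_nonneg (by linarith)] at h2 hx'
      nlinarith
end

section
/- Let p > 1 and set β = 2/(p−1). Let k ≥ 2 be an integer, c₁ > 0, δ₀ > 0, C > 0, s₀ ∈ ℝ, and let e₁, …, e_k ∈ {−1, 1}. Let ζ₁, …, ζ_k : [s₀, ∞) → ℝ be C¹ functions with ζ₁(s) < ⋯ < ζ_k(s) for all s ≥ s₀ and ζ_{i+1}(s) − ζ_i(s) → ∞ as s → ∞ for each i = 1, …, k−1. Assume that for all s ≥ s₀ and all i = 1, …, k, |ζ_i'(s)/c₁ + e_{i−1} e_i e^{−β(ζ_i(s)−ζ_{i−1}(s))} − e_i e_{i+1} e^{−β(ζ_{i+1}(s)−ζ_i(s))}| ≤ C J(s)^{1+δ₀}, where J(s) = Σ_{j=1}^{k−1} e^{−β(ζ_{j+1}(s)−ζ_j(s))} and, by convention, the term with index i−1 = 0 is absent when i = 1 and the term with index i+1 = k+1 is absent when i = k. Then e_i e_{i+1} = −1 for every i = 1, …, k−1 (equivalently e_i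 = (−1)^{i+1} e₁); moreover ∫_{s₀}^{s} e^{−β(ζ_{j+1}(s')−ζ_j(s'))} ds' → ∞ as s → ∞ for every j = 1, …, k−1, and there exist C₀ > 0 and s₁ ≥ s₀ such that for all i, j ∈ {1, …, k−1} and all s ≥ s₁, ∫_{s₀}^{s} e^{−β(ζ_{i+1}−ζ_i)} ds' ≤ C₀ ∫_{s₀}^{s} e^{−β(ζ_{j+1}−ζ_j)} ds'. -/
open Real Filter

lemma toda_ratio (k : ℕ) (z : ℕ → ℝ) (h0 : z 0 = 0)
    (hc : ∀ i, 1 ≤ i → i < k → z (i-1) + z (i+1) ≤ 2 * z i) :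
    ∀ i, i < k → (i:ℝ) * z (i+1) ≤ (i+1) * z i := by
  intro i
  induction i with
  | zero => intro _; simp [h0]
  | succ n ih =>
    intro h
    have h1 := ih (by omega)
    have h2 := hc (n+1) (by omega) h
    simp only [Nat.add_sub_cancel] at h2
    push_cast
    have h3 : (0:ℝ) ≤ (n:ℝ) + 1 := by positivity
    nlinarith [mul_le_mul_of_nonneg_left h2 h3]

lemma toda_ratio_le (k : ℕ) (z : ℕ → ℝ) (h0 : z 0 = 0)
    (hc : ∀ i, 1 ≤ i → i < k → z (i-1) + z (i+1) ≤ 2 * z i) (i : ℕ) (hi : 1 ≤ i) :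
    ∀ j, i ≤ j → j ≤ k → (i:ℝ) * z j ≤ j * z i := by
  intro j hij
  induction j, hij using Nat.le_induction with
  | base => intro _; exact le_rfl
  | succ n hn ih =>
    intro h
    have h1 := ih (by omega)
    have h2 := toda_ratio k z h0 hc n (by omega)
    push_cast
    have hnp : (0:ℝ) < n := by exact_mod_cast (by omega : 0 < n)
    have hip : (0:ℝ) < i := by exact_mod_cast hi
    have h3 := mul_le_mul_of_nonneg_left h2 hip.le
    have h4 := mul_le_mul_of_nonneg_left h1 (by positivity : (0:ℝ) ≤ (n:ℝ) + 1)
    have : (n:ℝ) * ((i:ℝ) * z (n+1)) ≤ n * ((n+1) * z i) := by nlinarith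
    exact le_of_mul_le_mul_left this hnp

lemma toda_nonneg (k : ℕ) (z : ℕ → ℝ) (h0 : z 0 = 0) (hk : z k = 0)
    (hc : ∀ i, 1 ≤ i → i < k → z (i-1) + z (i+1) ≤ 2 * z i) (i : ℕ) (hi : 1 ≤ i)
    (hik : i < k) : 0 ≤ z i := by
  have h := toda_ratio_le k z h0 hc i hi k hik.le le_rfl
  rw [hk, mul_zero] at h
  have hkp : (0:ℝ) < k := by exact_mod_cast (by omega : 0 < k)
  exact nonneg_of_mul_nonneg_right h hkp

lemma toda_half (k : ℕ) (z : ℕ → ℝ) (h0 : z 0 = 0) (hk : z k = 0)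
    (hc : ∀ i, 1 ≤ i → i < k → z (i-1) + z (i+1) ≤ 2 * z i) (i j : ℕ) (hi : 1 ≤ i)
    (hij : i ≤ j) (hjk : j < k) : z j ≤ k * z i := by
  have h := toda_ratio_le k z h0 hc i hi j hij hjk.le
  have hi0 := toda_nonneg k z h0 hk hc i hi (by omega)
  have hj0 := toda_nonneg k z h0 hk hc j (by omega) hjk
  have h1 : (1:ℝ) ≤ i := by exact_mod_cast hi
  have h2 : (j:ℝ) ≤ k := by exact_mod_cast hjk.le
  nlinarith

lemma toda_concave (k : ℕ) (z : ℕ → ℝ) (h0 : z 0 = 0) (hk : z k = 0)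
    (hc : ∀ i, 1 ≤ i → i < k → z (i-1) + z (i+1) ≤ 2 * z i) (i j : ℕ) (hi : 1 ≤ i)
    (hik : i < k) (hj : 1 ≤ j) (hjk : j < k) : z j ≤ k * z i := by
  rcases le_total i j with h | h
  · exact toda_half k z h0 hk hc i j hi h hjk
  · have := toda_half k (fun n => z (k - n)) (by simpa using hk) (by simpa using h0)
      (by
        intro n hn hnk
        have := hc (k - n) (by omega) (by omega)
        have e1 : k - (n - 1) = k - n + 1 := by omega
        have e2 : k - (n + 1) = k - n - 1 := by omega
        simp only [e1, e2]
        linarith) (k - i) (k - j) (by omega) (by omega) (by omega)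
    have e1 : k - (k - i) = i := by omega
    have e2 : k - (k - j) = j := by omega
    simpa only [e1, e2] using this

/-- almost concave sequences -/
lemma toda_discrete (k : ℕ) (hk2 : 2 ≤ k) (y : ℕ → ℝ) (A : ℝ) (hA : 0 < A) (h0 : y 0 = 0)
    (hk : y k = 0) (hsum : ∑ j ∈ Finset.Icc 1 (k-1), |y j| = A)
    (hc : ∀ i, 1 ≤ i → i < k →
      y (i-1) + y (i+1) ≤ 2 * y i + 4 * (1 / (16 * (k:ℝ)^4)) * A) :
    ∀ i, 1 ≤ i → i < k → A / (2 * (k:ℝ)^2) ≤ y i := by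
  have hkp : (2:ℝ) ≤ k := by exact_mod_cast hk2
  set η : ℝ := 4 * (1 / (16 * (k:ℝ)^4)) * A with hη
  have hηp : 0 < η := by positivity
  set z : ℕ → ℝ := fun n => y n + η / 2 * (n * (k - n)) with hz
  have hz0 : z 0 = 0 := by simp [hz, h0]
  have hzk : z k = 0 := by simp [hz, hk]
  have hzc : ∀ i, 1 ≤ i → i < k → z (i-1) + z (i+1) ≤ 2 * z i := by
    intro i hi hik
    have := hc i hi hik
    simp only [hz]
    push_cast [Nat.cast_sub hi]
    nlinarith
  have hzy : ∀ i, 1 ≤ i → i < k → y i ≤ z i ∧ z i ≤ y i + A / (8 * (k:ℝ)^2) := by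
    intro i hi hik
    have h1 : (1:ℝ) ≤ i := by exact_mod_cast hi
    have h2 : (i:ℝ) < k := by exact_mod_cast hik
    have h3 : 0 ≤ (i:ℝ) * (k - i) := mul_nonneg (by linarith) (by linarith)
    have h4 : (i:ℝ) * (k - i) ≤ (k:ℝ)^2 := by nlinarith
    have h5 : η / 2 * (k:ℝ)^2 = A / (8 * (k:ℝ)^2) := by
      rw [hη]; field_simp; norm_num
    have h6 := mul_le_mul_of_nonneg_left h4 (by positivity : 0 ≤ η / 2)
    have h7 : 0 ≤ η / 2 * ((i:ℝ) * (k - i)) := by positivity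
    simp only [hz]
    constructor <;> linarith
  obtain ⟨m, hm, hmA⟩ : ∃ m ∈ Finset.Icc 1 (k-1), A / k ≤ |y m| := by
    by_contra hcon
    push Not at hcon
    have hne : (Finset.Icc 1 (k-1)).Nonempty := ⟨1, by simp; omega⟩
    have := Finset.sum_lt_sum_of_nonempty hne hcon
    rw [hsum] at this
    simp only [Finset.sum_const, Nat.card_Icc, nsmul_eq_mul] at this
    have e1 : k - 1 + 1 - 1 = k - 1 := by omega
    rw [e1, Nat.cast_sub (by omega)] at this
    have h8 : (k:ℝ) * (A / k) = A := by field_simp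
    have h9 : 0 < A / k := by positivity
    push_cast at this
    nlinarith
  rw [Finset.mem_Icc] at hm
  have hm1 := hm.1
  have hmk : m < k := by omega
  have hzm0 := toda_nonneg k z hz0 hzk hzc m hm1 hmk
  have hsmall : A / (8 * (k:ℝ)^2) < A / k := by
    apply div_lt_div_of_pos_left hA (by positivity)
    nlinarith
  have hym : A / k ≤ y m := by
    rcases abs_cases (y m) with h | h
    · linarith
    · have := (hzy m hm1 hmk).2
      linarith
  intro i hi hik
  have h1 := toda_concave k z hz0 hzk hzc i m hi hik hm1 hmk
  have h2 := hzy i hi hik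
  have h3 := hzy m hm1 hmk
  have h4 : A / k ≤ k * z i := by linarith
  have h5 : A / (k:ℝ)^2 ≤ z i := by
    rw [div_le_iff₀ (by positivity)] at h4 ⊢
    nlinarith
  have h6 : A / (2 * (k:ℝ)^2) = A / (k:ℝ)^2 / 2 := by field_simp
  have h7 : A / (8 * (k:ℝ)^2) = A / (k:ℝ)^2 / 8 := by field_simp
  have h8 : 0 < A / (k:ℝ)^2 := by positivity
  rw [h6]; rw [h7] at h2
  linarith

/-- Sign alternation for the Toda-lattice type system satisfied by the solitons' centers:
if the centers `ζ₁ < ⋯ < ζ_k` satisfy the perturbed Toda system, then the signs alternate,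
`e_i e_{i+1} = -1`, the interaction integrals diverge, and they are pairwise comparable.
(The convention that the boundary terms are absent is implemented by `e 0 = 0` and
`e (k+1) = 0`.) -/
theorem toda_sign_alternation (p : ℝ) (hp : 1 < p) (k : ℕ) (hk : 2 ≤ k)
    (c₁ δ₀ C s₀ : ℝ) (hc₁ : 0 < c₁) (hδ₀ : 0 < δ₀) (hC : 0 < C)
    (e : ℕ → ℝ) (he0 : e 0 = 0) (hek : e (k+1) = 0)
    (he : ∀ i, 1 ≤ i → i ≤ k → e i = 1 ∨ e i = -1)
    (ζ ζ' : ℕ → ℝ → ℝ)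
    (hderiv : ∀ i, 1 ≤ i → i ≤ k → ∀ s, s₀ ≤ s → HasDerivAt (ζ i) (ζ' i s) s)
    (hcont : ∀ i, 1 ≤ i → i ≤ k → ContinuousOn (ζ' i) (Set.Ici s₀))
    (hmono : ∀ s, s₀ ≤ s → ∀ i, 1 ≤ i → i < k → ζ i s < ζ (i+1) s)
    (hdiv : ∀ i, 1 ≤ i → i < k →
      Tendsto (fun s => ζ (i+1) s - ζ i s) atTop atTop)
    (hode : ∀ s, s₀ ≤ s → ∀ i, 1 ≤ i → i ≤ k →
      |ζ' i s / c₁ + e (i-1) * e i * Real.exp (-(2/(p-1)) * (ζ i s - ζ (i-1) s))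
        - e i * e (i+1) * Real.exp (-(2/(p-1)) * (ζ (i+1) s - ζ i s))|
      ≤ C * (∑ j ∈ Finset.Icc 1 (k-1),
          Real.exp (-(2/(p-1)) * (ζ (j+1) s - ζ j s))) ^ (1+δ₀)) :
    (∀ i, 1 ≤ i → i < k → e i * e (i+1) = -1) ∧
    (∀ j, 1 ≤ j → j < k →
      Tendsto (fun s => ∫ t in s₀..s, Real.exp (-(2/(p-1)) * (ζ (j+1) t - ζ j t)))
        atTop atTop) ∧
    (∃ C₀ > (0:ℝ), ∃ s₁, s₀ ≤ s₁ ∧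
      ∀ i, 1 ≤ i → i < k → ∀ j, 1 ≤ j → j < k → ∀ s, s₁ ≤ s →
        (∫ t in s₀..s, Real.exp (-(2/(p-1)) * (ζ (i+1) t - ζ i t))) ≤
          C₀ * ∫ t in s₀..s, Real.exp (-(2/(p-1)) * (ζ (j+1) t - ζ j t))) := by
  classical
  have hkp : (2:ℝ) ≤ k := by exact_mod_cast hk
  set β : ℝ := 2/(p-1) with hβ
  have hβp : 0 < β := div_pos two_pos (by linarith)
  set a : ℕ → ℝ → ℝ := fun j t => Real.exp (-β * (ζ (j+1) t - ζ j t)) with ha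
  set B : ℕ → ℝ → ℝ := fun j s => ∫ t in s₀..s, a j t with hB
  set J : ℝ → ℝ := fun s => ∑ j ∈ Finset.Icc 1 (k-1), a j s with hJ
  set A : ℝ → ℝ := fun s => ∑ j ∈ Finset.Icc 1 (k-1), B j s with hAdef
  set σ : ℕ → ℝ := fun i => e i * e (i+1) with hσ
  have hσ0 : σ 0 = 0 := by simp [hσ, he0]
  have hσk : σ k = 0 := by simp [hσ, hek]
  have hσ1 : ∀ i, 1 ≤ i → i < k → σ i = 1 ∨ σ i = -1 := by
    intro i hi hik
    rcases he i hi hik.le with h | h <;> rcases he (i+1) (by omega) (by omega) with h' | h' <;>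
      simp [hσ, h, h']
  have hapos : ∀ j t, 0 < a j t := fun j t => Real.exp_pos _
  have hacont : ∀ j, 1 ≤ j → j < k → ∀ t, s₀ ≤ t → ContinuousAt (a j) t := by
    intro j hj hjk t ht
    have h1 := (hderiv j hj hjk.le t ht).continuousAt
    have h2 := (hderiv (j+1) (by omega) (by omega) t ht).continuousAt
    exact Real.continuous_exp.continuousAt.comp (continuousAt_const.mul (h2.sub h1))
  have hBderiv : ∀ j, 1 ≤ j → j < k → ∀ s, s₀ < s → HasDerivAt (B j) (a j s) s := by
    intro j hj hjk s hs
    apply intervalIntegral.integral_hasDerivAt_right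
    · apply ContinuousOn.intervalIntegrable
      rw [Set.uIcc_of_le hs.le]
      intro t ht
      exact (hacont j hj hjk t ht.1).continuousWithinAt
    · refine ContinuousOn.stronglyMeasurableAtFilter isOpen_Ioi (s := Set.Ioi s₀) ?_ s hs
      intro t ht
      exact (hacont j hj hjk t (le_of_lt ht)).continuousWithinAt
    · exact hacont j hj hjk s hs.le
  have hBnn : ∀ j s, s₀ ≤ s → 0 ≤ B j s := by
    intro j s hs
    exact intervalIntegral.integral_nonneg hs (fun t _ => (hapos j t).le)
  have hBA : ∀ j, 1 ≤ j → j < k → ∀ s, s₀ ≤ s → B j s ≤ A s := by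
    intro j hj hjk s hs
    exact Finset.single_le_sum (f := fun j => B j s) (fun i _ => hBnn i s hs)
      (Finset.mem_Icc.2 ⟨hj, by omega⟩)
  have hAnn : ∀ s, s₀ ≤ s → 0 ≤ A s := fun s hs => Finset.sum_nonneg (fun i _ => hBnn i s hs)
  have hAderiv : ∀ s, s₀ < s → HasDerivAt A (J s) s := by
    intro s hs
    apply HasDerivAt.fun_sum
    intro j hj
    rw [Finset.mem_Icc] at hj
    exact hBderiv j hj.1 (by omega) s hs
  have hJpos : ∀ s, 0 < J s := fun s =>
    Finset.sum_pos (fun j _ => hapos j s) ⟨1, by simp; omega⟩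
  have hatend : ∀ j, 1 ≤ j → j < k → Tendsto (a j) atTop (nhds 0) := by
    intro j hj hjk
    apply Real.tendsto_exp_atBot.comp
    exact (hdiv j hj hjk).const_mul_atTop_of_neg (by linarith)
  have hJtend : Tendsto J atTop (nhds 0) := by
    have : Tendsto J atTop (nhds (∑ j ∈ Finset.Icc 1 (k-1), (0:ℝ))) := by
      apply tendsto_finset_sum
      intro j hj
      rw [Finset.mem_Icc] at hj
      exact hatend j hj.1 (by omega)
    simpa using this
  set ε : ℝ := 1 / (32 * (k:ℝ)^4) with hε
  have hεp : 0 < ε := by positivity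
  have hJd : Tendsto (fun s => C * (J s)^δ₀) atTop (nhds 0) := by
    have h1 := (hJtend.rpow_const (p := δ₀) (Or.inr hδ₀.le)).const_mul C
    rwa [Real.zero_rpow hδ₀.ne', mul_zero] at h1
  obtain ⟨S, hSlt, hS⟩ : ∃ S, s₀ < S ∧ ∀ s, S ≤ s → C * (J s)^(1+δ₀) ≤ ε * J s := by
    have h1 := (hJd.eventually_lt_const hεp).and (eventually_gt_atTop s₀)
    obtain ⟨S, hS⟩ := eventually_atTop.1 h1
    refine ⟨S, (hS S le_rfl).2, fun s hs => ?_⟩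
    rw [Real.rpow_add (hJpos s), Real.rpow_one]
    have := mul_le_mul_of_nonneg_right (hS s hs).1.le (hJpos s).le
    linarith
  set y : ℕ → ℝ → ℝ := fun i s => -σ i * B i s with hy
  have hyderiv : ∀ i, i ≤ k → ∀ s, s₀ < s → HasDerivAt (y i) (-σ i * a i s) s := by
    intro i hik s hs
    by_cases h : σ i = 0
    · simp only [hy, h, neg_zero, zero_mul]
      exact hasDerivAt_const _ _
    · have h1 : 1 ≤ i := by
        rcases Nat.eq_zero_or_pos i with h' | h'
        · rw [h'] at h; exact absurd hσ0 h
        · exact h'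
      have h2 : i < k := by
        rcases hik.eq_or_lt with h' | h'
        · rw [h'] at h; exact absurd hσk h
        · exact h'
      exact (hBderiv i h1 h2 s hs).const_mul _
  have hyabs : ∀ i, 1 ≤ i → i < k → ∀ s, s₀ ≤ s → |y i s| = B i s := by
    intro i hi hik s hs
    simp only [hy, abs_mul, abs_of_nonneg (hBnn i s hs)]
    rcases hσ1 i hi hik with h | h <;> simp [h]
  have hyA : ∀ i, i ≤ k → ∀ s, s₀ ≤ s → |y i s| ≤ A s := by
    intro i hik s hs
    rcases Nat.eq_zero_or_pos i with h' | h'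
    · simp [hy, h', hσ0, hAnn s hs]
    rcases hik.eq_or_lt with h2 | h2
    · simp [hy, h2, hσk, hAnn s hs]
    rw [hyabs i h' h2 s hs]
    exact hBA i h' h2 s hs
  set D : ℕ → ℝ → ℝ := fun i s => ζ i s / c₁ - y (i-1) s + y i s with hD
  set D' : ℕ → ℝ → ℝ := fun i s => ζ' i s / c₁ - (-σ (i-1) * a (i-1) s) + (-σ i * a i s) with hD'
  have hDderiv : ∀ i, 1 ≤ i → i ≤ k → ∀ s, s₀ < s → HasDerivAt (D i) (D' i s) s := by
    intro i hi hik s hs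
    exact (((hderiv i hi hik s hs.le).div_const c₁).sub (hyderiv (i-1) (by omega) s hs)).add
      (hyderiv i hik s hs)
  have hDbd : ∀ i, 1 ≤ i → i ≤ k → ∀ s, S ≤ s → |D' i s| ≤ ε * J s := by
    intro i hi hik s hs
    have h1 := hode s (by linarith) i hi hik
    have h2 := hS s hs
    refine le_trans (le_of_eq ?_) (h1.trans h2)
    congr 1
    have e1 : i - 1 + 1 = i := by omega
    simp only [hD', hσ, ha, e1]
    ring
  have hDA : ∀ i, 1 ≤ i → i ≤ k → ∀ s, S ≤ s → |D i s - D i S| ≤ ε * A s := by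
    intro i hi hik s hs
    have hm : ∀ r : ℝ, |r| = 1 → r * (D i s - D i S) ≤ ε * A s := by
      intro r hr
      have hder : ∀ t, S ≤ t → HasDerivAt (fun t => ε * A t - r * D i t)
          (ε * J t - r * D' i t) t := fun t ht =>
        ((hAderiv t (by linarith)).const_mul ε).sub
          ((hDderiv i hi hik t (by linarith)).const_mul r)
      have hmon : MonotoneOn (fun t => ε * A t - r * D i t) (Set.Ici S) := by
        apply monotoneOn_of_deriv_nonneg (convex_Ici S)
        · intro t ht
          exact (hder t ht).continuousAt.continuousWithinAt
        · intro t ht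
          rw [interior_Ici] at ht
          exact (hder t (le_of_lt ht)).differentiableAt.differentiableWithinAt
        · intro t ht
          rw [interior_Ici] at ht
          rw [(hder t (le_of_lt ht)).deriv]
          have h1 := hDbd i hi hik t (le_of_lt ht)
          have h2 := le_abs_self (r * D' i t)
          rw [abs_mul, hr, one_mul] at h2
          linarith
      have h1 := hmon (Set.self_mem_Ici) (Set.mem_Ici.2 hs) hs
      have h2 : 0 ≤ ε * A S := mul_nonneg hεp.le (hAnn S hSlt.le)
      simp only at h1
      linarith
    rw [abs_le]
    have h1 := hm 1 (by simp)
    have h2 := hm (-1) (by simp)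
    constructor <;> linarith
  -- divergence of A
  have hgap : ∀ i s, 1 ≤ i → D (i+1) s - D i s =
      (ζ (i+1) s - ζ i s) / c₁ - 2 * y i s + y (i+1) s + y (i-1) s + 2 * (y i s - y i s) := by
    intro i s hi
    simp only [hD, Nat.add_sub_cancel]
    ring
  have hAtend : Tendsto A atTop atTop := by
    have h1 := (hdiv 1 le_rfl (by omega)).atTop_div_const hc₁
    have h2 := tendsto_atTop_add_const_right _ (-(D 2 S - D 1 S)) h1
    have h3 : Tendsto (fun s => (2 * ε + 4) * A s) atTop atTop := by
      refine tendsto_atTop_mono' _ ?_ h2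
      filter_upwards [eventually_ge_atTop S] with s hs
      have g := hgap 1 s le_rfl
      have hs0 : s₀ ≤ s := by linarith
      have q0 := abs_le.1 (hyA 0 (by omega) s hs0)
      have q1 := abs_le.1 (hyA 1 (by omega) s hs0)
      have q2 := abs_le.1 (hyA 2 (by omega) s hs0)
      have d1 := abs_le.1 (hDA 1 le_rfl (by omega) s hs)
      have d2 := abs_le.1 (hDA 2 (by omega) (by omega) s hs)
      norm_num at g ⊢
      linarith
    have hc : 0 < 2 * ε + 4 := by positivity
    exact (tendsto_const_mul_atTop_of_pos hc).1 h3
  obtain ⟨s₁, hs₁⟩ : ∃ s₁, ∀ s, s₁ ≤ s → S ≤ s ∧ 0 < A s ∧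
      ∀ i ∈ Finset.Icc 1 k, |D i S| ≤ ε * A s := by
    apply eventually_atTop.1
    refine (eventually_ge_atTop S).and ((hAtend.eventually_gt_atTop 0).and ?_)
    rw [Filter.eventually_all_finset]
    intro i _
    exact (hAtend.const_mul_atTop hεp).eventually_ge_atTop _
  have key : ∀ s, s₁ ≤ s → ∀ i, 1 ≤ i → i < k → A s / (2 * (k:ℝ)^2) ≤ y i s := by
    intro s hs
    obtain ⟨hSs, hAs, hDs⟩ := hs₁ s hs
    have hs0 : s₀ ≤ s := by linarith
    apply toda_discrete k hk (fun i => y i s) (A s) hAs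
    · simp [hy, hσ0]
    · simp [hy, hσk]
    · apply Finset.sum_congr rfl
      intro j hj
      rw [Finset.mem_Icc] at hj
      exact hyabs j hj.1 (by omega) s hs0
    · intro i hi hik
      have g := hgap i s hi
      have d1 := abs_le.1 (hDA i hi hik.le s hSs)
      have d2 := abs_le.1 (hDA (i+1) (by omega) (by omega) s hSs)
      have c1 := abs_le.1 (hDs i (Finset.mem_Icc.2 ⟨hi, hik.le⟩))
      have c2 := abs_le.1 (hDs (i+1) (Finset.mem_Icc.2 ⟨by omega, by omega⟩))
      have hz : 0 ≤ (ζ (i+1) s - ζ i s) / c₁ :=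
        div_nonneg (by linarith [hmono s hs0 i hi hik]) hc₁.le
      have hee : 4 * (1 / (16 * (k:ℝ)^4)) * A s = 8 * (ε * A s) := by
        rw [hε]; field_simp; norm_num
      have hεA : 0 ≤ ε * A s := by positivity
      show y (i-1) s + y (i+1) s ≤ 2 * y i s + 4 * (1 / (16 * (k:ℝ)^4)) * A s
      rw [hee]
      linarith
  have hsg : ∀ i, 1 ≤ i → i < k → σ i = -1 := by
    intro i hi hik
    rcases hσ1 i hi hik with h | h
    · exfalso
      have h1 := key s₁ le_rfl i hi hik
      obtain ⟨hSs, hAs, -⟩ := hs₁ s₁ le_rfl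
      have h2 := hBnn i s₁ (by linarith)
      have h3 : 0 < A s₁ / (2 * (k:ℝ)^2) := by positivity
      simp only [hy, h] at h1
      linarith
    · exact h
  have hBlow : ∀ s, s₁ ≤ s → ∀ i, 1 ≤ i → i < k → A s / (2 * (k:ℝ)^2) ≤ B i s := by
    intro s hs i hi hik
    have h1 := key s hs i hi hik
    simp only [hy, hsg i hi hik] at h1
    linarith
  refine ⟨hsg, ?_, 2 * (k:ℝ)^2, by positivity, s₁, ?_, ?_⟩
  · intro j hj hjk
    have h1 : Tendsto (fun s => A s / (2 * (k:ℝ)^2)) atTop atTop :=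
      hAtend.atTop_div_const (by positivity)
    refine tendsto_atTop_mono' _ ?_ h1
    filter_upwards [eventually_ge_atTop s₁] with s hs
    exact hBlow s hs j hj hjk
  · linarith [(hs₁ s₁ le_rfl).1]
  · intro i hi hik j hj hjk s hs
    have hs0 : s₀ ≤ s := by linarith [(hs₁ s hs).1]
    have h1 := hBA i hi hik s hs0
    have h2 := hBlow s hs j hj hjk
    rw [div_le_iff₀ (by positivity)] at h2
    show B i s ≤ 2 * (k:ℝ)^2 * B j s
    linarith
end

section
/- Let p > 1 and set β = 2/(p−1). Let k ≥ 2 be an integer, c₁ > 0, δ₀ > 0, C > 0, s₀ ∈ ℝ, and let e₁, …, e_k ∈ {−1, 1}. Let ζ₁, …, ζ_k : [s₀, ∞) → ℝ be C¹ functions with ζ₁(s) < ⋯ < ζ_k(s) for all s ≥ s₀ and ζ_{i+1}(s) − ζ_i(s) → ∞ as s → ∞ for each i = 1, …, k−1. Assume that for all s ≥ s₀ and all i = 1, …, k, |ζ_i'(s)/c₁ + e_{i−1} e_i e^{−β(ζ_i(s)−ζ_{i−1}(s))} − e_i e_{i+1} e^{−β(ζ_{i+1}(s)−ζ_i(s))}|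 ≤ C J(s)^{1+δ₀}, where J(s) = Σ_{j=1}^{k−1} e^{−β(ζ_{j+1}(s)−ζ_j(s))} and, by convention, the term with index 0 is absent when i = 1 and the term with index k+1 is absent when i = k. Then there exist C₀ > 0 and s₁ ≥ s₀ such that for all i = 1, …, k and all s ≥ s₁, |ζ_i(s) − (i − (k+1)/2)·((p−1)/2)·log s| ≤ C₀. -/
open Real Filter

lemma anti_aux {f f' : ℝ → ℝ} {a : ℝ} (h : ∀ s, a ≤ s → HasDerivAt f (f' s) s)
    (h' : ∀ s, a ≤ s → f' s ≤ 0) (s t : ℝ) (hs : a ≤ s) (hst : s ≤ t) : f t ≤ f s := by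
  have : AntitoneOn f (Set.Ici a) := by
    apply antitoneOn_of_deriv_nonpos (convex_Ici a)
    · intro x hx
      exact (h x hx).continuousAt.continuousWithinAt
    · intro x hx
      rw [interior_Ici] at hx
      exact (h x (le_of_lt hx)).differentiableAt.differentiableWithinAt
    · intro x hx
      rw [interior_Ici] at hx
      rw [(h x (le_of_lt hx)).deriv]
      exact h' x (le_of_lt hx)
  exact this hs (le_trans hs hst) hst

lemma sbp (a Y : ℕ → ℝ) (n : ℕ) :
    ∑ j ∈ Finset.range (n+1), a j * (Y (j+1) - Y j)
      = a n * Y (n+1) - a 0 * Y 0 - ∑ j ∈ Finset.range n, (a (j+1) - a j) * Y (j+1) := by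
  induction n with
  | zero => simp; ring
  | succ n ih =>
    rw [Finset.sum_range_succ, ih, Finset.sum_range_succ _ n]
    ring

lemma decay_aux {W W' J : ℝ → ℝ} {c a δ : ℝ} (hc : 0 < c) (hδ : 0 < δ) (hδ1 : δ < 1)
    (hW : ∀ s, a ≤ s → HasDerivAt W (W' s) s)
    (hW' : ∀ s, a ≤ s → W' s ≤ -c * J s ^ 2)
    (hJ : ∀ s, a ≤ s → 0 < J s) (hWJ : ∀ s, a ≤ s → |W s| ≤ J s)
    (hlim : Tendsto J atTop (nhds 0)) :
    ∃ (Q Q' : ℝ → ℝ) (s₁ : ℝ), a ≤ s₁ ∧ 1 ≤ s₁ ∧ ∀ s, s₁ ≤ s →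
      HasDerivAt Q (Q' s) s ∧ J s ^ (1 + δ) ≤ Q' s ∧ Q s ≤ 0 := by
  have hWlim : Tendsto W atTop (nhds 0) := by
    apply squeeze_zero_norm' _ hlim
    filter_upwards [eventually_ge_atTop a] with s hs
    simpa using hWJ s hs
  have hanti : ∀ s t, a ≤ s → s ≤ t → W t ≤ W s :=
    anti_aux hW (fun s hs => (hW' s hs).trans (by nlinarith [sq_nonneg (J s)]))
  have hnn : ∀ s, a ≤ s → 0 ≤ W s := by
    intro s hs
    refine le_of_tendsto hWlim ?_
    filter_upwards [eventually_ge_atTop s] with t ht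
    exact hanti s t hs ht
  have hpos : ∀ s, a ≤ s → 0 < W s := by
    intro s hs
    rcases (hnn s hs).lt_or_eq with h | h
    · exact h
    · exfalso
      have hmin : IsLocalMin W (s+1) := by
        have : ∀ t, s < t → W t = 0 := fun t ht =>
          le_antisymm ((hanti s t hs ht.le).trans h.symm.le) (hnn t (hs.trans ht.le))
        filter_upwards [lt_mem_nhds (show s < s + 1 by linarith)] with t ht
        rw [this t ht, this (s+1) (by linarith)]
      have h0 := hmin.hasDerivAt_eq_zero (hW (s+1) (by linarith))
      have h1 := hW' (s+1) (by linarith)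
      have h2 := hJ (s+1) (by linarith)
      rw [h0] at h1
      have : 0 < c * J (s+1) ^ 2 := by positivity
      linarith
  -- 1/W grows
  have hinv : ∀ s, a ≤ s → c * (s - a) * W s ≤ 1 := by
    intro s hs
    have h := anti_aux (f := fun t => c * t - (W t)⁻¹) (f' := fun t => c - (-W' t / W t ^ 2)) (a := a)
      (fun t ht => by
        have h1 : HasDerivAt (fun t => c * t) c t := by
          simpa using (hasDerivAt_id t).const_mul c
        exact h1.sub ((hW t ht).inv (hpos t ht).ne'))
      (fun t ht => by
        have hp := hpos t ht
        have h1 : c ≤ -W' t / W t ^ 2 := by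
          rw [le_div_iff₀ (by positivity)]
          have h2 := hW' t ht
          have h3 : W t ^ 2 ≤ J t ^ 2 := by
            apply sq_le_sq.2
            exact (hWJ t ht).trans (le_abs_self _)
          nlinarith
        linarith) a s le_rfl hs
    have hp := hpos s hs
    have h4 : 0 < (W a)⁻¹ := inv_pos.2 (hpos a le_rfl)
    have h5 : c * (s - a) ≤ (W s)⁻¹ := by linarith
    calc c * (s - a) * W s ≤ (W s)⁻¹ * W s := by gcongr
      _ = 1 := inv_mul_cancel₀ hp.ne'
  -- bound W ≤ (2/c)/s
  set s₁ := max 1 (2 * |a|) with hs₁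
  have ha1 : a ≤ s₁ := by
    have := le_max_right 1 (2 * |a|)
    have := le_abs_self a
    have := abs_nonneg a
    linarith
  have hWs : ∀ s, s₁ ≤ s → W s ≤ 2 / c * s ^ (-1 : ℝ) := by
    intro s hs
    have h1 : 1 ≤ s := (le_max_left _ _).trans hs
    have h2 : 2 * |a| ≤ s := (le_max_right _ _).trans hs
    have h3 := hinv s (ha1.trans hs)
    have h4 := hpos s (ha1.trans hs)
    have h5 : s / 2 ≤ s - a := by have := le_abs_self a; linarith
    rw [rpow_neg_one, ← div_eq_mul_inv, le_div_iff₀ (by linarith), le_div_iff₀ hc]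
    have : c * (s/2) * W s ≤ c * (s - a) * W s := by gcongr
    linarith
  refine ⟨fun s => -(1/c) * (s ^ (1-δ) * W s) - ((1/c) * ((1-δ) * (2/c)) + 1)/δ * s ^ (-δ),
    fun s => -(1/c) * ((1-δ) * s ^ (1-δ-1) * W s + s ^ (1-δ) * W' s) -
      ((1/c) * ((1-δ) * (2/c)) + 1)/δ * (-δ * s ^ (-δ-1)), s₁, ha1, le_max_left _ _, ?_⟩
  intro s hs
  have h1 : 1 ≤ s := (le_max_left _ _).trans hs
  have h0 : 0 < s := by linarith
  have has := ha1.trans hs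
  refine ⟨?_, ?_, ?_⟩
  · have e1 := hasDerivAt_rpow_const (x := s) (p := 1-δ) (Or.inl h0.ne')
    have e2 := hasDerivAt_rpow_const (x := s) (p := -δ) (Or.inl h0.ne')
    exact ((e1.mul (hW s has)).const_mul _).sub (e2.const_mul _)
  · have hj := hJ s has
    have k1 : J s ^ (1+δ) ≤ J s ^ 2 * s ^ (1-δ) + s ^ (-δ-1) := by
      rcases le_total (J s) s⁻¹ with h | h
      · have : J s ^ (1+δ) ≤ s⁻¹ ^ (1+δ) := by
          apply rpow_le_rpow hj.le h; linarith
        rw [inv_rpow h0.le, ← rpow_neg h0.le, show -(1+δ) = -δ-1 by ring] at this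
        have : 0 ≤ J s ^ 2 * s ^ (1-δ) := by positivity
        linarith
      · have : J s ^ (1+δ) = J s ^ 2 * ((J s)⁻¹) ^ (1-δ) := by
          rw [inv_rpow hj.le, ← rpow_neg hj.le, ← rpow_natCast, ← rpow_add hj]
          congr 1; push_cast; ring
        rw [this]
        have h2 : (J s)⁻¹ ^ (1-δ) ≤ s ^ (1-δ) := by
          apply rpow_le_rpow (by positivity) _ (by linarith)
          exact inv_le_of_inv_le₀ h0 h
        have h3 : 0 ≤ s ^ (-δ-1) := by positivity
        have := mul_le_mul_of_nonneg_left h2 (sq_nonneg (J s))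
        linarith
    have k2 : s ^ (1-δ-1) * W s ≤ 2/c * s ^ (-δ-1) := by
      have : s ^ (-δ-1) = s ^ (1-δ-1) * s ^ (-1:ℝ) := by
        rw [← rpow_add h0]; congr 1; ring
      rw [this]
      have := mul_le_mul_of_nonneg_left (hWs s hs) (show 0 ≤ s ^ (1-δ-1) by positivity)
      linarith
    have k3 : s ^ (1-δ) * W' s ≤ s ^ (1-δ) * (-c * J s ^ 2) :=
      mul_le_mul_of_nonneg_left (hW' s has) (by positivity)
    have k4 : (1/c) * ((1-δ) * (s ^ (1-δ-1) * W s)) ≤ (1/c) * ((1-δ) * (2/c * s ^ (-δ-1))) := by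
      have : 0 ≤ 1 - δ := by linarith
      gcongr
    have k5 : (1/c) * (s ^ (1-δ) * W' s) ≤ (1/c) * (s ^ (1-δ) * (-c * J s ^ 2)) := by
      gcongr
    have k6 : (1/c) * (s ^ (1-δ) * (-c * J s ^ 2)) = - (J s ^ 2 * s ^ (1-δ)) := by
      field_simp
    have k7 : ((1/c) * ((1-δ) * (2/c)) + 1)/δ * (-δ * s ^ (-δ-1)) =
       - ((1/c) * ((1-δ) * (2/c * s ^ (-δ-1)))) - s ^ (-δ-1) := by
      field_simp
      ring
    beta_reduce
    rw [k7]
    linarith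
  · have := hpos s has
    have h3 : 0 < 1 - δ := by linarith
    have t1 : 0 ≤ (1/c) * (s ^ (1-δ) * W s) := by positivity
    have t2 : 0 ≤ ((1/c) * ((1-δ) * (2/c)) + 1)/δ * s ^ (-δ) := by positivity
    linarith

/-- coercivity -/
lemma coer (Y : ℕ → ℝ) (n : ℕ) (h0 : Y 0 = 0) :
    (∑ j ∈ Finset.range n, |Y (j+1)|) ^ 2 ≤
      ((n:ℝ)+1) ^ 4 * ∑ j ∈ Finset.range (n+1), (Y (j+1) - Y j) ^ 2 := by
  set S := ∑ j ∈ Finset.range (n+1), (Y (j+1) - Y j) ^ 2 with hS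
  have hSn : 0 ≤ S := Finset.sum_nonneg (fun _ _ => sq_nonneg _)
  have h1 : ∀ j, j < n + 1 → |Y (j+1) - Y j| ≤ √S := by
    intro j hj
    apply abs_le_sqrt
    exact Finset.single_le_sum (f := fun j => (Y (j+1) - Y j) ^ 2) (fun _ _ => sq_nonneg _) (Finset.mem_range.2 hj)
  have h2 : ∀ j, j ≤ n + 1 → |Y j| ≤ j * √S := by
    intro j
    induction j with
    | zero => intro _; simp [h0]
    | succ j ih =>
      intro hj
      have a1 := ih (by omega)
      have a2 := h1 j (by omega)
      have a3 : |Y (j+1)| ≤ |Y (j+1) - Y j| + |Y j| := by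
        simpa using abs_add_le (Y (j+1) - Y j) (Y j)
      push_cast
      linarith
  have h3 : ∑ j ∈ Finset.range n, |Y (j+1)| ≤ ((n:ℝ)+1)^2 * √S := by
    calc ∑ j ∈ Finset.range n, |Y (j+1)| ≤ ∑ j ∈ Finset.range n, ((n:ℝ)+1) * √S := by
          apply Finset.sum_le_sum
          intro j hj
          have hj := Finset.mem_range.1 hj
          refine (h2 (j+1) (by omega)).trans ?_
          have : ((j+1 : ℕ) : ℝ) ≤ (n:ℝ)+1 := by exact_mod_cast (by omega : j+1 ≤ n+1)
          gcongr
      _ = n * (((n:ℝ)+1) * √S) := by simp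
      _ ≤ ((n:ℝ)+1)^2 * √S := by
          have := sqrt_nonneg S
          have : 0 ≤ ((n:ℝ)+1) * √S := by positivity
          nlinarith
  calc _ ≤ (((n:ℝ)+1)^2 * √S)^2 := by gcongr
    _ = ((n:ℝ)+1)^4 * (√S)^2 := by ring
    _ = _ := by rw [sq_sqrt hSn]

lemma getQ {n : ℕ} (hn : 1 ≤ n) {β c₁ C δ a : ℝ} (hβ : 0 < β) (hc₁ : 0 < c₁) (hC : 0 < C)
    (hδ : 0 < δ) (hδ1 : δ < 1) (σ : ℕ → ℝ) (h0 : σ 0 = 0) (hk : σ (n+1) = 0)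
    (hσ : ∀ j, j < n → |σ (j+1)| = 1) (ζ ζ' Y : ℕ → ℝ → ℝ) (J : ℝ → ℝ)
    (hY : ∀ j s, Y j s = σ j * exp (-β * (ζ (j+1) s - ζ j s)))
    (hJ : ∀ s, J s = ∑ j ∈ Finset.range n, exp (-β * (ζ (j+2) s - ζ (j+1) s)))
    (hderiv : ∀ j, j < n+1 → ∀ s, a ≤ s → HasDerivAt (ζ (j+1)) (ζ' (j+1) s) s)
    (hode : ∀ s, a ≤ s → ∀ j, j < n+1 →
      |ζ' (j+1) s / c₁ - (Y (j+1) s - Y j s)| ≤ C * J s ^ (1+δ))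
    (hlim : Tendsto J atTop (nhds 0)) :
    ∃ (Q Q' : ℝ → ℝ) (s₁ : ℝ), a ≤ s₁ ∧ 1 ≤ s₁ ∧ ∀ s, s₁ ≤ s →
      HasDerivAt Q (Q' s) s ∧ J s ^ (1 + δ) ≤ Q' s ∧ Q s ≤ 0 := by
  have hY0 : ∀ s, Y 0 s = 0 := fun s => by rw [hY, h0, zero_mul]
  have hYk : ∀ s, Y (n+1) s = 0 := fun s => by rw [hY, hk, zero_mul]
  have hYabs : ∀ j, j < n → ∀ s, |Y (j+1) s| = exp (-β * (ζ (j+2) s - ζ (j+1) s)) := by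
    intro j hj s
    rw [hY, abs_mul, hσ j hj, one_mul, abs_of_pos (exp_pos _)]
  have hJY : ∀ s, J s = ∑ j ∈ Finset.range n, |Y (j+1) s| := by
    intro s
    rw [hJ]
    exact Finset.sum_congr rfl (fun j hj => (hYabs j (Finset.mem_range.1 hj) s).symm)
  have hJpos : ∀ s, 0 < J s := by
    intro s
    rw [hJ]
    exact Finset.sum_pos (fun j _ => exp_pos _) ⟨0, Finset.mem_range.2 (by omega)⟩
  have hYJ : ∀ j, j ≤ n+1 → ∀ s, |Y j s| ≤ J s := by
    intro j hj s
    rcases j with _ | j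
    · rw [hY0]; simpa using (hJpos s).le
    · rcases (show j < n ∨ j = n by omega) with h | h
      · rw [hJY]
        exact Finset.single_le_sum (f := fun j => |Y (j+1) s|) (fun _ _ => abs_nonneg _)
          (Finset.mem_range.2 h)
      · rw [h, hYk]; simpa using (hJpos s).le
  have hev : ∀ᶠ s in atTop, C * J s ^ δ * (2 * ((n:ℝ)+1)) ≤ 1 / (2 * ((n:ℝ)+1)^4) := by
    have h1 : Tendsto (fun s => C * J s ^ δ * (2 * ((n:ℝ)+1))) atTop (nhds (C * 0 ^ δ * (2 * ((n:ℝ)+1)))) :=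
      ((hlim.rpow_const (Or.inr hδ.le)).const_mul C).mul_const _
    rw [zero_rpow hδ.ne'] at h1
    apply h1.eventually_le_const
    have : 0 < 1 / (2 * ((n:ℝ)+1)^4) := by positivity
    simpa using this
  obtain ⟨b, hb⟩ := eventually_atTop.1 hev
  have key := decay_aux (W := fun s => -∑ j ∈ Finset.range n, Y (j+1) s)
    (W' := fun s => -∑ j ∈ Finset.range n, Y (j+1) s * (-β * (ζ' (j+2) s - ζ' (j+1) s)))
    (J := J) (c := β * c₁ / (2 * ((n:ℝ)+1)^4)) (a := max a b) (δ := δ) (by positivity) hδ hδ1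
    ?_ ?_ (fun s _ => hJpos s) ?_ hlim
  · obtain ⟨Q, Q', s₁, h1, h2, h3⟩ := key
    exact ⟨Q, Q', s₁, (le_max_left _ _).trans h1, h2, h3⟩
  · intro s hs
    have hs := (le_max_left _ _).trans hs
    refine HasDerivAt.fun_neg (HasDerivAt.fun_sum fun j hj => ?_)
    have hj := Finset.mem_range.1 hj
    have d := (((hderiv (j+1) (by omega) s hs).sub (hderiv j (by omega) s hs)).const_mul (-β)).exp.const_mul (σ (j+1))
    have : Y (j+1) = fun s => σ (j+1) * exp (-β * (ζ (j+1+1) s - ζ (j+1) s)) := by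
      funext t; exact hY _ _
    rw [this]
    refine d.congr_deriv ?_
    simp only [Pi.sub_apply]
    ring
  · intro s hs
    have hbs := (le_max_right _ _).trans hs
    have hs := (le_max_left _ _).trans hs
    have hj := hJpos s
    have e1 := sbp (fun j => ζ' (j+1) s) (fun j => Y j s) n
    simp only [hY0, hYk, mul_zero, sub_zero, zero_sub] at e1
    have e2 : -∑ j ∈ Finset.range n, Y (j+1) s * (-β * (ζ' (j+2) s - ζ' (j+1) s))
        = -β * ∑ j ∈ Finset.range (n+1), ζ' (j+1) s * (Y (j+1) s - Y j s) := by
      rw [e1, ← Finset.sum_neg_distrib, ← Finset.sum_neg_distrib, Finset.mul_sum]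
      apply Finset.sum_congr rfl
      intro j _
      ring
    have e3 : c₁ * (∑ j ∈ Finset.range (n+1), ((Y (j+1) s - Y j s)^2 - C * J s ^ (1+δ) * (2 * J s)))
        ≤ ∑ j ∈ Finset.range (n+1), ζ' (j+1) s * (Y (j+1) s - Y j s) := by
      rw [Finset.mul_sum]
      apply Finset.sum_le_sum
      intro j hj'
      have hj' := Finset.mem_range.1 hj'
      have r1 := hode s hs j hj'
      have r2 : |Y (j+1) s - Y j s| ≤ 2 * J s := by
        have := abs_sub (Y (j+1) s) (Y j s)
        have := hYJ j (by omega) s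
        have := hYJ (j+1) (by omega) s
        linarith
      set d := Y (j+1) s - Y j s
      set r := ζ' (j+1) s / c₁ - d with hr
      have r3 : ζ' (j+1) s = c₁ * (d + r) := by rw [hr]; field_simp; ring
      rw [r3, mul_assoc c₁]
      apply mul_le_mul_of_nonneg_left _ hc₁.le
      have r4 : |r * d| ≤ C * J s ^ (1+δ) * (2 * J s) := by
        rw [abs_mul]
        gcongr
      have := neg_abs_le (r * d)
      nlinarith
    have e4 := coer (fun j => Y j s) n (hY0 s)
    simp only [← hJY] at e4
    rw [Finset.sum_sub_distrib] at e3
    simp only [Finset.sum_const, Finset.card_range, nsmul_eq_mul] at e3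
    push_cast at e3
    set S := ∑ j ∈ Finset.range (n+1), (Y (j+1) s - Y j s)^2
    have e5 : C * J s ^ (1+δ) * (2 * J s) * ((n:ℝ)+1) ≤ J s ^ 2 * (1 / (2 * ((n:ℝ)+1)^4)) := by
      have : C * J s ^ (1+δ) * (2 * J s) * ((n:ℝ)+1) = J s ^ 2 * (C * J s ^ δ * (2 * ((n:ℝ)+1))) := by
        rw [rpow_add hj, rpow_one]; ring
      rw [this]
      exact mul_le_mul_of_nonneg_left (hb s hbs) (sq_nonneg _)
    have e6 : J s ^ 2 * (1 / ((n:ℝ)+1)^4) ≤ S := by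
      rw [mul_one_div, div_le_iff₀ (by positivity)]
      linarith
    have e7 : J s ^ 2 * (1 / ((n:ℝ)+1)^4) = 2 * (J s ^ 2 * (1 / (2 * ((n:ℝ)+1)^4))) := by
      field_simp
    have e8 : c₁ * (J s ^ 2 * (1 / (2 * ((n:ℝ)+1)^4))) ≤ ∑ j ∈ Finset.range (n+1), ζ' (j+1) s * (Y (j+1) s - Y j s) := by
      refine le_trans ?_ e3
      apply mul_le_mul_of_nonneg_left _ hc₁.le
      linarith
    rw [e2]
    have e9 := mul_le_mul_of_nonneg_left e8 hβ.le
    have e10 : β * (c₁ * (J s ^ 2 * (1 / (2 * ((n:ℝ)+1)^4)))) = β * c₁ / (2 * ((n:ℝ)+1)^4) * J s ^ 2 := by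
      ring
    linarith
  · intro s _
    rw [abs_neg, hJY]
    exact Finset.abs_sum_le_sum_abs _ _

lemma signs {n : ℕ} {β c₁ C δ a : ℝ} (hc₁ : 0 < c₁) (hC : 0 < C)
    (σ : ℕ → ℝ) (h0 : σ 0 = 0) (hk : σ (n+1) = 0)
    (hσ : ∀ j, j < n → σ (j+1) = 1 ∨ σ (j+1) = -1) (ζ ζ' Y : ℕ → ℝ → ℝ) (J : ℝ → ℝ)
    (hY : ∀ j s, Y j s = σ j * exp (-β * (ζ (j+1) s - ζ j s)))
    (hderiv : ∀ j, j < n+1 → ∀ s, a ≤ s → HasDerivAt (ζ (j+1)) (ζ' (j+1) s) s)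
    (hode : ∀ s, a ≤ s → ∀ j, j < n+1 →
      |ζ' (j+1) s / c₁ - (Y (j+1) s - Y j s)| ≤ C * J s ^ (1+δ))
    (hmono : ∀ s, a ≤ s → ∀ j, j < n → ζ (j+1) s < ζ (j+2) s)
    (hdiv : ∀ j, j < n → Tendsto (fun s => ζ (j+2) s - ζ (j+1) s) atTop atTop)
    (Q Q' : ℝ → ℝ) (s₁ : ℝ) (has : a ≤ s₁) (hQ : ∀ s, s₁ ≤ s →
      HasDerivAt Q (Q' s) s ∧ J s ^ (1 + δ) ≤ Q' s ∧ Q s ≤ 0) :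
    ∀ j, j < n → σ (j+1) = -1 := by
  classical
  by_contra! hcon
  obtain ⟨m, hm, hm1⟩ := hcon
  have hm2 : σ (m+1) = 1 := (hσ m hm).resolve_right hm1
  have hle : ∀ j, j ≤ n+1 → σ j ≠ 1 → σ j ≤ 0 := by
    intro j hj h
    rcases j with _ | j
    · exact h0.le
    · rcases (show j < n ∨ j = n by omega) with h' | h'
      · rcases hσ j h' with h'' | h''
        · exact absurd h'' h
        · rw [h'']; norm_num
      · rw [h', hk]
  have ex1 : ∃ i, σ (i+1) = 1 := ⟨m, hm2⟩
  obtain ⟨i, hi, him⟩ : ∃ i, σ (i+1) = 1 ∧ ∀ l < i, σ (l+1) ≠ 1 :=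
    ⟨Nat.find ex1, Nat.find_spec ex1, fun l hl => Nat.find_min ex1 hl⟩
  have hi_le : i ≤ m := by
    by_contra! h
    exact him m h hm2
  have ex2 : ∃ d, σ (i + d + 2) ≠ 1 := ⟨n - 1 - i, by
    rw [show i + (n-1-i) + 2 = n+1 by omega, hk]; norm_num⟩
  obtain ⟨d, hd, hdm⟩ : ∃ d, σ (i+d+2) ≠ 1 ∧ ∀ l < d, σ (i+l+2) = 1 :=
    ⟨Nat.find ex2, Nat.find_spec ex2, fun l hl => not_not.1 (Nat.find_min ex2 hl)⟩
  have hd_le : i + d < n := by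
    by_contra! h
    have := hdm (n - 1 - i) (by omega)
    rw [show i + (n-1-i) + 2 = n+1 by omega, hk] at this
    norm_num at this
  have hd1 : σ (i+d+1) = 1 := by
    rcases d with _ | d
    · exact hi
    · exact hdm d (by omega)
  have hi0 : σ i ≤ 0 := by
    apply hle i (by omega)
    rcases i with _ | i
    · rw [h0]; norm_num
    · exact him i (by omega)
  have hd2 : σ (i+d+2) ≤ 0 := hle _ (by omega) hd
  have hsgn1 : ∀ j s, σ j ≤ 0 → Y j s ≤ 0 := fun j s h => by
    rw [hY]; exact mul_nonpos_of_nonpos_of_nonneg h (exp_pos _).le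
  have hsgn2 : ∀ j s, σ j = 1 → 0 ≤ Y j s := fun j s h => by
    rw [hY, h]; positivity
  have hm' : ∀ s, a ≤ s → ζ (i+1) s ≤ ζ (i+d+1) s := by
    intro s hs
    have : ∀ l, l ≤ d → ζ (i+1) s ≤ ζ (i+l+1) s := by
      intro l
      induction l with
      | zero => intro _; exact le_rfl
      | succ l ih =>
        intro hl
        exact (ih (by omega)).trans (hmono s hs (i+l) (by omega)).le
    exact this d le_rfl
  have hanti := anti_aux (f := fun s => ζ (i+d+1+1) s - ζ (i+1) s - 2 * c₁ * C * Q s)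
    (f' := fun s => ζ' (i+d+1+1) s - ζ' (i+1) s - 2 * c₁ * C * Q' s) (a := s₁)
    (fun s hs => ((hderiv (i+d+1) (by omega) s (has.trans hs)).sub
        (hderiv i (by omega) s (has.trans hs))).sub ((hQ s hs).1.const_mul _))
    (fun s hs => by
      have o1 := (abs_le.1 (hode s (has.trans hs) (i+d+1) (by omega))).2
      have o2 := (abs_le.1 (hode s (has.trans hs) i (by omega))).1
      have q := mul_le_mul_of_nonneg_left (hQ s hs).2.1 hC.le
      have y1 := hsgn1 _ s hd2
      have y2 := hsgn2 _ s hd1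
      have y3 := hsgn1 _ s hi0
      have y4 := hsgn2 _ s hi
      have x1 : ζ' (i+d+1+1) s / c₁ ≤ C * Q' s := by
        have : Y (i+d+1+1) s ≤ 0 := y1
        linarith
      have x2 : -(C * Q' s) ≤ ζ' (i+1) s / c₁ := by linarith
      rw [div_le_iff₀ hc₁] at x1
      rw [le_div_iff₀ hc₁] at x2
      linarith)
  have hdv := (hdiv (i+d) hd_le).eventually_gt_atTop (ζ (i+d+1+1) s₁ - ζ (i+1) s₁ - 2 * c₁ * C * Q s₁)
  obtain ⟨s, hs1, hs2⟩ := (hdv.and (eventually_ge_atTop s₁)).exists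
  have f1 := hanti s₁ s le_rfl hs2
  have f2 := hm' s (has.trans hs2)
  have f3 : 2 * c₁ * C * Q s ≤ 0 :=
    mul_nonpos_of_nonneg_of_nonpos (by positivity) (hQ s hs2).2.2
  have : ζ (i+d+2) s = ζ (i+d+1+1) s := rfl
  linarith

lemma final {n : ℕ} {β c₁ C δ a : ℝ} (hβ : 0 < β) (hc₁ : 0 < c₁) (hC : 0 < C)
    (σ : ℕ → ℝ) (h0 : σ 0 = 0) (hk : σ (n+1) = 0)
    (hσ : ∀ j, j < n → σ (j+1) = -1) (ζ ζ' Y : ℕ → ℝ → ℝ) (J : ℝ → ℝ)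
    (hY : ∀ j s, Y j s = σ j * exp (-β * (ζ (j+1) s - ζ j s)))
    (hderiv : ∀ j, j < n+1 → ∀ s, a ≤ s → HasDerivAt (ζ (j+1)) (ζ' (j+1) s) s)
    (hode : ∀ s, a ≤ s → ∀ j, j < n+1 →
      |ζ' (j+1) s / c₁ - (Y (j+1) s - Y j s)| ≤ C * J s ^ (1+δ))
    (Q Q' : ℝ → ℝ) (s₁ : ℝ) (has : a ≤ s₁) (hs₁ : 1 ≤ s₁) (hQ : ∀ s, s₁ ≤ s →
      HasDerivAt Q (Q' s) s ∧ J s ^ (1 + δ) ≤ Q' s ∧ Q s ≤ 0) :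
    ∃ C₀ > (0:ℝ), ∀ j, j < n+1 → ∀ s, s₁ ≤ s →
      |ζ (j+1) s - ((j:ℝ) - (n:ℝ)/2) * (1/β) * log s| ≤ C₀ := by
  set q : ℕ → ℝ := fun j => 1 / (2 * β * c₁) * (j * ((n:ℝ) + 1 - j)) with hq
  have hqpos : ∀ j, j < n → 0 < q (j+1) := by
    intro j hj
    have : (j:ℝ) < n := by exact_mod_cast hj
    simp only [hq]; push_cast
    have : (0:ℝ) < n + 1 - (j+1) := by linarith
    positivity
  set α : ℕ → ℝ := fun j => ∑ m ∈ Finset.range j, -(1/β) * log (q m) with hα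
  have hαs : ∀ j, α (j+1) - α j = -(1/β) * log (q j) := by
    intro j; simp only [hα, Finset.sum_range_succ]; ring
  set u : ℕ → ℝ → ℝ := fun j s => ζ (j+1) s - (((j:ℝ) - (n:ℝ)/2) * (1/β) * log s + α (j+1)) with hu
  set u' : ℕ → ℝ → ℝ := fun j s => ζ' (j+1) s - ((j:ℝ) - (n:ℝ)/2) * (1/β) * s⁻¹ with hu'
  have hud : ∀ j, j < n+1 → ∀ s, s₁ ≤ s → HasDerivAt (u j) (u' j s) s := by
    intro j hj s hs
    have hs0 : s ≠ 0 := by intro h; linarith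
    exact (hderiv j hj s (has.trans hs)).sub (((hasDerivAt_log hs0).const_mul _).add_const _)
  set N : ℝ → ℝ := fun s => √(1 + ∑ j ∈ Finset.range (n+1), u j s ^ 2) with hN
  have hD1 : ∀ s, 0 < 1 + ∑ j ∈ Finset.range (n+1), u j s ^ 2 := fun s => by
    have : 0 ≤ ∑ j ∈ Finset.range (n+1), u j s ^ 2 := Finset.sum_nonneg fun _ _ => sq_nonneg _
    linarith
  have hNpos : ∀ s, 0 < N s := fun s => sqrt_pos.2 (hD1 s)
  have huN : ∀ j, j < n+1 → ∀ s, |u j s| ≤ N s := by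
    intro j hj s
    apply abs_le_sqrt
    have := Finset.single_le_sum (f := fun j => u j s ^ 2) (fun _ _ => sq_nonneg _) (Finset.mem_range.2 hj)
    linarith
  have hNd : ∀ s, s₁ ≤ s → HasDerivAt N ((∑ j ∈ Finset.range (n+1), 2 * u j s * u' j s) / (2 * N s)) s := by
    intro s hs
    refine HasDerivAt.sqrt (HasDerivAt.const_add 1 (HasDerivAt.fun_sum fun j hj => ?_)) (hD1 s).ne'
    have := (hud j (Finset.mem_range.1 hj) s hs).fun_pow 2
    simpa using this
  have hNle : ∀ s, s₁ ≤ s → (∑ j ∈ Finset.range (n+1), 2 * u j s * u' j s) / (2 * N s)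
      ≤ c₁ * C * ((n:ℝ)+1) * Q' s := by
    intro s hs
    have hs0 : 0 < s := by linarith
    have hNp := hNpos s
    rw [div_le_iff₀ (by positivity)]
    have Q1 := (hQ s hs).2.1
    set Z : ℕ → ℝ := fun j => -(q j * s⁻¹) with hZ
    have hZ' : ∀ j : ℕ, ((j:ℝ) - (n:ℝ)/2) * (1/β) * s⁻¹ = c₁ * (Z (j+1) - Z j) := by
      intro j
      simp only [hZ, hq]
      push_cast
      field_simp
      ring
    have t1 : ∀ j, j < n+1 → 2 * u j s * u' j s ≤
        2 * c₁ * (u j s * ((Y (j+1) s - Z (j+1)) - (Y j s - Z j))) + 2 * c₁ * (N s * (C * Q' s)) := by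
      intro j hj
      have o := hode s (has.trans hs) j hj
      set r := ζ' (j+1) s / c₁ - (Y (j+1) s - Y j s) with hr
      have r3 : ζ' (j+1) s = c₁ * (Y (j+1) s - Y j s + r) := by rw [hr]; field_simp; ring
      have r4 : u' j s = c₁ * (((Y (j+1) s - Z (j+1)) - (Y j s - Z j)) + r) := by
        simp only [hu']
        rw [hZ', r3]; ring
      have r5 : u j s * r ≤ N s * (C * Q' s) := by
        refine (le_abs_self _).trans ?_
        rw [abs_mul]
        have := huN j hj s
        have o' : |r| ≤ C * Q' s := o.trans (by gcongr)
        gcongr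
      rw [r4]
      have := mul_le_mul_of_nonneg_left r5 (show 0 ≤ 2 * c₁ by positivity)
      linarith
    have t2 := Finset.sum_le_sum (fun j hj => t1 j (Finset.mem_range.1 hj))
    rw [Finset.sum_add_distrib, ← Finset.mul_sum] at t2
    have e1 := sbp (fun j => u j s) (fun j => Y j s - Z j) n
    have z0 : Y 0 s - Z 0 = 0 := by simp [hY, h0, hZ, hq]
    have zk : Y (n+1) s - Z (n+1) = 0 := by simp [hY, hk, hZ, hq]
    rw [z0, zk] at e1
    have t3 : 0 ≤ ∑ j ∈ Finset.range n, (u (j+1) s - u j s) * (Y (j+1) s - Z (j+1)) := by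
      apply Finset.sum_nonneg
      intro j hj
      have hj := Finset.mem_range.1 hj
      have hqp := hqpos j hj
      have z1 : Z (j+1) = -exp (-β * ((1/β) * log s + (α (j+2) - α (j+1)))) := by
        rw [hαs]
        have : -β * ((1/β) * log s + -(1/β) * log (q (j+1))) = log (q (j+1)) - log s := by
          field_simp; ring
        rw [this, exp_sub, exp_log hqp, exp_log hs0]
        simp only [hZ]; rw [div_eq_mul_inv]
      have z2 : u (j+1) s - u j s = (ζ (j+2) s - ζ (j+1) s) - ((1/β) * log s + (α (j+2) - α (j+1))) := by
        simp only [hu]; push_cast; ring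
      have z3 : Y (j+1) s = -exp (-β * (ζ (j+2) s - ζ (j+1) s)) := by
        rw [hY, hσ j hj]; ring
      rw [z1, z2, z3]
      set A := ζ (j+2) s - ζ (j+1) s
      set B := (1/β) * log s + (α (j+2) - α (j+1))
      rcases le_total A B with h | h
      · have : exp (-β * B) ≤ exp (-β * A) := exp_le_exp.2 (by nlinarith)
        nlinarith
      · have : exp (-β * A) ≤ exp (-β * B) := exp_le_exp.2 (by nlinarith)
        nlinarith
    simp only [Finset.sum_const, Finset.card_range, nsmul_eq_mul] at t2
    push_cast at t2
    have t4 : 2 * c₁ * ∑ j ∈ Finset.range (n+1), u j s * ((Y (j+1) s - Z (j+1)) - (Y j s - Z j)) ≤ 0 := by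
      apply mul_nonpos_of_nonneg_of_nonpos (by positivity)
      rw [e1]
      linarith
    linarith
  have hanti := anti_aux (f := fun s => N s - c₁ * C * ((n:ℝ)+1) * Q s)
    (f' := fun s => (∑ j ∈ Finset.range (n+1), 2 * u j s * u' j s) / (2 * N s) - c₁ * C * ((n:ℝ)+1) * Q' s) (a := s₁)
    (fun s hs => (hNd s hs).sub ((hQ s hs).1.const_mul _))
    (fun s hs => by have := hNle s hs; linarith)
  have hA : ∀ j, j < n+1 → |α (j+1)| ≤ ∑ j ∈ Finset.range (n+1), |α (j+1)| := fun j hj =>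
    Finset.single_le_sum (f := fun j => |α (j+1)|) (fun _ _ => abs_nonneg _) (Finset.mem_range.2 hj)
  have hpos1 : 0 ≤ c₁ * C * ((n:ℝ)+1) := by positivity
  refine ⟨N s₁ - c₁ * C * ((n:ℝ)+1) * Q s₁ + ∑ j ∈ Finset.range (n+1), |α (j+1)|, ?_, ?_⟩
  · have := hNpos s₁
    have := mul_nonpos_of_nonneg_of_nonpos hpos1 (hQ s₁ le_rfl).2.2
    have : 0 ≤ ∑ j ∈ Finset.range (n+1), |α (j+1)| := Finset.sum_nonneg fun _ _ => abs_nonneg _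
    linarith
  · intro j hj s hs
    have f1 := hanti s₁ s le_rfl hs
    have f2 := mul_nonpos_of_nonneg_of_nonpos hpos1 (hQ s hs).2.2
    have f3 := huN j hj s
    have f4 := hA j hj
    have f5 : ζ (j+1) s - ((j:ℝ) - (n:ℝ)/2) * (1/β) * log s = u j s + α (j+1) := by
      simp only [hu]; ring
    rw [f5]
    have := abs_add_le (u j s) (α (j+1))
    linarith

/-- Quantitative asymptotics of the solitons' centers: under the perturbed Toda-lattice
system, `ζ_i(s) = (i - (k+1)/2) ((p-1)/2) log s + O(1)` as `s → ∞`.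
(The convention that the boundary terms are absent is implemented by `e 0 = 0` and
`e (k+1) = 0`.) -/
theorem toda_centers_asymptotics (p : ℝ) (hp : 1 < p) (k : ℕ) (hk : 2 ≤ k)
    (c₁ δ₀ C s₀ : ℝ) (hc₁ : 0 < c₁) (hδ₀ : 0 < δ₀) (hC : 0 < C)
    (e : ℕ → ℝ) (he0 : e 0 = 0) (hek : e (k+1) = 0)
    (he : ∀ i, 1 ≤ i → i ≤ k → e i = 1 ∨ e i = -1)
    (ζ ζ' : ℕ → ℝ → ℝ)
    (hderiv : ∀ i, 1 ≤ i → i ≤ k → ∀ s, s₀ ≤ s → HasDerivAt (ζ i) (ζ' i s) s)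
    (hcont : ∀ i, 1 ≤ i → i ≤ k → ContinuousOn (ζ' i) (Set.Ici s₀))
    (hmono : ∀ s, s₀ ≤ s → ∀ i, 1 ≤ i → i < k → ζ i s < ζ (i+1) s)
    (hdiv : ∀ i, 1 ≤ i → i < k →
      Tendsto (fun s => ζ (i+1) s - ζ i s) atTop atTop)
    (hode : ∀ s, s₀ ≤ s → ∀ i, 1 ≤ i → i ≤ k →
      |ζ' i s / c₁ + e (i-1) * e i * Real.exp (-(2/(p-1)) * (ζ i s - ζ (i-1) s))
        - e i * e (i+1) * Real.exp (-(2/(p-1)) * (ζ (i+1) s - ζ i s))|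
      ≤ C * (∑ j ∈ Finset.Icc 1 (k-1),
          Real.exp (-(2/(p-1)) * (ζ (j+1) s - ζ j s))) ^ (1+δ₀)) :
    ∃ C₀ > (0:ℝ), ∃ s₁, s₀ ≤ s₁ ∧ ∀ i, 1 ≤ i → i ≤ k → ∀ s, s₁ ≤ s →
      |ζ i s - ((i : ℝ) - ((k : ℝ)+1)/2) * ((p-1)/2) * Real.log s| ≤ C₀ := by
  obtain ⟨n, rfl⟩ : ∃ n, k = n + 1 := ⟨k - 1, by omega⟩
  have hn : 1 ≤ n := by omega
  set β := 2/(p-1) with hβd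
  have hp1 : 0 < p - 1 := by linarith
  have hβ : 0 < β := by positivity
  set J : ℝ → ℝ := fun s => ∑ j ∈ Finset.range n, exp (-β * (ζ (j+2) s - ζ (j+1) s)) with hJd
  have hJ' : ∀ s, ∑ j ∈ Finset.Icc 1 (n+1-1), exp (-β * (ζ (j+1) s - ζ j s)) = J s := by
    intro s
    rw [show n + 1 - 1 = n by omega, show Finset.Icc 1 n = Finset.Ico 1 (n+1) from rfl, Finset.sum_Ico_eq_sum_range]
    simp only [hJd, Nat.add_sub_cancel]
    apply Finset.sum_congr rfl
    intro j _
    rw [show 1 + j + 1 = j + 2 by omega, show 1 + j = j + 1 by omega]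
  have hlim : Tendsto J atTop (nhds 0) := by
    have : Tendsto J atTop (nhds (∑ j ∈ Finset.range n, (0:ℝ))) := by
      apply tendsto_finsetSum
      intro j hj
      have hj := Finset.mem_range.1 hj
      apply tendsto_exp_atBot.comp
      exact (hdiv (j+1) (by omega) (by omega)).const_mul_atTop_of_neg (by linarith)
    simpa using this
  obtain ⟨b, hb⟩ := eventually_atTop.1 (hlim.eventually_le_const (show (0:ℝ) < 1 by norm_num))
  have hJpos : ∀ s, 0 < J s := by
    intro s
    exact Finset.sum_pos (fun j _ => exp_pos _) ⟨0, Finset.mem_range.2 (by omega)⟩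
  set a := max s₀ b with ha
  have ha0 : s₀ ≤ a := le_max_left _ _
  set δ := min δ₀ (1/2) with hδ
  have hδp : 0 < δ := lt_min hδ₀ (by norm_num)
  have hδ1 : δ < 1 := (min_le_right _ _).trans_lt (by norm_num)
  set σ : ℕ → ℝ := fun j => e j * e (j+1) with hσd
  have hσ0 : σ 0 = 0 := by simp [hσd, he0]
  have hσk : σ (n+1) = 0 := by simp [hσd, hek]
  have hσ : ∀ j, j < n → σ (j+1) = 1 ∨ σ (j+1) = -1 := by
    intro j hj
    rcases he (j+1) (by omega) (by omega) with h1 | h1 <;>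
    rcases he (j+1+1) (by omega) (by omega) with h2 | h2 <;> simp [hσd, h1, h2]
  have hσabs : ∀ j, j < n → |σ (j+1)| = 1 := by
    intro j hj
    rcases hσ j hj with h | h <;> simp [h]
  set Y : ℕ → ℝ → ℝ := fun j s => σ j * exp (-β * (ζ (j+1) s - ζ j s)) with hYd
  have hderiv' : ∀ j, j < n+1 → ∀ s, a ≤ s → HasDerivAt (ζ (j+1)) (ζ' (j+1) s) s :=
    fun j hj s hs => hderiv (j+1) (by omega) (by omega) s (ha0.trans hs)
  have hode' : ∀ s, a ≤ s → ∀ j, j < n+1 →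
      |ζ' (j+1) s / c₁ - (Y (j+1) s - Y j s)| ≤ C * J s ^ (1+δ) := by
    intro s hs j hj
    have h := hode s (ha0.trans hs) (j+1) (by omega) (by omega)
    rw [hJ', show j + 1 - 1 = j by omega] at h
    have h2 : J s ^ (1+δ₀) ≤ J s ^ (1+δ) := by
      apply rpow_le_rpow_of_exponent_ge (hJpos s) (hb s ((le_max_right _ _).trans hs))
      have := min_le_left δ₀ (1/2)
      linarith
    have h3 := h.trans (mul_le_mul_of_nonneg_left h2 hC.le)
    have h4 : ζ' (j+1) s / c₁ - (Y (j+1) s - Y j s) =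
        ζ' (j+1) s / c₁ + e j * e (j+1) * exp (-β * (ζ (j+1) s - ζ j s))
        - e (j+1) * e (j+1+1) * exp (-β * (ζ (j+1+1) s - ζ (j+1) s)) := by
      change _ - (e (j+1) * e (j+1+1) * _ - e j * e (j+1) * _) = _
      ring
    rw [h4]
    exact h3
  obtain ⟨Q, Q', s₁, h1, h2, h3⟩ := getQ hn hβ hc₁ hC hδp hδ1 σ hσ0 hσk hσabs ζ ζ' Y J
    (fun _ _ => rfl) (fun _ => rfl) hderiv' hode' hlim
  have hs := signs hc₁ hC σ hσ0 hσk hσ ζ ζ' Y J (fun _ _ => rfl) hderiv' hode'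
    (fun s hs j hj => hmono s (ha0.trans hs) (j+1) (by omega) (by omega))
    (fun j hj => hdiv (j+1) (by omega) (by omega)) Q Q' s₁ h1 h3
  obtain ⟨C₀, hC₀, hfin⟩ := final hβ hc₁ hC σ hσ0 hσk hs ζ ζ' Y J (fun _ _ => rfl) hderiv' hode'
    Q Q' s₁ h1 h2 h3
  refine ⟨C₀, hC₀, s₁, ha0.trans h1, ?_⟩
  intro i hi hik s hs'
  obtain ⟨j, rfl⟩ : ∃ j, i = j + 1 := ⟨i - 1, by omega⟩
  have := hfin j (by omega) s hs'
  convert this using 3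
  rw [hβd, one_div_div]
  push_cast
  ring
end

section
/- Let p > 1 and set β = 2/(p−1). Let k ≥ 2 be an integer, c₁ > 0, δ₀ > 0, C > 0, s₀ ∈ ℝ. Let L₁, …, L_{k−1} : [s₀, ∞) → ℝ be C¹ functions with L_i(s) → ∞ as s → ∞ for each i, and assume that for all s ≥ s₀ and all i = 1, …, k−1, |L_i'(s)/c₁ + E_{i−1}(s) − 2E_i(s) + E_{i+1}(s)| ≤ C (Σ_{j=1}^{k−1} E_j(s))^{1+δ₀}, where E_i(s) = e^{−β L_i(s)} for 1 ≤ i ≤ k−1 and E₀ ≡ E_k ≡ 0. Then there exist C₀ > 0 and s₁ ≥ s₀ such that for all i = 1, …, k−1 and all s ≥ s₁, |L_i(s) − L₁(s)| ≤ C₀. -/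
open Real Filter

lemma aux_sbp (e : ℕ → ℝ) (n : ℕ) :
    ∑ j ∈ Finset.range n, e (j+1) * (2 * e (j+1) - e j - e (j+2)) =
      ∑ j ∈ Finset.range (n+1), (e (j+1) - e j)^2 + e 0 * (e 1 - e 0)
        - e (n+1) * (e (n+1) - e n) := by
  induction n with
  | zero => simp; ring
  | succ n ih => rw [Finset.sum_range_succ, ih, Finset.sum_range_succ _ (n+1)]; ring

lemma aux_coer (e : ℕ → ℝ) (n : ℕ) (h0 : e 0 = 0) (hn : e (n+1) = 0) :
    (∑ j ∈ Finset.range n, e (j+1))^2 ≤ ((n:ℝ)+1)^3 *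
      ∑ j ∈ Finset.range n, e (j+1) * (2 * e (j+1) - e j - e (j+2)) := by
  rw [aux_sbp, h0, hn]
  set D := ∑ j ∈ Finset.range (n+1), (e (j+1) - e j)^2 with hD
  have hD0 : 0 ≤ D := Finset.sum_nonneg fun _ _ => sq_nonneg _
  have h1 : ∀ i, i < n → e (i+1)^2 ≤ ((n:ℝ)+1) * D := by
    intro i hi
    have h2 : e (i+1) = ∑ j ∈ Finset.range (i+1), (e (j+1) - e j) := by
      rw [Finset.sum_range_sub, h0, sub_zero]
    have h3 := sq_sum_le_card_mul_sum_sq (s := Finset.range (i+1)) (f := fun j => e (j+1) - e j)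
    rw [← h2] at h3
    have h4 : ∑ j ∈ Finset.range (i+1), (e (j+1) - e j)^2 ≤ D :=
      Finset.sum_le_sum_of_subset_of_nonneg
        (Finset.range_subset_range.2 (by omega)) fun _ _ _ => sq_nonneg _
    refine h3.trans ?_
    have h5 : ((Finset.range (i+1)).card : ℝ) ≤ (n:ℝ)+1 := by
      rw [Finset.card_range]; push_cast
      have : (i:ℝ) ≤ n := by exact_mod_cast hi.le
      linarith
    exact mul_le_mul h5 h4 (Finset.sum_nonneg fun _ _ => sq_nonneg _) (by positivity)
  have h6 := sq_sum_le_card_mul_sum_sq (s := Finset.range n) (f := fun j => e (j+1))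
  have h7 : ∑ j ∈ Finset.range n, e (j+1)^2 ≤ n * (((n:ℝ)+1) * D) := by
    have := Finset.sum_le_card_nsmul (Finset.range n) (fun j => e (j+1)^2) (((n:ℝ)+1) * D)
      (fun j hj => h1 j (Finset.mem_range.1 hj))
    simpa using this
  rw [Finset.card_range] at h6
  have h8 : (n:ℝ) * ∑ j ∈ Finset.range n, e (j+1)^2 ≤ n * (n * (((n:ℝ)+1) * D)) := by gcongr
  have hn0 : (0:ℝ) ≤ n := by positivity
  have h9 : (n:ℝ) * (n * (((n:ℝ)+1) * D)) ≤ (n+1)^3 * D := by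
    have : (n:ℝ) * (n * (((n:ℝ)+1) * D)) = (n * n * (n+1)) * D := by ring
    rw [this]
    apply mul_le_mul_of_nonneg_right _ hD0
    nlinarith [mul_nonneg hn0 hn0]
  linarith

lemma aux_decay (n : ℕ) (hn : 1 ≤ n) (β c₁ δ C s₀ : ℝ) (hβ : 0 < β) (hc : 0 < c₁) (hδ : 0 < δ)
    (hC : 0 < C) (L R E : ℕ → ℝ → ℝ) (J : ℝ → ℝ)
    (hJ : ∀ s, J s = ∑ j ∈ Finset.range n, E (j+1) s)
    (hE0 : ∀ s, E 0 s = 0) (hEn : ∀ s, E (n+1) s = 0)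
    (hE : ∀ j < n, ∀ s, E (j+1) s = exp (-β * L (j+1) s))
    (hd : ∀ j < n, ∀ s, s₀ ≤ s → HasDerivAt (L (j+1))
      (c₁ * (2 * E (j+1) s - E j s - E (j+2) s + R (j+1) s)) s)
    (hR : ∀ j < n, ∀ s, s₀ ≤ s → |R (j+1) s| ≤ C * J s ^ (1+δ))
    (hdiv : ∀ j < n, Tendsto (L (j+1)) atTop atTop) :
    ∃ s₁, s₀ ≤ s₁ ∧ ∃ b > 0, ∀ s, s₁ < s → J s ≤ 1 / (b * (s - s₁)) := by
  have hEpos : ∀ j < n, ∀ s, 0 < E (j+1) s := fun j hj s => by rw [hE j hj]; positivity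
  have hJpos : ∀ s, 0 < J s := fun s => by
    rw [hJ]
    exact Finset.sum_pos (fun j hj => hEpos j (Finset.mem_range.1 hj) s) ⟨0, by simp; omega⟩
  have hEt : ∀ j < n, Tendsto (E (j+1)) atTop (nhds 0) := by
    intro j hj
    have : E (j+1) = fun s => exp (-β * L (j+1) s) := funext (hE j hj)
    rw [this]
    exact tendsto_exp_atBot.comp ((hdiv j hj).const_mul_atTop_of_neg (by linarith))
  have hJt : Tendsto J atTop (nhds 0) := by
    have : J = fun s => ∑ j ∈ Finset.range n, E (j+1) s := funext hJ
    rw [this]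
    have := tendsto_finsetSum (Finset.range n) (f := fun j s => E (j+1) s) (a := fun _ => (0:ℝ))
      (x := atTop) (fun j hj => hEt j (Finset.mem_range.1 hj))
    simpa using this
  have hJd : Tendsto (fun s => C * J s ^ δ) atTop (nhds 0) := by
    have h := (hJt.rpow_const (p := δ) (Or.inr hδ.le)).const_mul C
    simpa [Real.zero_rpow hδ.ne'] using h
  set a : ℝ := 1 / ((n:ℝ)+1)^3 with ha
  have hapos : 0 < a := by positivity
  obtain ⟨s₂, hs₂⟩ := eventually_atTop.1 (hJd.eventually (gt_mem_nhds (half_pos hapos)))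
  refine ⟨max s₀ s₂, le_max_left _ _, β * c₁ * (a/2), by positivity, ?_⟩
  set s₁ := max s₀ s₂ with hs₁
  set b := β * c₁ * (a/2) with hb
  have hbpos : 0 < b := by positivity
  have hJder : ∀ s, s₁ ≤ s → HasDerivAt J (∑ j ∈ Finset.range n, E (j+1) s *
      (-β * (c₁ * (2 * E (j+1) s - E j s - E (j+2) s + R (j+1) s)))) s := by
    intro s hs
    have : J = fun s => ∑ j ∈ Finset.range n, E (j+1) s := funext hJ
    rw [this]
    apply HasDerivAt.fun_sum
    intro j hj
    have hj := Finset.mem_range.1 hj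
    have h1 : E (j+1) = fun s => exp (-β * L (j+1) s) := funext (hE j hj)
    have h2 := ((hd j hj s ((le_max_left _ _).trans hs)).const_mul (-β)).exp
    rw [← hE j hj s] at h2
    rw [← h1] at h2
    exact h2
  have hJle : ∀ s, s₁ ≤ s → (∑ j ∈ Finset.range n, E (j+1) s *
      (-β * (c₁ * (2 * E (j+1) s - E j s - E (j+2) s + R (j+1) s)))) ≤ - b * J s ^ 2 := by
    intro s hs
    have h1 := aux_coer (fun i => E i s) n (hE0 s) (hEn s)
    rw [← hJ] at h1
    set P := ∑ j ∈ Finset.range n, E (j+1) s * (2 * E (j+1) s - E j s - E (j+2) s) with hP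
    have h2 : a * J s ^ 2 ≤ P := by
      rw [ha, one_div, inv_mul_le_iff₀ (by positivity)]; exact h1
    have h3 : ∑ j ∈ Finset.range n, E (j+1) s *
      (-β * (c₁ * (2 * E (j+1) s - E j s - E (j+2) s + R (j+1) s))) =
        -(β * c₁) * (P + ∑ j ∈ Finset.range n, E (j+1) s * R (j+1) s) := by
      rw [hP, ← Finset.sum_add_distrib, Finset.mul_sum]
      exact Finset.sum_congr rfl fun _ _ => by ring
    have h4 : -(a/2 * J s ^ 2) ≤ ∑ j ∈ Finset.range n, E (j+1) s * R (j+1) s := by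
      have h5 : C * J s ^ (1+δ) ≤ a/2 * J s := by
        rw [Real.rpow_add (hJpos s), Real.rpow_one]
        have := (hs₂ s ((le_max_right _ _).trans hs)).le
        nlinarith [hJpos s]
      have h6 : ∀ j ∈ Finset.range n, E (j+1) s * (-(a/2 * J s)) ≤ E (j+1) s * R (j+1) s := by
        intro j hj
        have hj := Finset.mem_range.1 hj
        apply mul_le_mul_of_nonneg_left _ (hEpos j hj s).le
        have := (abs_le.1 (hR j hj s ((le_max_left _ _).trans hs))).1
        linarith
      have h7 := Finset.sum_le_sum h6
      rw [← Finset.sum_mul, ← hJ] at h7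
      linarith
    rw [h3, hb]
    have : 0 < β * c₁ := by positivity
    nlinarith
  have hmono : MonotoneOn (fun s => (J s)⁻¹ - b * s) (Set.Ici s₁) := by
    have hder : ∀ s, s₁ ≤ s → HasDerivAt (fun s => (J s)⁻¹ - b * s) (-(∑ j ∈ Finset.range n, E (j+1) s *
      (-β * (c₁ * (2 * E (j+1) s - E j s - E (j+2) s + R (j+1) s)))) / J s ^ 2 - b * 1) s := by
      intro s hs
      exact ((hJder s hs).inv (hJpos s).ne').sub ((hasDerivAt_id s).const_mul b)
    apply monotoneOn_of_deriv_nonneg (convex_Ici _)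
    · exact fun s hs => (hder s hs).continuousAt.continuousWithinAt
    · intro s hs
      rw [interior_Ici] at hs
      exact (hder s (le_of_lt hs)).differentiableAt.differentiableWithinAt
    · intro s hs
      rw [interior_Ici] at hs
      rw [(hder s (le_of_lt hs)).deriv, sub_nonneg, le_div_iff₀ (pow_pos (hJpos s) 2)]
      have := hJle s (le_of_lt hs)
      linarith
  intro s hs
  have h1 := hmono (Set.self_mem_Ici) (Set.mem_Ici.2 hs.le) hs.le
  simp only [] at h1
  have h2 : 0 < (J s₁)⁻¹ := inv_pos.2 (hJpos _)
  have h3 : b * (s - s₁) ≤ (J s)⁻¹ := by linarith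
  have h4 : 0 < b * (s - s₁) := mul_pos hbpos (by linarith)
  rw [one_div]
  exact (le_inv_comm₀ h4 (hJpos s)).1 h3

lemma aux_abel (n : ℕ) (z e : ℕ → ℝ) :
    ∑ j ∈ Finset.range (n+1), z j * (e j - e (j+1)) =
      ∑ j ∈ Finset.range n, e (j+1) * (z (j+1) - z j) + z 0 * e 0 - z n * e (n+1) := by
  induction n with
  | zero => simp; ring
  | succ n ih => rw [Finset.sum_range_succ, ih, Finset.sum_range_succ _ n]; ring

lemma aux_tel (e : ℕ → ℝ) (j : ℕ) :
    ∑ i ∈ Finset.range j, (2 * e (i+1) - e i - e (i+2)) = e 1 - e 0 + e j - e (j+1) := by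
  induction j with
  | zero => simp
  | succ n ih => rw [Finset.sum_range_succ, ih]; ring

lemma aux_contract (n : ℕ) (c₁ δ K s₁ : ℝ) (hc : 0 < c₁) (hδ : 0 < δ) (hK : 0 ≤ K)
    (x e R : ℕ → ℝ → ℝ)
    (he0 : ∀ s, e 0 s = 0) (hen : ∀ s, e (n+1) s = 0)
    (hxe : ∀ j < n, ∀ s, s₁ < s → e (j+1) s * x (j+1) s ≤ 0)
    (hd : ∀ j < n, ∀ s, s₁ < s → HasDerivAt (x (j+1))
      (c₁ * (2 * e (j+1) s - e j s - e (j+2) s + R (j+1) s)) s)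
    (hR : ∀ j < n, ∀ s, s₁ < s → |R (j+1) s| ≤ K * (s - s₁) ^ (-δ-1)) :
    ∃ B, ∀ j < n, ∀ s, s₁ + 1 ≤ s → |x (j+1) s| ≤ B := by
  set T : ℕ → ℝ → ℝ := fun j s => ∑ i ∈ Finset.range j, x (i+1) s with hT
  set T' : ℕ → ℝ → ℝ := fun j s => c₁ * (e 1 s + (e j s - e (j+1) s)) +
    c₁ * ∑ i ∈ Finset.range j, R (i+1) s with hT'
  have hTd : ∀ j < n + 1, ∀ s, s₁ < s → HasDerivAt (T j) (T' j s) s := by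
    intro j hj s hs
    have h1 : HasDerivAt (T j) (∑ i ∈ Finset.range j,
        (c₁ * (2 * e (i+1) s - e i s - e (i+2) s + R (i+1) s))) s := by
      apply HasDerivAt.fun_sum
      intro i hi
      have := Finset.mem_range.1 hi
      exact hd i (by omega) s hs
    convert h1 using 1
    rw [← Finset.mul_sum, Finset.sum_add_distrib, aux_tel (fun i => e i s) j, he0 s]
    simp only [hT']
    ring
  set m : ℝ → ℝ := fun s => (∑ j ∈ Finset.range (n+1), T j s) / ((n:ℝ)+1) with hm
  set m' : ℝ → ℝ := fun s => (∑ j ∈ Finset.range (n+1), T' j s) / ((n:ℝ)+1) with hm'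
  have hmd : ∀ s, s₁ < s → HasDerivAt m (m' s) s := by
    intro s hs
    apply HasDerivAt.div_const
    apply HasDerivAt.fun_sum
    intro j hj
    exact hTd j (Finset.mem_range.1 hj) s hs
  set z : ℕ → ℝ → ℝ := fun j s => T j s - m s with hz
  have hzsum : ∀ s, ∑ j ∈ Finset.range (n+1), z j s = 0 := by
    intro s
    simp only [hz, hm, Finset.sum_sub_distrib, Finset.sum_const, Finset.card_range, nsmul_eq_mul]
    push_cast
    field_simp
    ring
  have hzd : ∀ j s, z (j+1) s - z j s = x (j+1) s := by
    intro j s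
    simp only [hz, hT, Finset.sum_range_succ]
    ring
  set Q : ℝ → ℝ := fun s => ∑ j ∈ Finset.range (n+1), z j s ^ 2 with hQ
  set Q' : ℝ → ℝ := fun s => ∑ j ∈ Finset.range (n+1), 2 * z j s * (T' j s - m' s) with hQ'
  have hQ0 : ∀ s, 0 ≤ Q s := fun s => Finset.sum_nonneg fun _ _ => sq_nonneg _
  have hQd : ∀ s, s₁ < s → HasDerivAt Q (Q' s) s := by
    intro s hs
    apply HasDerivAt.fun_sum
    intro j hj
    have := ((hTd j (Finset.mem_range.1 hj) s hs).sub (hmd s hs)).pow 2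
    refine (show HasDerivAt (fun y => z j y ^ 2) _ s from this).congr_deriv ?_
    simp [hz]
  set A : ℝ := 2 * c₁ * n * K with hA
  have hA0 : 0 ≤ A := by positivity
  have hQle : ∀ s, s₁ < s → Q' s ≤ A * (s - s₁) ^ (-δ-1) * ((n:ℝ) + 1 + Q s) := by
    intro s hs
    set M := K * (s - s₁) ^ (-δ-1) with hM
    have hM0 : 0 ≤ M := mul_nonneg hK (Real.rpow_nonneg (by linarith) _)
    have h1 : Q' s = 2 * c₁ * (∑ j ∈ Finset.range (n+1), z j s * (e j s - e (j+1) s)) +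
        2 * c₁ * (∑ j ∈ Finset.range (n+1), z j s * ∑ i ∈ Finset.range j, R (i+1) s) := by
      have h2 : Q' s = 2 * c₁ * (∑ j ∈ Finset.range (n+1), z j s * (e j s - e (j+1) s)) +
        2 * c₁ * (∑ j ∈ Finset.range (n+1), z j s * ∑ i ∈ Finset.range j, R (i+1) s)
         + 2 * (c₁ * e 1 s - m' s) * ∑ j ∈ Finset.range (n+1), z j s := by
        rw [Finset.mul_sum, Finset.mul_sum, Finset.mul_sum, ← Finset.sum_add_distrib,
          ← Finset.sum_add_distrib]
        apply Finset.sum_congr rfl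
        intro j _
        simp only [hT']
        ring
      rw [h2, hzsum]; ring
    have h3 : ∑ j ∈ Finset.range (n+1), z j s * (e j s - e (j+1) s) ≤ 0 := by
      rw [aux_abel n (fun j => z j s) (fun j => e j s), he0, hen]
      have : ∑ j ∈ Finset.range n, e (j+1) s * (z (j+1) s - z j s) ≤ 0 := by
        apply Finset.sum_nonpos
        intro j hj
        rw [hzd]
        exact hxe j (Finset.mem_range.1 hj) s hs
      simpa using this
    have h4 : ∑ j ∈ Finset.range (n+1), z j s * ∑ i ∈ Finset.range j, R (i+1) s ≤
        ∑ j ∈ Finset.range (n+1), (1 + z j s ^ 2) * (n * M) := by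
      apply Finset.sum_le_sum
      intro j hj
      have hj := Finset.mem_range.1 hj
      have h5 : |∑ i ∈ Finset.range j, R (i+1) s| ≤ n * M := by
        refine (Finset.abs_sum_le_sum_abs _ _).trans ?_
        have h6 := Finset.sum_le_card_nsmul (Finset.range j) (fun i => |R (i+1) s|) M
          (fun i hi => hR i (by have := Finset.mem_range.1 hi; omega) s hs)
        refine h6.trans ?_
        rw [Finset.card_range, nsmul_eq_mul]
        apply mul_le_mul_of_nonneg_right _ hM0
        exact_mod_cast (by omega : j ≤ n)
      refine (le_abs_self _).trans ?_
      rw [abs_mul]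
      apply mul_le_mul _ h5 (abs_nonneg _) (by positivity)
      nlinarith [sq_abs (z j s), sq_nonneg (|z j s| - 1), abs_nonneg (z j s)]
    have h7 : ∑ j ∈ Finset.range (n+1), (1 + z j s ^ 2) * (n * M) =
        ((n:ℝ) + 1 + Q s) * (n * M) := by
      rw [← Finset.sum_mul, Finset.sum_add_distrib]
      simp [hQ]
    rw [h7] at h4
    have h8 : A * (s - s₁) ^ (-δ-1) * ((n:ℝ) + 1 + Q s) =
        2 * c₁ * (((n:ℝ) + 1 + Q s) * (n * M)) := by rw [hA, hM]; ring
    rw [h1, h8]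
    nlinarith
  set V : ℝ → ℝ := fun s => ((n:ℝ) + 1 + Q s) * exp (A / δ * (s - s₁) ^ (-δ)) with hV
  have hVd : ∀ s, s₁ < s → HasDerivAt V (Q' s * exp (A / δ * (s - s₁) ^ (-δ)) +
      ((n:ℝ) + 1 + Q s) * (exp (A / δ * (s - s₁) ^ (-δ)) *
        (A / δ * (1 * (-δ) * (s - s₁) ^ (-δ-1))))) s := by
    intro s hs
    have h1 : HasDerivAt (fun s => s - s₁) 1 s := (hasDerivAt_id s).sub_const s₁
    have h2 := ((h1.rpow_const (p := -δ) (Or.inl (by linarith))).const_mul (A/δ)).exp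
    exact ((hQd s hs).const_add ((n:ℝ)+1)).mul h2
  have hanti : AntitoneOn V (Set.Ici (s₁+1)) := by
    apply antitoneOn_of_deriv_nonpos (convex_Ici _)
    · intro s hs
      have hs : s₁ + 1 ≤ s := hs
      exact (hVd s (by linarith)).continuousAt.continuousWithinAt
    · intro s hs
      rw [interior_Ici] at hs
      have hs : s₁ + 1 < s := hs
      exact (hVd s (by linarith)).differentiableAt.differentiableWithinAt
    · intro s hs
      rw [interior_Ici] at hs
      have hs : s₁ + 1 < s := hs
      rw [(hVd s (by linarith)).deriv]
      have h1 := hQle s (by linarith)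
      have h2 : Q' s * exp (A / δ * (s - s₁) ^ (-δ)) +
      ((n:ℝ) + 1 + Q s) * (exp (A / δ * (s - s₁) ^ (-δ)) *
        (A / δ * (1 * (-δ) * (s - s₁) ^ (-δ-1)))) =
        (Q' s - A * (s - s₁) ^ (-δ-1) * ((n:ℝ) + 1 + Q s)) * exp (A / δ * (s - s₁) ^ (-δ)) := by
        field_simp
        ring
      rw [h2]
      exact mul_nonpos_of_nonpos_of_nonneg (by linarith) (exp_pos _).le
  have hQb : ∀ s, s₁ + 1 ≤ s → Q s ≤ V (s₁+1) := by
    intro s hs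
    refine le_trans ?_ (hanti (Set.self_mem_Ici) (Set.mem_Ici.2 hs) hs)
    have h1 : 1 ≤ exp (A / δ * (s - s₁) ^ (-δ)) := by
      apply Real.one_le_exp
      exact mul_nonneg (by positivity) (Real.rpow_nonneg (by linarith) _)
    have hn0 : (0:ℝ) ≤ n := by positivity
    simp only [hV]
    nlinarith [hQ0 s]
  refine ⟨1 + 4 * V (s₁+1), ?_⟩
  intro j hj s hs
  have h1 := hQb s hs
  have h2 : ∀ i < n + 1, z i s ^ 2 ≤ Q s := fun i hi =>
    Finset.single_le_sum (f := fun i => z i s ^ 2) (fun _ _ => sq_nonneg _) (Finset.mem_range.2 hi)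
  have h3 := h2 j (by omega)
  have h4 := h2 (j+1) (by omega)
  rw [← hzd]
  rw [abs_le]
  constructor <;>
  nlinarith [sq_nonneg (z j s - 1), sq_nonneg (z (j+1) s - 1), sq_nonneg (z j s + 1), sq_nonneg (z (j+1) s + 1)]

/-- All the gaps `L_i = ζ_{i+1} - ζ_i` between consecutive solitons' centers agree up to a
bounded error: under the discrete-Laplacian type ODE system
`(1/c₁) L_i' = -E_{i-1} + 2 E_i - E_{i+1} + O(J^{1+δ₀})`, with `E_i = e^{-βL_i}` for
`1 ≤ i ≤ k-1` and `E₀ = E_k = 0`, we have `|L_i(s) - L₁(s)| ≤ C₀` for large `s`. -/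
theorem gaps_comparable (p : ℝ) (hp : 1 < p) (k : ℕ) (hk : 2 ≤ k)
    (c₁ δ₀ C s₀ : ℝ) (hc₁ : 0 < c₁) (hδ₀ : 0 < δ₀) (hC : 0 < C)
    (L L' : ℕ → ℝ → ℝ) (E : ℕ → ℝ → ℝ)
    (hE : ∀ i s, E i s =
      if 1 ≤ i ∧ i ≤ k - 1 then Real.exp (-(2/(p-1)) * L i s) else 0)
    (hderiv : ∀ i, 1 ≤ i → i ≤ k-1 → ∀ s, s₀ ≤ s → HasDerivAt (L i) (L' i s) s)
    (hcont : ∀ i, 1 ≤ i → i ≤ k-1 → ContinuousOn (L' i) (Set.Ici s₀))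
    (hdiv : ∀ i, 1 ≤ i → i ≤ k-1 → Tendsto (L i) atTop atTop)
    (hode : ∀ s, s₀ ≤ s → ∀ i, 1 ≤ i → i ≤ k-1 →
      |L' i s / c₁ + E (i-1) s - 2 * E i s + E (i+1) s| ≤
        C * (∑ j ∈ Finset.Icc 1 (k-1), E j s) ^ (1+δ₀)) :
    ∃ C₀ > (0:ℝ), ∃ s₁, s₀ ≤ s₁ ∧ ∀ i, 1 ≤ i → i ≤ k-1 → ∀ s, s₁ ≤ s →
      |L i s - L 1 s| ≤ C₀ := by
  obtain ⟨n, rfl⟩ : ∃ n, k = n + 1 := ⟨k - 1, by omega⟩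
  simp only [Nat.add_sub_cancel] at *
  have hn : 1 ≤ n := by omega
  set β := 2 / (p - 1) with hβ
  have hβ0 : 0 < β := div_pos two_pos (by linarith)
  set J : ℝ → ℝ := fun s => ∑ j ∈ Finset.range n, E (j+1) s with hJ
  have hJs : ∀ s, ∑ j ∈ Finset.Icc 1 n, E j s = J s := by
    intro s
    rw [hJ, Finset.sum_bij' (i := fun j _ => j - 1) (j := fun j _ => j + 1)]
    · intro a ha; simp at ha ⊢; omega
    · intro a ha; simp at ha ⊢; omega
    · intro a ha; simp at ha ⊢; omega
    · intro a ha; simp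
    · intro a ha; simp at ha; rw [Nat.sub_add_cancel ha.1]
  set R : ℕ → ℝ → ℝ := fun i s => L' i s / c₁ + E (i-1) s - 2 * E i s + E (i+1) s with hR
  have hE0 : ∀ s, E 0 s = 0 := fun s => by simp [hE]
  have hEn : ∀ s, E (n+1) s = 0 := fun s => by simp [hE]
  have hE1 : ∀ j < n, ∀ s, E (j+1) s = exp (-β * L (j+1) s) := by
    intro j hj s
    rw [hE, if_pos ⟨by omega, by omega⟩]
  have hd : ∀ j < n, ∀ s, s₀ ≤ s → HasDerivAt (L (j+1))
      (c₁ * (2 * E (j+1) s - E j s - E (j+2) s + R (j+1) s)) s := by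
    intro j hj s hs
    convert hderiv (j+1) (by omega) (by omega) s hs using 1
    simp only [hR, Nat.add_sub_cancel]
    field_simp
    ring
  have hRb : ∀ j < n, ∀ s, s₀ ≤ s → |R (j+1) s| ≤ C * J s ^ (1+δ₀) := by
    intro j hj s hs
    have := hode s hs (j+1) (by omega) (by omega)
    rw [hJs] at this
    exact this
  obtain ⟨s₁, hs₁, b, hb, hdec⟩ := aux_decay n hn β c₁ δ₀ C s₀ hβ0 hc₁ hδ₀ hC L R E J
    (fun _ => rfl) hE0 hEn hE1 hd hRb (fun j hj => hdiv (j+1) (by omega) (by omega))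
  have hJ0 : ∀ s, 0 ≤ J s := fun s => Finset.sum_nonneg fun j hj => by
    rw [hE1 j (Finset.mem_range.1 hj)]; positivity
  set w : ℕ → ℝ := fun i => (i:ℝ) * ((n:ℝ) + 1 - i) / (2 * β * c₁) with hw
  have hwpos : ∀ j < n, 0 < w (j+1) := by
    intro j hj
    have : (j:ℝ) + 1 ≤ n := by exact_mod_cast hj
    simp only [hw]
    push_cast
    apply div_pos (mul_pos (by positivity) (by linarith)) (by positivity)
  set e : ℕ → ℝ → ℝ := fun i s => E i s - w i / (s - s₁) with he
  set x : ℕ → ℝ → ℝ := fun i s => L i s - (log (s - s₁) - log (w i)) / β with hx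
  obtain ⟨B, hB⟩ := aux_contract n c₁ δ₀ (C * (1/b)^(1+δ₀)) s₁ hc₁ hδ₀
    (by positivity) x e R (by intro s; simp [he, hE0, hw]) (by intro s; simp [he, hEn, hw])
    (by
      intro j hj s hs
      have ht : 0 < s - s₁ := by linarith
      have h1 : w (j+1) / (s - s₁) = exp (-β * ((log (s - s₁) - log (w (j+1))) / β)) := by
        have : -β * ((log (s - s₁) - log (w (j+1))) / β) = log (w (j+1)) - log (s - s₁) := by
          field_simp; ring
        rw [this, exp_sub, exp_log (hwpos j hj), exp_log ht]
      simp only [he, hx]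
      rw [h1, hE1 j hj]
      set u := (log (s - s₁) - log (w (j+1))) / β
      rcases le_total (L (j+1) s) u with h | h
      · apply mul_nonpos_of_nonneg_of_nonpos _ (by linarith)
        rw [sub_nonneg]
        apply exp_le_exp.2
        nlinarith
      · apply mul_nonpos_of_nonpos_of_nonneg _ (by linarith)
        rw [sub_nonpos]
        apply exp_le_exp.2
        nlinarith)
    (by
      intro j hj s hs
      have ht : 0 < s - s₁ := by linarith
      have h1 : HasDerivAt (fun s => s - s₁) 1 s := (hasDerivAt_id s).sub_const s₁
      have h2 := (hd j hj s (by linarith)).sub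
        (((h1.log ht.ne').sub_const (log (w (j+1)))).div_const β)
      refine (show HasDerivAt (x (j+1)) _ s from h2).congr_deriv ?_
      simp only [he, hw]
      push_cast
      field_simp
      ring)
    (by
      intro j hj s hs
      have ht : 0 < s - s₁ := by linarith
      refine (hRb j hj s (by linarith)).trans ?_
      rw [mul_assoc]
      apply mul_le_mul_of_nonneg_left _ hC.le
      refine (Real.rpow_le_rpow (hJ0 s) (hdec s hs) (by linarith)).trans (le_of_eq ?_)
      rw [one_div, mul_inv, Real.mul_rpow (by positivity) (by positivity), one_div,
        Real.inv_rpow ht.le, ← Real.rpow_neg ht.le]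
      ring_nf)
  set D := ∑ j ∈ Finset.range n, |(log (w (j+1)) - log (w 1)) / β| with hD
  have hD0 : 0 ≤ D := Finset.sum_nonneg fun _ _ => abs_nonneg _
  refine ⟨2 * |B| + D + 1, by positivity, s₁ + 1, by linarith, ?_⟩
  intro i hi1 hi2 s hs
  obtain ⟨j, rfl⟩ : ∃ j, i = j + 1 := ⟨i - 1, by omega⟩
  have h1 := hB j (by omega) s hs
  have h2 := hB 0 (by omega) s hs
  have h3 : |(log (w (j+1)) - log (w 1)) / β| ≤ D :=
    Finset.single_le_sum (f := fun j => |(log (w (j+1)) - log (w 1)) / β|)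
      (fun _ _ => abs_nonneg _) (Finset.mem_range.2 (by omega))
  have h4 : L (j+1) s - L 1 s = x (j+1) s - x (0+1) s - (log (w (j+1)) - log (w 1)) / β := by
    simp only [hx]
    ring_nf
  rw [h4]
  have h5 := le_abs_self B
  rw [abs_le] at *
  constructor <;> linarith [h1.1, h1.2, h2.1, h2.2, h3.1, h3.2]
end

section
/- Let p > 1 and set β = 2/(p−1). Let k ≥ 2 be an integer, c₁ > 0, δ₀ > 0, C > 0, s₀ ∈ ℝ. Let L₁, …, L_{k−1} : [s₀, ∞) → ℝ be C¹ functions with L_i(s) → ∞ as s → ∞ for each i, and assume that for all s ≥ s₀ and all i = 1, …, k−1, |L_i'(s)/c₁ + E_{i−1}(s) − 2E_i(s) + E_{i+1}(s)| ≤ C (Σ_{j=1}^{k−1} E_j(s))^{1+δ₀}, where E_i(s) = e^{−β L_i(s)} for 1 ≤ i ≤ k−1 and E₀ ≡ E_k ≡ 0. Set ε₀ = 1/1000, r = ⌊k/2⌋, S_j(s) = Σ_{i=j}^{k−j} L_i(s) for j = 1, …, r, and σ(s) = Σ_{j=1}^{r} ε₀^{j−1} S_j(s). Then for all sufficiently large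 s, (ε₀^{r−1}/2) Σ_{j=1}^{k−1} e^{−β L_j(s)} ≤ σ'(s)/c₁ ≤ 3 Σ_{j=1}^{k−1} e^{−β L_j(s)}. -/
open Real Filter

lemma aux_tele (e : ℕ → ℝ) (j m : ℕ) (hj : 1 ≤ j) (hm : j ≤ m) :
    ∑ i ∈ Finset.Icc j m, (2 * e i - e (i-1) - e (i+1)) =
      (e j + e m) - (e (j-1) + e (m+1)) := by
  induction m, hm using Nat.le_induction with
  | base => simp; ring
  | succ m hm ih =>
    rw [Finset.sum_Icc_succ_top (by omega), ih]
    simp only [Nat.add_sub_cancel]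
    ring

lemma aux_abel_s6 (F : ℕ → ℝ) (h0 : F 0 = 0) (hF : ∀ i, 0 ≤ F i) (r : ℕ) (hr : 1 ≤ r) :
    (1/1000 : ℝ) ^ (r-1) * ∑ j ∈ Finset.Icc 1 r, F j ≤
      ∑ j ∈ Finset.Icc 1 r, (1/1000 : ℝ) ^ (j-1) * (F j - F (j-1)) ∧
    ∑ j ∈ Finset.Icc 1 r, (1/1000 : ℝ) ^ (j-1) * (F j - F (j-1)) ≤
      ∑ j ∈ Finset.Icc 1 r, F j := by
  induction r, hr using Nat.le_induction with
  | base => simp [h0]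
  | succ r hr ih =>
    obtain ⟨n, rfl⟩ : ∃ n, r = n + 1 := ⟨r - 1, by omega⟩
    rw [Finset.sum_Icc_succ_top (show 1 ≤ n+1+1 by omega) F,
      Finset.sum_Icc_succ_top (show 1 ≤ n+1+1 by omega)
        (fun j => (1/1000 : ℝ) ^ (j-1) * (F j - F (j-1)))]
    obtain ⟨h1, h2⟩ := ih
    have hS : F (n+1) ≤ ∑ j ∈ Finset.Icc 1 (n+1), F j :=
      Finset.single_le_sum (fun i _ => hF i) (by simp)
    simp only [Nat.add_sub_cancel] at h1 h2 ⊢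
    set S := ∑ j ∈ Finset.Icc 1 (n+1), F j
    set M := ∑ j ∈ Finset.Icc 1 (n+1), (1/1000 : ℝ) ^ (j-1) * (F j - F (j-1))
    have ha : (0:ℝ) < (1/1000)^n := by positivity
    have ha1 : ((1:ℝ)/1000)^n ≤ 1 := pow_le_one₀ (by norm_num) (by norm_num)
    rw [pow_succ]
    set a := ((1:ℝ)/1000)^n
    have hFn := hF (n+1)
    have hFn2 := hF (n+1+1)
    have p1 := mul_le_mul_of_nonneg_left hS ha.le
    have p2 := mul_nonneg ha.le hFn
    have p3 := mul_le_mul_of_nonneg_right ha1 hFn2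
    have p4 : 0 ≤ a * S := p2.trans p1
    constructor <;> nlinarith

lemma aux_J (k : ℕ) (hk : 2 ≤ k) (e : ℕ → ℝ) (he : ∀ i, 0 ≤ e i) :
    ∑ j ∈ Finset.Icc 1 (k-1), e j ≤ ∑ j ∈ Finset.Icc 1 (k/2), (e j + e (k-j)) ∧
    ∑ j ∈ Finset.Icc 1 (k/2), (e j + e (k-j)) ≤ 2 * ∑ j ∈ Finset.Icc 1 (k-1), e j := by
  have hrefl : ∑ j ∈ Finset.Icc 1 (k/2), e (k-j) = ∑ j ∈ Finset.Icc (k-k/2) (k-1), e j := by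
    refine Finset.sum_nbij' (fun j => k - j) (fun j => k - j) ?_ ?_ ?_ ?_ ?_
    · intro a ha; simp only [Finset.mem_Icc] at *; omega
    · intro a ha; simp only [Finset.mem_Icc] at *; omega
    · intro a ha; simp only [Finset.mem_Icc] at *; omega
    · intro a ha; simp only [Finset.mem_Icc] at *; omega
    · intro a ha; rfl
  rw [Finset.sum_add_distrib, hrefl]
  constructor
  · rw [← Finset.sum_union_inter]
    have h1 : ∑ j ∈ Finset.Icc 1 (k-1), e j ≤
        ∑ j ∈ Finset.Icc 1 (k/2) ∪ Finset.Icc (k-k/2) (k-1), e j := by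
      apply Finset.sum_le_sum_of_subset_of_nonneg
      · intro a ha
        simp only [Finset.mem_Icc, Finset.mem_union] at *; omega
      · intro i _ _; exact he i
    have h2 : 0 ≤ ∑ j ∈ Finset.Icc 1 (k/2) ∩ Finset.Icc (k-k/2) (k-1), e j :=
      Finset.sum_nonneg (fun i _ => he i)
    linarith
  · have h1 : ∑ j ∈ Finset.Icc 1 (k/2), e j ≤ ∑ j ∈ Finset.Icc 1 (k-1), e j := by
      apply Finset.sum_le_sum_of_subset_of_nonneg
      · intro a ha
        simp only [Finset.mem_Icc] at *; omega
      · intro i _ _; exact he i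
    have h2 : ∑ j ∈ Finset.Icc (k-k/2) (k-1), e j ≤ ∑ j ∈ Finset.Icc 1 (k-1), e j := by
      apply Finset.sum_le_sum_of_subset_of_nonneg
      · intro a ha
        simp only [Finset.mem_Icc] at *; omega
      · intro i _ _; exact he i
    linarith

lemma aux_main (k : ℕ) (hk : 2 ≤ k) (e : ℕ → ℝ) (he : ∀ i, 0 ≤ e i) (h0 : e 0 = 0)
    (hek : e k = 0) (l : ℕ → ℝ) (B : ℝ) (hB : 0 ≤ B)
    (h : ∀ i, 1 ≤ i → i ≤ k-1 → |l i + e (i-1) - 2 * e i + e (i+1)| ≤ B) :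
    (1/1000 : ℝ) ^ (k/2-1) * ∑ j ∈ Finset.Icc 1 (k-1), e j - k * k * B ≤
      ∑ j ∈ Finset.Icc 1 (k/2), (1/1000 : ℝ) ^ (j-1) * ∑ i ∈ Finset.Icc j (k-j), l i ∧
    ∑ j ∈ Finset.Icc 1 (k/2), (1/1000 : ℝ) ^ (j-1) * ∑ i ∈ Finset.Icc j (k-j), l i ≤
      2 * ∑ j ∈ Finset.Icc 1 (k-1), e j + k * k * B := by
  obtain ⟨J1, J2⟩ := aux_J k hk e he
  obtain ⟨A1, A2⟩ := aux_abel_s6 (fun j => e j + e (k-j)) (by simp [h0, hek])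
    (fun i => add_nonneg (he _) (he _)) (k/2) (by omega)
  have hterm : ∀ j ∈ Finset.Icc 1 (k/2),
      |(1/1000 : ℝ) ^ (j-1) * ∑ i ∈ Finset.Icc j (k-j), l i -
        (1/1000 : ℝ) ^ (j-1) * ((e j + e (k-j)) - (e (j-1) + e (k-(j-1))))| ≤ k * B := by
    intro j hj
    rw [Finset.mem_Icc] at hj
    have hk1 : k - (j-1) = k - j + 1 := by omega
    rw [hk1, ← aux_tele e j (k-j) hj.1 (by omega), ← mul_sub, ← Finset.sum_sub_distrib, abs_mul]
    have hb : |∑ i ∈ Finset.Icc j (k-j), (l i - (2 * e i - e (i-1) - e (i+1)))| ≤ k * B := by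
      refine (Finset.abs_sum_le_sum_abs _ _).trans ?_
      refine (Finset.sum_le_card_nsmul _ _ B ?_).trans ?_
      · intro i hi
        rw [Finset.mem_Icc] at hi
        refine le_trans (le_of_eq ?_) (h i (by omega) (by omega))
        congr 1; ring
      · rw [nsmul_eq_mul]
        refine mul_le_mul_of_nonneg_right ?_ hB
        rw [Nat.card_Icc]
        exact_mod_cast (by omega)
    have ha1 : |((1:ℝ)/1000)^(j-1)| ≤ 1 := by
      rw [abs_of_pos (by positivity)]
      exact pow_le_one₀ (by norm_num) (by norm_num)
    calc _ ≤ 1 * |∑ i ∈ Finset.Icc j (k-j), (l i - (2 * e i - e (i-1) - e (i+1)))| :=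
          mul_le_mul_of_nonneg_right ha1 (abs_nonneg _)
      _ ≤ _ := by rw [one_mul]; exact hb
  have htot : |∑ j ∈ Finset.Icc 1 (k/2), (1/1000 : ℝ) ^ (j-1) * ∑ i ∈ Finset.Icc j (k-j), l i -
      ∑ j ∈ Finset.Icc 1 (k/2), (1/1000 : ℝ) ^ (j-1) *
        ((e j + e (k-j)) - (e (j-1) + e (k-(j-1))))| ≤ k * k * B := by
    rw [← Finset.sum_sub_distrib]
    refine (Finset.abs_sum_le_sum_abs _ _).trans ?_
    refine (Finset.sum_le_card_nsmul _ _ _ hterm).trans ?_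
    rw [nsmul_eq_mul, Nat.card_Icc, mul_assoc]
    refine mul_le_mul_of_nonneg_right ?_ (by positivity)
    exact_mod_cast (by omega)
  rw [abs_le] at htot
  have hp : (0:ℝ) ≤ (1/1000 : ℝ) ^ (k/2-1) := by positivity
  have := mul_le_mul_of_nonneg_left J1 hp
  constructor <;> linarith [htot.1, htot.2]

/-- The derivative of the weighted sum `σ = Σ_{j=1}^{r} ε₀^{j-1} S_j`, where
`S_j = Σ_{i=j}^{k-j} L_i`, `r = ⌊k/2⌋` and `ε₀ = 1/1000`, is comparable to
`J = Σ_{j=1}^{k-1} e^{-βL_j}` for large `s`: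
`(ε₀^{r-1}/2) J ≤ σ'/c₁ ≤ 3 J`. Here `σ' = Σ_{j=1}^{r} ε₀^{j-1} Σ_{i=j}^{k-j} L_i'`. -/
theorem sigma_derivative_comparable (p : ℝ) (hp : 1 < p) (k : ℕ) (hk : 2 ≤ k)
    (c₁ δ₀ C s₀ : ℝ) (hc₁ : 0 < c₁) (hδ₀ : 0 < δ₀) (hC : 0 < C)
    (L L' : ℕ → ℝ → ℝ) (E : ℕ → ℝ → ℝ)
    (hE : ∀ i s, E i s =
      if 1 ≤ i ∧ i ≤ k - 1 then Real.exp (-(2/(p-1)) * L i s) else 0)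
    (hderiv : ∀ i, 1 ≤ i → i ≤ k-1 → ∀ s, s₀ ≤ s → HasDerivAt (L i) (L' i s) s)
    (hcont : ∀ i, 1 ≤ i → i ≤ k-1 → ContinuousOn (L' i) (Set.Ici s₀))
    (hdiv : ∀ i, 1 ≤ i → i ≤ k-1 → Tendsto (L i) atTop atTop)
    (hode : ∀ s, s₀ ≤ s → ∀ i, 1 ≤ i → i ≤ k-1 →
      |L' i s / c₁ + E (i-1) s - 2 * E i s + E (i+1) s| ≤
        C * (∑ j ∈ Finset.Icc 1 (k-1), E j s) ^ (1+δ₀)) :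
    ∃ s₁, s₀ ≤ s₁ ∧ ∀ s, s₁ ≤ s →
      ((1/1000 : ℝ) ^ (k/2 - 1) / 2) *
          (∑ j ∈ Finset.Icc 1 (k-1), Real.exp (-(2/(p-1)) * L j s)) ≤
        (∑ j ∈ Finset.Icc 1 (k/2), (1/1000 : ℝ) ^ (j-1) *
          ∑ i ∈ Finset.Icc j (k-j), L' i s) / c₁ ∧
      (∑ j ∈ Finset.Icc 1 (k/2), (1/1000 : ℝ) ^ (j-1) *
          ∑ i ∈ Finset.Icc j (k-j), L' i s) / c₁ ≤
        3 * ∑ j ∈ Finset.Icc 1 (k-1), Real.exp (-(2/(p-1)) * L j s) := by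
  have hβ : 0 < 2/(p-1) := div_pos two_pos (by linarith)
  set β := 2/(p-1)
  set a : ℝ := (1/1000 : ℝ) ^ (k/2 - 1) with ha_def
  have ha : 0 < a := by positivity
  have ha1 : a ≤ 1 := pow_le_one₀ (by norm_num) (by norm_num)
  have hJE : ∀ s, ∑ j ∈ Finset.Icc 1 (k-1), E j s =
      ∑ j ∈ Finset.Icc 1 (k-1), Real.exp (-β * L j s) := by
    intro s
    refine Finset.sum_congr rfl fun j hj => ?_
    rw [Finset.mem_Icc] at hj
    rw [hE, if_pos hj]
  have hJ0 : Tendsto (fun s => ∑ j ∈ Finset.Icc 1 (k-1), Real.exp (-β * L j s)) atTop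
      (nhds 0) := by
    have : Tendsto (fun s => ∑ j ∈ Finset.Icc 1 (k-1), Real.exp (-β * L j s)) atTop
      (nhds (∑ j ∈ Finset.Icc 1 (k-1), 0)) := by
      refine tendsto_finsetSum _ fun j hj => ?_
      rw [Finset.mem_Icc] at hj
      refine Real.tendsto_exp_atBot.comp ?_
      exact (hdiv j hj.1 hj.2).const_mul_atTop_of_neg (by linarith)
    simpa using this
  have hJd : Tendsto (fun s => k * k * C *
      (∑ j ∈ Finset.Icc 1 (k-1), Real.exp (-β * L j s)) ^ δ₀) atTop (nhds 0) := by
    have := (hJ0.rpow_const (p := δ₀) (Or.inr hδ₀.le)).const_mul ((k:ℝ) * k * C)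
    simpa [Real.zero_rpow hδ₀.ne'] using this
  have hev := (hJd.eventually (gt_mem_nhds (show 0 < a/2 by positivity))).and
    (eventually_ge_atTop s₀)
  obtain ⟨s₁, hs₁⟩ := eventually_atTop.1 hev
  refine ⟨s₁, (hs₁ s₁ le_rfl).2, fun s hs => ?_⟩
  obtain ⟨hsm, hss⟩ := hs₁ s hs
  have hode' := hode s hss
  have hJpos : 0 < ∑ j ∈ Finset.Icc 1 (k-1), Real.exp (-β * L j s) :=
    Finset.sum_pos (fun i _ => Real.exp_pos _) ⟨1, by simp; omega⟩
  have hm := aux_main k hk (fun i => E i s)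
    (by intro i; simp only [hE]; split_ifs <;> positivity)
    (by simp [hE]) (by simp only [hE]; rw [if_neg (by omega)]) (fun i => L' i s / c₁)
    (C * (∑ j ∈ Finset.Icc 1 (k-1), E j s) ^ (1+δ₀))
    (by rw [hJE]; positivity) hode'
  simp only [hJE, ← Finset.sum_div, ← mul_div_assoc] at hm
  set J := ∑ j ∈ Finset.Icc 1 (k-1), Real.exp (-β * L j s)
  rw [Real.rpow_add hJpos, Real.rpow_one] at hm
  have hx := mul_le_mul_of_nonneg_right hsm.le hJpos.le
  have hy := mul_le_mul_of_nonneg_right ha1 hJpos.le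
  obtain ⟨m1, m2⟩ := hm
  rw [← ha_def] at m1
  constructor <;> nlinarith
end

section
/- Let p > 1, set β = 2/(p−1) and θ₀ = e^{−8/(p−1)}, and let k ≥ 2 be an integer. For every η₀ > 0 there exist ε > 0 and Φ > 0 such that the following holds: for every φ ≥ Φ and all C¹ functions a₁, …, a_{k−1} : [0, θ₀] → ℝ satisfying 0 ≤ a_i(0) ≤ φ for every i = 1, …, k−1 and |a_i'(θ) + E_{i−1}(θ) − 2E_i(θ) + E_{i+1}(θ)| ≤ ε Σ_{j=1}^{k−1} E_j(θ) for all θ ∈ [0, θ₀] and all i (where E_i(θ) = e^{−β a_i(θ)} for 1 ≤ i ≤ k−1 and E₀ ≡ E_k ≡ 0), one has −4 ≤ a_i(θ) ≤ φ + η₀ for all i = 1, …, k−1 and all θ ∈ [0, θ₀]. -/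
open Real Filter

lemma ev_ge_of_right_deriv {f : ℝ → ℝ} {d T t : ℝ} (ht : t < T) (h0 : 0 ≤ t)
    (hf : HasDerivWithinAt f d (Set.Icc 0 T) t) (h : 0 ≤ f t) (hd : f t = 0 → 0 < d) :
    ∀ᶠ x in nhdsWithin t (Set.Ioi t), 0 ≤ f x := by
  have hf' : HasDerivWithinAt f d (Set.Ioi t) t := by
    apply hf.mono_of_mem_nhdsWithin
    filter_upwards [Ioo_mem_nhdsGT ht] with x hx
    exact ⟨h0.trans hx.1.le, hx.2.le⟩
  rcases h.lt_or_eq with h | h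
  · filter_upwards [hf'.continuousWithinAt.eventually_const_lt h] with x hx using hx.le
  · have h1 := (hasDerivWithinAt_iff_tendsto_slope' (by simp)).1 hf'
    filter_upwards [h1.eventually_const_lt (hd h.symm), self_mem_nhdsWithin] with x hx hx'
    rw [slope_def_field, ← h] at hx
    have h2 : 0 < x - t := sub_pos.2 hx'
    have := (div_pos_iff_of_pos_right h2).1 hx
    linarith

lemma lower_aux (β T ε : ℝ) (k : ℕ) (hβ : 0 < β) (hT1 : T ≤ 1) (hε : 0 < ε)
    (hεK : ε * (k * Real.exp (2*β)) ≤ 1/2) (a a' : ℕ → ℝ → ℝ)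
    (hd : ∀ i, 1 ≤ i → i ≤ k-1 → ∀ θ ∈ Set.Icc (0:ℝ) T,
      HasDerivWithinAt (a i) (a' i θ) (Set.Icc (0:ℝ) T) θ)
    (h0 : ∀ i, 1 ≤ i → i ≤ k-1 → 0 ≤ a i 0)
    (H : ∀ i, 1 ≤ i → i ≤ k-1 → ∀ θ ∈ Set.Icc (0:ℝ) T,
          |a' i θ + (if i = 1 then 0 else Real.exp (-β * a (i-1) θ))
            - 2 * Real.exp (-β * a i θ)
            + (if i = k-1 then 0 else Real.exp (-β * a (i+1) θ))|
          ≤ ε * ∑ j ∈ Finset.Icc 1 (k-1), Real.exp (-β * a j θ)) :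
    ∀ t ∈ Set.Icc (0:ℝ) T, ∀ i ∈ Finset.Icc 1 (k-1), -1 - t ≤ a i t := by
  have hcont : ∀ i ∈ Finset.Icc 1 (k-1), ContinuousOn (fun t => a i t - (-1 - t)) (Set.Icc 0 T) := by
    intro i hi
    rw [Finset.mem_Icc] at hi
    have : ContinuousOn (a i) (Set.Icc 0 T) := fun t ht => (hd i hi.1 hi.2 t ht).continuousWithinAt
    fun_prop
  have key : Set.Icc (0:ℝ) T ⊆ {t | ∀ i ∈ Finset.Icc 1 (k-1), 0 ≤ a i t - (-1 - t)} := by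
    apply IsClosed.Icc_subset_of_forall_mem_nhdsWithin
    · have : {t | ∀ i ∈ Finset.Icc 1 (k-1), 0 ≤ a i t - (-1 - t)} ∩ Set.Icc 0 T =
        Set.Icc 0 T ∩ ⋂ i ∈ Finset.Icc 1 (k-1),
          (Set.Icc 0 T ∩ (fun t => a i t - (-1 - t)) ⁻¹' Set.Ici 0) := by
        ext t
        simp only [Set.mem_inter_iff, Set.mem_ofPred_eq, Set.mem_iInter, Set.mem_preimage,
          Set.mem_Ici]
        constructor
        · rintro ⟨h1, h2⟩; exact ⟨h2, fun i hi => ⟨h2, h1 i hi⟩⟩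
        · rintro ⟨h1, h2⟩; exact ⟨fun i hi => (h2 i hi).2, h1⟩
      rw [this]
      refine isClosed_Icc.inter (isClosed_biInter fun i hi => ?_)
      exact (hcont i hi).preimage_isClosed_of_isClosed isClosed_Icc isClosed_Ici
    · intro i hi
      rw [Finset.mem_Icc] at hi
      have := h0 i hi.1 hi.2
      linarith
    · rintro t ⟨hs, ht⟩
      have htI : t ∈ Set.Icc 0 T := ⟨ht.1, ht.2.le⟩
      change ∀ᶠ x in nhdsWithin t (Set.Ioi t), ∀ i ∈ Finset.Icc 1 (k-1), 0 ≤ a i x - (-1 - x)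
      rw [Filter.eventually_all_finset]
      intro i hi
      have hi' := Finset.mem_Icc.1 hi
      have hD : HasDerivWithinAt (fun x => a i x - (-1 - x)) (a' i t + 1) (Set.Icc 0 T) t := by
        have := (hd i hi'.1 hi'.2 t htI).sub
          ((hasDerivWithinAt_id t (Set.Icc 0 T)).const_sub (-1))
        exact this.congr_deriv (by norm_num)
      refine ev_ge_of_right_deriv ht.2 ht.1 hD (hs i hi) fun he => ?_
      have hEle : ∀ j ∈ Finset.Icc 1 (k-1), Real.exp (-β * a j t) ≤ Real.exp (-β * a i t) := by
        intro j hj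
        have := hs j hj
        apply Real.exp_le_exp.2
        have : a i t ≤ a j t := by linarith
        nlinarith
      have hEi : Real.exp (-β * a i t) ≤ Real.exp (2*β) := by
        apply Real.exp_le_exp.2
        have : -2 ≤ a i t := by linarith [ht.2]
        nlinarith
      have hS : ∑ j ∈ Finset.Icc 1 (k-1), Real.exp (-β * a j t) ≤ k * Real.exp (2*β) := by
        calc _ ≤ ∑ j ∈ Finset.Icc 1 (k-1), Real.exp (2*β) :=
              Finset.sum_le_sum fun j hj => (hEle j hj).trans hEi
          _ = ((k-1 : ℕ):ℝ) * Real.exp (2*β) := by simp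
          _ ≤ _ := by
            gcongr
            omega
      have hH := (abs_le.1 ((H i hi'.1 hi'.2 t htI).trans
        ((mul_le_mul_of_nonneg_left hS hε.le).trans hεK))).1
      have h1 : (if i = 1 then 0 else Real.exp (-β * a (i-1) t)) ≤ Real.exp (-β * a i t) := by
        split_ifs with h
        · positivity
        · apply hEle; rw [Finset.mem_Icc]; omega
      have h2 : (if i = k-1 then 0 else Real.exp (-β * a (i+1) t)) ≤ Real.exp (-β * a i t) := by
        split_ifs with h
        · positivity
        · apply hEle; rw [Finset.mem_Icc]; omega
      linarith
  intro t ht i hi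
  have := key ht i hi
  linarith

lemma upper_aux (f f' : ℝ → ℝ) (T φ η : ℝ)
    (hd : ∀ θ ∈ Set.Icc (0:ℝ) T, HasDerivWithinAt f (f' θ) (Set.Icc (0:ℝ) T) θ)
    (h0 : f 0 ≤ φ) (hη : 0 < η)
    (h : ∀ θ ∈ Set.Icc (0:ℝ) T, φ ≤ f θ → f' θ < η) :
    ∀ t ∈ Set.Icc (0:ℝ) T, f t ≤ φ + η * t := by
  intro t ht
  refine image_le_of_deriv_right_lt_deriv_boundary' (f := f) (f' := f') (a := 0) (b := T)
    (B := fun t => φ + η * t) (B' := fun _ => η)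
    (fun x hx => (hd x hx).continuousWithinAt) ?_ (by simpa using h0) (by fun_prop) ?_ ?_ ht
  · intro x hx
    apply (hd x ⟨hx.1, hx.2.le⟩).mono_of_mem_nhdsWithin
    filter_upwards [Ico_mem_nhdsGE hx.2] with y hy
    exact ⟨hx.1.trans hy.1, hy.2.le⟩
  · intro x _
    simpa using ((hasDerivWithinAt_id x (Set.Ici x)).const_mul η).const_add φ
  · intro x hx he
    apply h x ⟨hx.1, hx.2.le⟩
    rw [he]
    nlinarith [hx.1]

/-- A priori bound on the short time interval `[0, θ₀]`, `θ₀ = e^{-8/(p-1)}`, for perturbed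
solutions of the rescaled Toda-lattice type system
`a_i' = -e^{-βa_{i-1}} + 2e^{-βa_i} - e^{-βa_{i+1}}` (boundary terms for indices `0` and
`k` are absent): if `0 ≤ a_i(0) ≤ φ` with `φ` large and the perturbation is at most
`ε Σ_j e^{-βa_j}` with `ε` small, then `-4 ≤ a_i(θ) ≤ φ + η₀` on `[0, θ₀]`. -/
theorem short_time_apriori_bound (p : ℝ) (hp : 1 < p) (k : ℕ) (hk : 2 ≤ k) :
    ∀ η₀ > (0:ℝ), ∃ ε > (0:ℝ), ∃ Φ > (0:ℝ), ∀ φ, Φ ≤ φ →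
      ∀ a a' : ℕ → ℝ → ℝ,
        (∀ i, 1 ≤ i → i ≤ k-1 → ∀ θ ∈ Set.Icc (0:ℝ) (Real.exp (-8/(p-1))),
          HasDerivWithinAt (a i) (a' i θ) (Set.Icc (0:ℝ) (Real.exp (-8/(p-1)))) θ) →
        (∀ i, 1 ≤ i → i ≤ k-1 →
          ContinuousOn (a' i) (Set.Icc (0:ℝ) (Real.exp (-8/(p-1))))) →
        (∀ i, 1 ≤ i → i ≤ k-1 → 0 ≤ a i 0 ∧ a i 0 ≤ φ) →
        (∀ i, 1 ≤ i → i ≤ k-1 → ∀ θ ∈ Set.Icc (0:ℝ) (Real.exp (-8/(p-1))),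
          |a' i θ + (if i = 1 then 0 else Real.exp (-(2/(p-1)) * a (i-1) θ))
            - 2 * Real.exp (-(2/(p-1)) * a i θ)
            + (if i = k-1 then 0 else Real.exp (-(2/(p-1)) * a (i+1) θ))|
          ≤ ε * ∑ j ∈ Finset.Icc 1 (k-1), Real.exp (-(2/(p-1)) * a j θ)) →
        ∀ i, 1 ≤ i → i ≤ k-1 → ∀ θ ∈ Set.Icc (0:ℝ) (Real.exp (-8/(p-1))),
          -4 ≤ a i θ ∧ a i θ ≤ φ + η₀ := by
  intro η hη
  have hp' : 0 < p - 1 := by linarith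
  have hT1 : Real.exp (-8/(p-1)) ≤ 1 := by
    rw [Real.exp_le_one_iff]
    exact div_nonpos_of_nonpos_of_nonneg (by norm_num) hp'.le
  have hβ : 0 < 2/(p-1) := by positivity
  generalize 2/(p-1) = β at *
  generalize Real.exp (-8/(p-1)) = T at *
  have hK : 0 < k * Real.exp (2*β) := by
    have : (0:ℝ) < k := by exact_mod_cast (by omega : 0 < k)
    positivity
  refine ⟨min (1/2) (η/4) / (k * Real.exp (2*β)), by positivity, 4/(β*η), by positivity, ?_⟩
  have hεp : 0 < min (1/2) (η/4) / (k * Real.exp (2*β)) := by positivity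
  have hεe : min (1/2) (η/4) / (k * Real.exp (2*β)) * (k * Real.exp (2*β)) = min (1/2) (η/4) :=
    div_mul_cancel₀ _ hK.ne'
  generalize min (1/2) (η/4) / (k * Real.exp (2*β)) = ε at *
  have he1 : ε * (k * Real.exp (2*β)) ≤ 1/2 := hεe ▸ min_le_left _ _
  have he2 : ε * (k * Real.exp (2*β)) ≤ η/4 := hεe ▸ min_le_right _ _
  intro φ hφ a a' hd _ h0 H
  have hL := lower_aux β T ε k hβ hT1 hεp he1 a a' hd (fun i h1 h2 => (h0 i h1 h2).1) H
  intro i hi1 hi2 θ hθ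
  refine ⟨by linarith [hL θ hθ i (Finset.mem_Icc.2 ⟨hi1, hi2⟩), hθ.2], ?_⟩
  have hU := upper_aux (a i) (a' i) T φ η (hd i hi1 hi2) (h0 i hi1 hi2).2 hη ?_ θ hθ
  · nlinarith [hθ.2]
  intro t ht hta
  have hS : ∑ j ∈ Finset.Icc 1 (k-1), Real.exp (-β * a j t) ≤ k * Real.exp (2*β) := by
    calc _ ≤ ∑ j ∈ Finset.Icc 1 (k-1), Real.exp (2*β) :=
          Finset.sum_le_sum fun j hj => by
            have := hL t ht j hj
            apply Real.exp_le_exp.2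
            have : -2 ≤ a j t := by linarith [ht.2]
            nlinarith
      _ = ((k-1 : ℕ):ℝ) * Real.exp (2*β) := by simp
      _ ≤ _ := by
        gcongr
        omega
  have hH := (abs_le.1 ((H i hi1 hi2 t ht).trans
    ((mul_le_mul_of_nonneg_left hS hεp.le).trans he2))).2
  have h1 : 0 ≤ (if i = 1 then 0 else Real.exp (-β * a (i-1) t)) := by
    split_ifs <;> positivity
  have h2 : 0 ≤ (if i = k-1 then 0 else Real.exp (-β * a (i+1) t)) := by
    split_ifs <;> positivity
  have h3 : Real.exp (-β * a i t) ≤ η/4 := by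
    have h4 : 4/η ≤ β * a i t := by
      calc 4/η = β * (4/(β*η)) := by field_simp
        _ ≤ _ := by gcongr; linarith
    have h5 : 4/η ≤ Real.exp (β * a i t) := by linarith [Real.add_one_le_exp (β * a i t)]
    rw [neg_mul, Real.exp_neg]
    calc _ ≤ (4/η)⁻¹ := inv_anti₀ (by positivity) h5
      _ = _ := by simp
  linarith
end

section
/- Let p > 1, set β = 2/(p−1), let k ≥ 2 be an integer and θ₀ > 0. Let a₁, …, a_{k−1} : [0, θ₀] → ℝ be C¹ functions satisfying, for all θ ∈ [0, θ₀] and all i = 1, …, k−1, a_i'(θ) = −E_{i−1}(θ) + 2E_i(θ) − E_{i+1}(θ), where E_i(θ) = e^{−β a_i(θ)} for 1 ≤ i ≤ k−1 and E₀ ≡ E_k ≡ 0. Assume that a_i(0) ≥ 0 for every i, and that there are integers 0 ≤ r₁ < r₂ ≤ k such that a_{r₁}(0) > 0 if r₁ ≥ 1, a_{r₂}(0) > 0 if r₂ ≤ k−1, and a_j(0) = 0 for every j with r₁ < j < r₂. Then there exists δ₀ ∈ (0, θ₀] such that a_j(θ) > 0 for every θ ∈ (0, δ₀] and every j with r₁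 ≤ j ≤ r₂ and 1 ≤ j ≤ k−1. -/
open Real

lemma toda_weak (r₁ r₂ : ℕ) (u c : ℕ → ℝ → ℝ) (δ : ℝ)
    (hc : ∀ j t, 0 ≤ c j t)
    (hd : ∀ j, r₁ < j → j < r₂ → ∀ t ∈ Set.Icc (0:ℝ) δ, HasDerivWithinAt (u j)
      (c j t * (u (j-1) t + u (j+1) t - 2 * u j t)) (Set.Icc (0:ℝ) δ) t)
    (h1 : ∀ t ∈ Set.Icc (0:ℝ) δ, 0 ≤ u r₁ t)
    (h2 : ∀ t ∈ Set.Icc (0:ℝ) δ, 0 ≤ u r₂ t)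
    (h0 : ∀ j, r₁ < j → j < r₂ → 0 ≤ u j 0) :
    ∀ t ∈ Set.Icc (0:ℝ) δ, ∀ j, r₁ ≤ j → j ≤ r₂ → 0 ≤ u j t := by
  have key : ∀ ε : ℝ, 0 < ε → ∀ t ∈ Set.Icc (0:ℝ) δ, ∀ j, r₁ < j → j < r₂ →
      0 < u j t + ε * (1 + t) := by
    intro ε hε
    by_contra hcon
    push Not at hcon
    obtain ⟨t₁, ht₁, j₁, hj₁, hj₁', hneg⟩ := hcon
    have hcont : ∀ j, r₁ < j → j < r₂ →
        ContinuousOn (fun t => u j t + ε * (1 + t)) (Set.Icc (0:ℝ) δ) := by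
      intro j hj hj'
      have : ContinuousOn (u j) (Set.Icc (0:ℝ) δ) :=
        fun t ht => (hd j hj hj' t ht).continuousWithinAt
      exact this.add (by fun_prop)
    set S : Set ℝ := ⋃ j ∈ Finset.Ioo r₁ r₂,
      (Set.Icc (0:ℝ) δ ∩ (fun t => u j t + ε * (1 + t)) ⁻¹' Set.Iic 0) with hS
    have hSc : IsClosed S := by
      rw [hS]
      refine isClosed_biUnion_finset ?_
      intro j hj
      rw [Finset.mem_Ioo] at hj
      exact (hcont j hj.1 hj.2).preimage_isClosed_of_isClosed isClosed_Icc isClosed_Iic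
    have hmem : ∀ t, t ∈ S ↔ ∃ j, (r₁ < j ∧ j < r₂) ∧ (0 ≤ t ∧ t ≤ δ) ∧
        u j t + ε * (1 + t) ≤ 0 := by
      intro t
      simp only [hS, Set.mem_iUnion, Finset.mem_Ioo, Set.mem_inter_iff, Set.mem_Icc,
        Set.mem_preimage, Set.mem_Iic, exists_prop]
    have hSn : S.Nonempty := ⟨t₁, (hmem t₁).2 ⟨j₁, ⟨hj₁, hj₁'⟩, ht₁, hneg⟩⟩
    have hSb : BddBelow S := ⟨0, fun t ht => by
      obtain ⟨j, _, h, _⟩ := (hmem t).1 ht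
      exact h.1⟩
    have hT := hSc.csInf_mem hSn hSb
    have hmin : ∀ t, t < sInf S → t ∉ S := fun t ht => notMem_of_lt_csInf ht hSb
    generalize sInf S = T at hT hmin
    obtain ⟨j, ⟨hj, hj'⟩, hTI, hjT⟩ := (hmem T).1 hT
    have hTpos : 0 < T := by
      rcases hTI.1.lt_or_eq with h | h
      · exact h
      · rw [← h] at hjT
        have := h0 j hj hj'
        linarith
    have hbef : ∀ t ∈ Set.Ico 0 T, ∀ i, r₁ < i → i < r₂ → 0 < u i t + ε * (1 + t) := by
      intro t ht i hi hi'
      by_contra hle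
      exact hmin t ht.2 ((hmem t).2 ⟨i, ⟨hi, hi'⟩, ⟨ht.1, ht.2.le.trans hTI.2⟩, not_lt.1 hle⟩)
    have hsub : Set.Ico 0 T ⊆ Set.Icc 0 δ := fun t ht => ⟨ht.1, ht.2.le.trans hTI.2⟩
    haveI : (nhdsWithin T (Set.Ico 0 T)).NeBot := by
      rw [nhdsWithin_Ico_eq_nhdsLT hTpos]
      infer_instance
    have hat : ∀ i, r₁ ≤ i → i ≤ r₂ → 0 ≤ u i T + ε * (1 + T) := by
      intro i hi hi'
      have hεT : 0 ≤ ε * (1 + T) := by positivity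
      rcases hi.eq_or_lt with h | h
      · subst h
        have := h1 T hTI
        linarith
      rcases hi'.eq_or_lt with h' | h'
      · subst h'
        have := h2 T hTI
        linarith
      have hti := ((hcont i h h') T hTI).mono hsub
      refine ge_of_tendsto hti ?_
      filter_upwards [self_mem_nhdsWithin] with t ht
      exact (hbef t ht i h h').le
    have hjz : u j T + ε * (1 + T) = 0 := le_antisymm hjT (hat j hj.le hj'.le)
    have hder : HasDerivWithinAt (fun t => u j t + ε * (1 + t))
        (c j T * (u (j-1) T + u (j+1) T - 2 * u j T) + ε * 1) (Set.Ico 0 T) T := by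
      refine ((hd j hj hj' T hTI).mono hsub).add ?_
      exact (((hasDerivAt_id T).const_add 1).const_mul ε).hasDerivWithinAt
    rw [hasDerivWithinAt_iff_tendsto_slope' (by simp)] at hder
    have hle := le_of_tendsto (b := 0) hder (by
      filter_upwards [self_mem_nhdsWithin] with t ht
      have hp := hbef t ht j hj hj'
      rw [slope_def_field]
      refine div_nonpos_of_nonneg_of_nonpos ?_ ?_
      · simp only [hjz]
        linarith
      · linarith [ht.2])
    have ha := hat (j-1) (by omega) (by omega)
    have hb := hat (j+1) (by omega) (by omega)
    have : 0 ≤ c j T * (u (j-1) T + u (j+1) T - 2 * u j T) :=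
      mul_nonneg (hc j T) (by linarith)
    linarith
  intro t ht j hj hj'
  rcases hj.eq_or_lt with h | h
  · subst h
    exact h1 t ht
  rcases hj'.eq_or_lt with h' | h'
  · subst h'
    exact h2 t ht
  by_contra hlt
  push Not at hlt
  have h1t : 0 < 1 + t := by linarith [ht.1]
  have := key (-u j t / (1 + t)) (div_pos (by linarith) h1t) t ht j h h'
  rw [div_mul_cancel₀ _ h1t.ne'] at this
  linarith

/-- Instantaneous positivity for the Toda-lattice type system governing the gaps between
the solitons' centers: if the gaps `a_j` satisfy
`a_j' = -E_{j-1} + 2E_j - E_{j+1}` on `[0, θ₀]` with `E_j = e^{-βa_j}` for `1 ≤ j ≤ k-1`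
and `E₀ = E_k = 0`, all start nonnegative, and a block `r₁ < j < r₂` of gaps vanishes at
time `0` while the flanking values `a_{r₁}(0)`, `a_{r₂}(0)` are positive (when present),
then all gaps with indices in `[r₁, r₂]` are strictly positive immediately after time `0`. -/
theorem toda_instant_positivity (p : ℝ) (hp : 1 < p) (k : ℕ) (hk : 2 ≤ k)
    (θ₀ : ℝ) (hθ₀ : 0 < θ₀)
    (a : ℕ → ℝ → ℝ) (E : ℕ → ℝ → ℝ)
    (hE : ∀ i θ, E i θ =
      if 1 ≤ i ∧ i ≤ k - 1 then Real.exp (-(2/(p-1)) * a i θ) else 0)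
    (hODE : ∀ i, 1 ≤ i → i ≤ k-1 → ∀ θ ∈ Set.Icc (0:ℝ) θ₀,
      HasDerivWithinAt (a i) (-(E (i-1) θ) + 2 * E i θ - E (i+1) θ)
        (Set.Icc (0:ℝ) θ₀) θ)
    (hinit : ∀ i, 1 ≤ i → i ≤ k-1 → 0 ≤ a i 0)
    (r₁ r₂ : ℕ) (hr : r₁ < r₂) (hr₂ : r₂ ≤ k)
    (hpos₁ : 1 ≤ r₁ → 0 < a r₁ 0)
    (hpos₂ : r₂ ≤ k-1 → 0 < a r₂ 0)
    (hzero : ∀ j, r₁ < j → j < r₂ → a j 0 = 0) :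
    ∃ δ₀ ∈ Set.Ioc (0:ℝ) θ₀, ∀ θ ∈ Set.Ioc (0:ℝ) δ₀,
      ∀ j, r₁ ≤ j → j ≤ r₂ → 1 ≤ j → j ≤ k-1 → 0 < a j θ := by
  obtain ⟨β, hβ⟩ : ∃ β, β = 2 / (p - 1) := ⟨_, rfl⟩
  have hβpos : 0 < β := by
    rw [hβ]
    exact div_pos two_pos (by linarith)
  rw [← hβ] at hE
  have hEin : ∀ i, 1 ≤ i → i ≤ k - 1 → ∀ t, E i t = Real.exp (-β * a i t) := by
    intro i hi hi' t
    rw [hE, if_pos ⟨hi, hi'⟩]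
  have hEout : ∀ i, ¬ (1 ≤ i ∧ i ≤ k - 1) → ∀ t, E i t = 0 := by
    intro i hi t
    rw [hE, if_neg hi]
  have hE0 : ∀ i t, 0 ≤ E i t := by
    intro i t
    rw [hE]
    split_ifs
    · positivity
    · exact le_rfl
  have hEd : ∀ i, 1 ≤ i → i ≤ k-1 → ∀ t ∈ Set.Icc (0:ℝ) θ₀,
      HasDerivWithinAt (E i) (E i t * (-β * (-(E (i-1) t) + 2 * E i t - E (i+1) t)))
        (Set.Icc (0:ℝ) θ₀) t := by
    intro i hi hi' t ht
    have h := ((hODE i hi hi' t ht).const_mul (-β)).exp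
    rw [← hEin i hi hi' t] at h
    have he : E i = fun t => Real.exp (-β * a i t) := funext (hEin i hi hi')
    rw [← he] at h
    exact h
  have hbd : ∀ r, (1 ≤ r → r ≤ k - 1 → 0 < a r 0) →
      ∀ᶠ t in nhdsWithin 0 (Set.Icc (0:ℝ) θ₀), E r t < 1 := by
    intro r hr
    by_cases h : 1 ≤ r ∧ r ≤ k - 1
    · have hc := (hEd r h.1 h.2 0 ⟨le_rfl, hθ₀.le⟩).continuousWithinAt
      refine hc.eventually_lt_const ?_
      rw [hEin r h.1 h.2, Real.exp_lt_one_iff]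
      nlinarith [mul_pos hβpos (hr h.1 h.2)]
    · refine Filter.Eventually.of_forall fun t => ?_
      rw [hEout r h]
      exact one_pos
  have hev := (hbd r₁ (fun h _ => hpos₁ h)).and (hbd r₂ (fun _ h => hpos₂ h))
  rw [nhdsWithin_Icc_eq_nhdsGE hθ₀] at hev
  obtain ⟨δ', hδ', hsub'⟩ := (mem_nhdsGE_iff_exists_Icc_subset).1 hev
  obtain ⟨δ, hδ⟩ : ∃ δ, δ = min δ' θ₀ := ⟨_, rfl⟩
  have hδpos : 0 < δ := by
    rw [hδ]
    exact lt_min hδ' hθ₀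
  have hδθ : δ ≤ θ₀ := hδ ▸ min_le_right _ _
  have hδδ : δ ≤ δ' := hδ ▸ min_le_left _ _
  have hb : ∀ t ∈ Set.Icc (0:ℝ) δ, E r₁ t < 1 ∧ E r₂ t < 1 :=
    fun t ht => hsub' ⟨ht.1, ht.2.trans hδδ⟩
  have hsub : Set.Icc (0:ℝ) δ ⊆ Set.Icc 0 θ₀ := Set.Icc_subset_Icc_right hδθ
  have hud : ∀ j, r₁ < j → j < r₂ → ∀ t ∈ Set.Icc (0:ℝ) δ,
      HasDerivWithinAt (fun t => 1 - E j t)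
      (β * E j t * ((1 - E (j-1) t) + (1 - E (j+1) t) - 2 * (1 - E j t)))
      (Set.Icc (0:ℝ) δ) t := by
    intro j hj hj' t ht
    have := ((hEd j (by omega) (by omega) t (hsub ht)).mono hsub).const_sub 1
    exact this.congr_deriv (by ring)
  have hu0 : ∀ j, r₁ < j → j < r₂ → 0 ≤ 1 - E j 0 := by
    intro j hj hj'
    rw [hEin j (by omega) (by omega), hzero j hj hj']
    simp
  have hweak := toda_weak r₁ r₂ (fun j t => 1 - E j t) (fun j t => β * E j t) δ
    (fun j t => mul_nonneg hβpos.le (hE0 j t)) hud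
    (fun t ht => by linarith [(hb t ht).1]) (fun t ht => by linarith [(hb t ht).2]) hu0
  have hstrong : ∀ j, r₁ ≤ j → j ≤ r₂ → ∀ t ∈ Set.Ioc (0:ℝ) δ, 0 < 1 - E j t := by
    intro j hj
    induction j, hj using Nat.le_induction with
    | base =>
      intro _ t ht
      linarith [(hb t ⟨ht.1.le, ht.2⟩).1]
    | succ j hj ih =>
      intro hj' t ht
      rcases hj'.eq_or_lt with h | h
      · rw [h]
        linarith [(hb t ⟨ht.1.le, ht.2⟩).2]
      have hdd : ∀ s ∈ Set.Icc (0:ℝ) δ, HasDerivWithinAt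
          (fun s => Real.exp (2 * β * s) * (1 - E (j+1) s))
          (Real.exp (2 * β * s) * (2 * β * 1) * (1 - E (j+1) s) + Real.exp (2 * β * s) *
           (β * E (j+1) s * ((1 - E (j+1-1) s) + (1 - E (j+1+1) s) - 2 * (1 - E (j+1) s))))
          (Set.Icc (0:ℝ) δ) s := by
        intro s hs
        exact (((hasDerivAt_id s).const_mul (2 * β)).exp.hasDerivWithinAt).mul
          (hud (j+1) (by omega) h s hs)
      have hmono : StrictMonoOn (fun s => Real.exp (2 * β * s) * (1 - E (j+1) s))
          (Set.Icc (0:ℝ) δ) := by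
        refine strictMonoOn_of_deriv_pos (convex_Icc _ _)
          (fun s hs => (hdd s hs).continuousWithinAt) ?_
        intro s hs
        rw [interior_Icc] at hs
        have hsI : s ∈ Set.Icc (0:ℝ) δ := ⟨hs.1.le, hs.2.le⟩
        rw [((hdd s hsI).hasDerivAt (Icc_mem_nhds hs.1 hs.2)).deriv]
        have e1 := ih (by omega) s ⟨hs.1, hs.2.le⟩
        have e2 : 0 ≤ 1 - E (j+1) s := hweak s hsI (j+1) (by omega) (by omega)
        have e3 : 0 ≤ 1 - E (j+1+1) s := hweak s hsI (j+1+1) (by omega) (by omega)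
        have e4 : 0 < E (j+1) s := by
          rw [hEin (j+1) (by omega) (by omega)]
          positivity
        rw [Nat.add_sub_cancel]
        have e5 : 0 < 2 * β * (1 - E (j+1) s) * (1 - E (j+1) s)
            + β * E (j+1) s * ((1 - E j s) + (1 - E (j+1+1) s)) := by
          have : 0 < (1 - E j s) + (1 - E (j+1+1) s) := by linarith
          positivity
        have := mul_pos (Real.exp_pos (2 * β * s)) e5
        linarith
      have hlt := hmono ⟨le_rfl, hδpos.le⟩ ⟨ht.1.le, ht.2⟩ ht.1
      have h00 := hu0 (j+1) (by omega) h
      simp only [mul_zero, Real.exp_zero, one_mul] at hlt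
      exact pos_of_mul_pos_right (h00.trans_lt hlt) (Real.exp_pos _).le
  refine ⟨δ, ⟨hδpos, hδθ⟩, ?_⟩
  intro t ht j hj hj' h1 hk1
  have h := hstrong j hj hj' t ht
  rw [hEin j h1 hk1, sub_pos, Real.exp_lt_one_iff] at h
  by_contra hn
  nlinarith [mul_nonneg hβpos.le (neg_nonneg.2 (not_lt.1 hn))]
end

section
/- For every a > 0 there exists a constant C₀ > 0 such that lim_{L → +∞} (e^{aL}/L) ∫_ℝ cosh(z)^{−a} cosh(z − L)^{−a} dz = C₀. In particular ∫_ℝ cosh(z)^{−a} cosh(z − L)^{−a} dz ∼ C₀ L e^{−aL} as L → +∞. -/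
open Real Filter MeasureTheory Asymptotics

lemma aux_integrable (b : ℝ) (hb : 0 < b) : Integrable (fun t : ℝ => Real.exp (-b * |t|)) := by
  rw [← integrableOn_univ, ← Set.Iic_union_Ioi (a := (0:ℝ))]
  refine IntegrableOn.union ?_ ?_
  · refine (integrableOn_exp_mul_Iic hb 0).congr_fun ?_ measurableSet_Iic
    intro t ht
    simp only [Set.mem_Iic] at ht
    simp [abs_of_nonpos ht]
  · refine (integrableOn_exp_mul_Ioi (neg_lt_zero.mpr hb) 0).congr_fun ?_ measurableSet_Ioi
    intro t ht
    simp only [Set.mem_Ioi] at ht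
    simp [abs_of_pos ht]

lemma aux_cosh (x : ℝ) : Real.exp |x| / 2 ≤ Real.cosh x := by
  rw [← Real.cosh_abs, Real.cosh_eq]
  have := Real.exp_pos (-|x|)
  linarith

lemma aux_bound (a : ℝ) (ha : 0 < a) (L t : ℝ) (hL : 0 < L) :
    (Real.cosh (L * t) * Real.cosh (L * t - L) * Real.exp (-L)) ^ (-a)
      ≤ 4 ^ a * Real.exp (a * L * (1 - |t| - |t - 1|)) := by
  have h1 := aux_cosh (L * t)
  have h2 := aux_cosh (L * t - L)
  have e1 : |L * t| = L * |t| := by rw [abs_mul, abs_of_pos hL]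
  have e2 : |L * t - L| = L * |t - 1| := by
    rw [show L * t - L = L * (t - 1) by ring, abs_mul, abs_of_pos hL]
  rw [e1] at h1
  rw [e2] at h2
  have h3 : (4:ℝ)⁻¹ * Real.exp (L * (|t| + |t - 1| - 1))
      ≤ Real.cosh (L * t) * Real.cosh (L * t - L) * Real.exp (-L) := by
    have : (4:ℝ)⁻¹ * Real.exp (L * (|t| + |t - 1| - 1))
        = Real.exp (L * |t|) / 2 * (Real.exp (L * |t - 1|) / 2) * Real.exp (-L) := by
      rw [show L * (|t| + |t - 1| - 1) = L * |t| + L * |t-1| + -L by ring, Real.exp_add,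
        Real.exp_add]
      ring
    rw [this]
    gcongr
  refine (Real.rpow_le_rpow_of_nonpos (by positivity) h3 (by linarith)).trans ?_
  rw [Real.mul_rpow (by positivity) (by positivity), Real.inv_rpow (by norm_num),
    Real.rpow_neg (by norm_num), inv_inv, ← Real.exp_mul]
  apply le_of_eq
  congr 2
  ring

lemma aux_lim_in (a t : ℝ) (h0 : 0 < t) (h1 : t < 1) :
    Tendsto (fun L : ℝ => (Real.cosh (L * t) * Real.cosh (L * t - L) * Real.exp (-L)) ^ (-a))
      atTop (nhds (4 ^ a)) := by
  have key : ∀ L : ℝ, Real.cosh (L * t) * Real.cosh (L * t - L) * Real.exp (-L)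
      = (1 + Real.exp (-2 * L) + Real.exp (2 * (t - 1) * L) + Real.exp (-2 * t * L)) / 4 := by
    intro L
    rw [Real.cosh_eq, Real.cosh_eq]
    have a1 : Real.exp (-2 * L) = Real.exp (-(L*t)) * Real.exp (L * t - L) * Real.exp (-L) := by
      rw [← Real.exp_add, ← Real.exp_add]; ring_nf
    have a2 : Real.exp (2 * (t-1) * L) = Real.exp (L*t) * Real.exp (L * t - L) * Real.exp (-L) := by
      rw [← Real.exp_add, ← Real.exp_add]; ring_nf
    have a3 : Real.exp (-2 * t * L) = Real.exp (-(L*t)) * Real.exp (-(L * t - L)) * Real.exp (-L) := by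
      rw [← Real.exp_add, ← Real.exp_add]; ring_nf
    have a4 : 1 = Real.exp (L*t) * Real.exp (-(L * t - L)) * Real.exp (-L) := by
      rw [← Real.exp_add, ← Real.exp_add]; ring_nf; simp
    rw [a1, a2, a3]
    linear_combination (-1/4) * a4
  simp only [key]
  have hexp : ∀ c : ℝ, c < 0 → Tendsto (fun L : ℝ => Real.exp (c * L)) atTop (nhds 0) := by
    intro c hc
    exact Real.tendsto_exp_atBot.comp (tendsto_id.const_mul_atTop_of_neg hc)
  have h := ((((tendsto_const_nhds (x := (1:ℝ))).add (hexp (-2) (by norm_num))).add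
    (hexp (2 * (t-1)) (by linarith))).add (hexp (-2 * t) (by linarith))).div_const 4
  have h' := h.rpow_const (p := -a) (Or.inl (by norm_num))
  convert h' using 2
  rw [show ((1:ℝ) + 0 + 0 + 0) / 4 = 4⁻¹ by norm_num, Real.inv_rpow (by norm_num),
    Real.rpow_neg (by norm_num), inv_inv]

lemma aux_lim_out (a t : ℝ) (ha : 0 < a) (h : t < 0 ∨ 1 < t) :
    Tendsto (fun L : ℝ => (Real.cosh (L * t) * Real.cosh (L * t - L) * Real.exp (-L)) ^ (-a))
      atTop (nhds 0) := by
  have hneg : 1 - |t| - |t - 1| < 0 := by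
    rcases h with h | h
    · rw [abs_of_neg h, abs_of_neg (by linarith)]; linarith
    · rw [abs_of_pos (by linarith), abs_of_pos (by linarith)]; linarith
  have hl : Tendsto (fun L : ℝ => 4 ^ a * Real.exp (a * L * (1 - |t| - |t - 1|))) atTop
      (nhds 0) := by
    have h1 : Tendsto (fun L : ℝ => a * L * (1 - |t| - |t - 1|)) atTop atBot :=
      (tendsto_id.const_mul_atTop ha).atTop_mul_const_of_neg hneg
    simpa using (Real.tendsto_exp_atBot.comp h1).const_mul ((4:ℝ) ^ a)
  refine tendsto_of_tendsto_of_tendsto_of_le_of_le' tendsto_const_nhds hl ?_ ?_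
  · refine Eventually.of_forall fun L => ?_
    have := Real.cosh_pos (L * t)
    have := Real.cosh_pos (L * t - L)
    positivity
  · filter_upwards [eventually_gt_atTop 0] with L hL
    exact aux_bound a ha L t hL

lemma aux_main_s9 (a : ℝ) (ha : 0 < a) :
    Tendsto (fun L : ℝ => (Real.exp (a * L) / L) *
            ∫ z : ℝ, Real.cosh z ^ (-a) * Real.cosh (z - L) ^ (-a))
        atTop (nhds (4 ^ a)) := by
  have h := tendsto_integral_filter_of_dominated_convergence (μ := volume) (l := atTop)
    (F := fun L t : ℝ => (Real.cosh (L * t) * Real.cosh (L * t - L) * Real.exp (-L)) ^ (-a))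
    (f := Set.indicator (Set.Ioo 0 1) (fun _ : ℝ => (4:ℝ) ^ a))
    (fun t => 4 ^ a * Real.exp (2 * a) * Real.exp (-(2 * a) * |t|)) ?_ ?_ ?_ ?_
  · have e : ∫ t : ℝ, Set.indicator (Set.Ioo 0 1) (fun _ : ℝ => (4:ℝ) ^ a) t = 4 ^ a := by
      rw [integral_indicator measurableSet_Ioo]
      simp
    rw [e] at h
    refine h.congr' ?_
    filter_upwards [eventually_gt_atTop 0] with L hL
    have := Measure.integral_comp_mul_left
      (fun z : ℝ => Real.cosh z ^ (-a) * Real.cosh (z - L) ^ (-a)) L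
    rw [abs_of_pos (inv_pos.mpr hL), smul_eq_mul] at this
    rw [div_eq_mul_inv, mul_assoc, ← this, ← integral_const_mul]
    refine integral_congr_ae (Eventually.of_forall fun t => ?_)
    have c1 := Real.cosh_pos (L * t)
    have c2 := Real.cosh_pos (L * t - L)
    simp only
    rw [Real.mul_rpow (by positivity) (by positivity), Real.mul_rpow c1.le c2.le, ← Real.exp_mul]
    ring_nf
  · refine Eventually.of_forall fun L => Measurable.aestronglyMeasurable ?_
    fun_prop
  · filter_upwards [eventually_ge_atTop 1] with L hL
    refine Eventually.of_forall fun t => ?_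
    have c1 := Real.cosh_pos (L * t)
    have c2 := Real.cosh_pos (L * t - L)
    rw [Real.norm_of_nonneg (by positivity)]
    refine (aux_bound a ha L t (by linarith)).trans ?_
    rw [mul_assoc (4 ^ a), ← Real.exp_add]
    gcongr
    have b1 : 1 ≤ |t| + |t - 1| := by
      have := abs_sub t (t - 1)
      simpa using this
    have b2 : |t| ≤ |t - 1| + 1 := by
      have := abs_add_le (t - 1) 1
      simpa using this
    have b3 : L * (1 - |t| - |t - 1|) ≤ 2 - 2 * |t| := by nlinarith
    nlinarith
  · exact (aux_integrable (2 * a) (by linarith)).const_mul _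
  · have hne : ∀ c : ℝ, ∀ᵐ t : ℝ, t ≠ c := fun c => by
      simp [ae_iff]
    filter_upwards [hne 0, hne 1] with t h0 h1
    by_cases ht : t ∈ Set.Ioo (0:ℝ) 1
    · rw [Set.indicator_of_mem ht]
      exact aux_lim_in a t ht.1 ht.2
    · rw [Set.indicator_of_notMem ht]
      refine aux_lim_out a t ha ?_
      by_contra hc
      push Not at hc
      exact ht ⟨lt_of_le_of_ne hc.1 (Ne.symm h0), lt_of_le_of_ne hc.2 h1⟩

/-- Overlap integral between two solitons at hyperbolic distance `L`, case of equal
exponents: for `a > 0` there is `C₀ > 0` with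
`∫ cosh(z)^{-a} cosh(z-L)^{-a} dz ∼ C₀ L e^{-aL}` as `L → ∞`. -/
theorem soliton_overlap_equal_exponents (a : ℝ) (ha : 0 < a) :
    ∃ C₀ > (0:ℝ),
      Tendsto (fun L : ℝ =>
          (Real.exp (a * L) / L) *
            ∫ z : ℝ, Real.cosh z ^ (-a) * Real.cosh (z - L) ^ (-a))
        atTop (nhds C₀) ∧
      (fun L : ℝ => ∫ z : ℝ, Real.cosh z ^ (-a) * Real.cosh (z - L) ^ (-a))
        ~[atTop] (fun L : ℝ => C₀ * L * Real.exp (-(a * L))) := by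
  have hC : (0:ℝ) < 4 ^ a := by positivity
  refine ⟨4 ^ a, hC, aux_main_s9 a ha, ?_⟩
  apply isEquivalent_of_tendsto_one
  have h := (aux_main_s9 a ha).div_const ((4:ℝ) ^ a)
  rw [div_self hC.ne'] at h
  refine h.congr fun L => ?_
  simp only [Pi.div_apply]
  rw [Real.exp_neg]
  simp only [div_eq_mul_inv, mul_inv, inv_inv]
  ring
end

section
/- Let a > b > 0. Then ∫_ℝ cosh(z)^{−a} e^{bz} dz is finite and positive, and lim_{L → +∞} e^{bL} ∫_ℝ cosh(z)^{−a} cosh(z − L)^{−b} dz = 2^b ∫_ℝ cosh(z)^{−a} e^{bz} dz. In particular ∫_ℝ cosh(z)^{−a} cosh(z − L)^{−b} dz ∼ C₀ e^{−bL} as L → +∞ for the positive constant C₀ = 2^b ∫_ℝ cosh(z)^{−a} e^{bz} dz. -/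
open Real Filter MeasureTheory Asymptotics

lemma sol_rpow (b z : ℝ) : (Real.exp (-z) / 2) ^ (-b) = (2:ℝ) ^ b * Real.exp (b * z) := by
  rw [Real.div_rpow (Real.exp_pos _).le (by norm_num), ← Real.exp_mul,
    Real.rpow_neg (by norm_num), div_inv_eq_mul, mul_comm]
  congr 2
  ring

lemma sol_cont (a L : ℝ) : Continuous (fun z : ℝ => Real.cosh (z - L) ^ (-a)) :=
  (Real.continuous_cosh.comp (continuous_id.sub continuous_const)).rpow_const
    (fun z => Or.inl (Real.cosh_pos _).ne')

lemma sol_cont0 (a : ℝ) : Continuous (fun z : ℝ => Real.cosh z ^ (-a)) :=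
  Real.continuous_cosh.rpow_const (fun z => Or.inl (Real.cosh_pos _).ne')

lemma sol_int (a b : ℝ) (hb : 0 < b) (hab : b < a) :
    Integrable (fun z : ℝ => Real.cosh z ^ (-a) * Real.exp (b * z)) := by
  have hc : Continuous (fun z : ℝ => Real.cosh z ^ (-a) * Real.exp (b * z)) :=
    (sol_cont0 a).mul (by fun_prop)
  rw [← integrableOn_univ, ← Set.Iic_union_Ioi (a := (0:ℝ))]
  refine IntegrableOn.union ?_ ?_
  · refine Integrable.mono' (integrableOn_exp_mul_Iic hb 0) hc.aestronglyMeasurable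
      (Eventually.of_forall fun z => ?_)
    have h1 : Real.cosh z ^ (-a) ≤ 1 :=
      Real.rpow_le_one_of_one_le_of_nonpos (Real.one_le_cosh z) (by linarith)
    have h0 : 0 < Real.cosh z ^ (-a) := Real.rpow_pos_of_pos (Real.cosh_pos z) _
    rw [Real.norm_of_nonneg (by positivity)]
    nlinarith [Real.exp_pos (b * z)]
  · refine Integrable.mono' ((integrableOn_exp_mul_Ioi (a := b - a) (by linarith) 0).const_mul
      ((2:ℝ) ^ a)) hc.aestronglyMeasurable (Eventually.of_forall fun z => ?_)
    have h0 : 0 < Real.cosh z ^ (-a) := Real.rpow_pos_of_pos (Real.cosh_pos z) _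
    have h1 : Real.cosh z ^ (-a) ≤ (Real.exp (-(-z)) / 2) ^ (-a) := by
      apply Real.rpow_le_rpow_of_nonpos (by positivity) _ (by linarith)
      rw [Real.cosh_eq, neg_neg]
      have := Real.exp_pos (-z)
      linarith
    rw [sol_rpow] at h1
    rw [Real.norm_of_nonneg (by positivity)]
    calc _ ≤ (2:ℝ) ^ a * Real.exp (a * -z) * Real.exp (b * z) := by gcongr
      _ = _ := by rw [mul_assoc, ← Real.exp_add]; congr 2; ring

lemma sol_eq (b L z : ℝ) : Real.exp (b * L) * Real.cosh (z - L) ^ (-b)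
    = ((Real.exp (z - 2 * L) + Real.exp (-z)) / 2) ^ (-b) := by
  have : (Real.exp (z - 2 * L) + Real.exp (-z)) / 2 = Real.exp (-L) * Real.cosh (z - L) := by
    rw [Real.cosh_eq, mul_div_assoc', mul_add, ← Real.exp_add, ← Real.exp_add]
    congr 3 <;> ring
  rw [this, Real.mul_rpow (Real.exp_pos _).le (Real.cosh_pos _).le, ← Real.exp_mul]
  congr 2
  ring

lemma sol_tendsto (a b : ℝ) (hb : 0 < b) (hab : b < a) :
    Tendsto (fun L : ℝ =>
        Real.exp (b * L) * ∫ z : ℝ, Real.cosh z ^ (-a) * Real.cosh (z - L) ^ (-b))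
      atTop
      (nhds ((2:ℝ) ^ b * ∫ z : ℝ, Real.cosh z ^ (-a) * Real.exp (b * z))) := by
  simp_rw [← integral_const_mul]
  refine tendsto_integral_filter_of_dominated_convergence
    (fun z => (2:ℝ) ^ b * (Real.cosh z ^ (-a) * Real.exp (b * z))) ?_ ?_
    ((sol_int a b hb hab).const_mul _) ?_
  · refine Eventually.of_forall fun L => Continuous.aestronglyMeasurable ?_
    exact continuous_const.mul ((sol_cont0 a).mul (sol_cont b L))
  · refine Eventually.of_forall fun L => Eventually.of_forall fun z => ?_
    have h0 : 0 < Real.cosh z ^ (-a) := Real.rpow_pos_of_pos (Real.cosh_pos z) _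
    have h2 : 0 < Real.cosh (z - L) ^ (-b) := Real.rpow_pos_of_pos (Real.cosh_pos _) _
    rw [Real.norm_of_nonneg (by positivity), mul_left_comm, sol_eq, mul_left_comm, ← sol_rpow]
    gcongr ?_ * ?_
    apply Real.rpow_le_rpow_of_nonpos (by positivity) _ (by linarith)
    have := Real.exp_pos (z - 2 * L)
    linarith
  · refine Eventually.of_forall fun z => ?_
    simp_rw [mul_left_comm _ (Real.cosh z ^ (-a)), sol_eq, ← sol_rpow]
    refine Tendsto.const_mul _ (Tendsto.rpow_const ?_ (Or.inl (by positivity)))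
    have h : Tendsto (fun L : ℝ => Real.exp (z - 2 * L)) atTop (nhds 0) := by
      refine Real.tendsto_exp_atBot.comp ?_
      simp_rw [sub_eq_add_neg]
      exact tendsto_atBot_add_const_left _ _
        (tendsto_neg_atTop_atBot.comp (tendsto_id.const_mul_atTop (by norm_num)))
    simpa using (h.add_const (Real.exp (-z))).div_const 2

/-- Overlap integral between two solitons at hyperbolic distance `L`, case of distinct
exponents `a > b > 0`: `∫ cosh(z)^{-a} e^{bz} dz` is finite and positive, and
`∫ cosh(z)^{-a} cosh(z-L)^{-b} dz ∼ C₀ e^{-bL}` as `L → ∞`, with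
`C₀ = 2^b ∫ cosh(z)^{-a} e^{bz} dz`. -/
theorem soliton_overlap_distinct_exponents (a b : ℝ) (hb : 0 < b) (hab : b < a) :
    Integrable (fun z : ℝ => Real.cosh z ^ (-a) * Real.exp (b * z)) ∧
    0 < ∫ z : ℝ, Real.cosh z ^ (-a) * Real.exp (b * z) ∧
    Tendsto (fun L : ℝ =>
        Real.exp (b * L) * ∫ z : ℝ, Real.cosh z ^ (-a) * Real.cosh (z - L) ^ (-b))
      atTop
      (nhds ((2:ℝ) ^ b * ∫ z : ℝ, Real.cosh z ^ (-a) * Real.exp (b * z))) ∧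
    (fun L : ℝ => ∫ z : ℝ, Real.cosh z ^ (-a) * Real.cosh (z - L) ^ (-b))
      ~[atTop]
      (fun L : ℝ => ((2:ℝ) ^ b * ∫ z : ℝ, Real.cosh z ^ (-a) * Real.exp (b * z)) *
        Real.exp (-(b * L))) := by
  have hi := sol_int a b hb hab
  have hpos : 0 < ∫ z : ℝ, Real.cosh z ^ (-a) * Real.exp (b * z) := by
    have hp : ∀ z : ℝ, 0 < Real.cosh z ^ (-a) * Real.exp (b * z) := fun z =>
      mul_pos (Real.rpow_pos_of_pos (Real.cosh_pos z) _) (Real.exp_pos _)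
    rw [integral_pos_iff_support_of_nonneg (fun z => (hp z).le) hi]
    have : Function.support (fun z : ℝ => Real.cosh z ^ (-a) * Real.exp (b * z)) = Set.univ :=
      Set.eq_univ_of_forall fun z => (hp z).ne'
    rw [this]
    simp
  have ht := sol_tendsto a b hb hab
  refine ⟨hi, hpos, ht, ?_⟩
  have hC : 0 < (2:ℝ) ^ b * ∫ z : ℝ, Real.cosh z ^ (-a) * Real.exp (b * z) := by positivity
  rw [isEquivalent_iff_tendsto_one
    (Eventually.of_forall fun L => (mul_pos hC (Real.exp_pos _)).ne')]
  have h2 := ht.div_const ((2:ℝ) ^ b * ∫ z : ℝ, Real.cosh z ^ (-a) * Real.exp (b * z))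
  rw [div_self hC.ne'] at h2
  refine h2.congr fun L => ?_
  simp only [Pi.div_apply]
  rw [Real.exp_neg, ← div_eq_mul_inv, div_div_eq_mul_div, mul_comm]
end

section
/- Let 1 < p < 2 and let k ≥ 1 be an integer. There exist constants A > 0 and C > 0, depending only on p and k, such that for all real numbers ζ₁ < ζ₂ < ⋯ < ζ_k with ζ_{j+1} − ζ_j ≥ A for every j = 1, …, k−1, all signs e₁, …, e_k ∈ {−1, 1}, and every i ∈ {1, …, k}, the (a.e.-defined) integral ∫_ℝ cosh(ξ − ζ_i)^{−2/(p−1)} · |Σ_{j=1}^{k} e_j cosh(ξ − ζ_j)^{−2/(p−1)}|^{p−2} dξ is finite and at most C. (Since p − 2 < 0 the integrand is singular at the zeros of the sum, which form a Lebesgue-null set.) -/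
open Real MeasureTheory

lemma sol_small (a : ℝ) (ha : 1 ≤ a) (ε : ℝ) (h0 : 0 < ε) (h1 : ε ≤ 1) :
    ∃ T > (0:ℝ), ∀ t, T ≤ t → (2 * exp (-t)) ^ a ≤ ε := by
  refine ⟨-log (ε/2), ?_, ?_⟩
  · have : log (ε/2) < 0 := Real.log_neg (by linarith) (by linarith)
    linarith
  · intro t ht
    have h2 : exp (-t) ≤ ε/2 := by
      rw [← Real.exp_log (show (0:ℝ) < ε/2 by linarith)]
      exact Real.exp_le_exp.2 (by linarith)
    have h3 : (2 * exp (-t)) ^ a ≤ (2 * exp (-t)) ^ (1:ℝ) :=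
      Real.rpow_le_rpow_of_exponent_ge (by positivity) (by linarith) ha
    rw [Real.rpow_one] at h3
    linarith

lemma sol_ratio (a : ℝ) (ha : 0 ≤ a) (x y t : ℝ) (h : |y| + t ≤ |x|) :
    cosh x ^ (-a) ≤ (2 * exp (-t)) ^ a * cosh y ^ (-a) := by
  have hx := Real.cosh_pos x
  have hy := Real.cosh_pos y
  have h1 : cosh y ≤ 2 * exp (-t) * cosh x := by
    have e1 : cosh y ≤ exp |y| := by
      rw [← Real.cosh_abs y, Real.cosh_eq]
      have : exp (-|y|) ≤ exp |y| := Real.exp_le_exp.2 (by linarith [abs_nonneg y])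
      linarith
    have e2 : exp |x| ≤ 2 * cosh x := by
      rw [← Real.cosh_abs x, Real.cosh_eq]
      have := Real.exp_pos (-|x|)
      linarith
    have e3 : exp |y| ≤ exp (-t) * exp |x| := by
      rw [← Real.exp_add]; exact Real.exp_le_exp.2 (by linarith)
    have := mul_le_mul_of_nonneg_left e2 (Real.exp_pos (-t)).le
    linarith
  rw [Real.rpow_neg hx.le, Real.rpow_neg hy.le]
  have h2 := Real.rpow_le_rpow hy.le h1 ha
  rw [Real.mul_rpow (by positivity) hx.le] at h2
  have p1 : 0 < cosh x ^ a := Real.rpow_pos_of_pos hx _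
  have p2 : 0 < cosh y ^ a := Real.rpow_pos_of_pos hy _
  rw [← div_eq_mul_inv, le_div_iff₀ p2, inv_mul_le_iff₀ p1]
  linarith

lemma sol_sum (S : Finset ℕ) (j : ℕ) (hj : j ∈ S) (f : ℕ → ℝ) (δ : ℝ) (hδ : 0 ≤ δ)
    (h : ∀ l ∈ S, l ≠ j → |f l| ≤ δ) : |f j| - S.card * δ ≤ |∑ l ∈ S, f l| := by
  rw [← Finset.add_sum_erase S f hj]
  have h1 : |∑ l ∈ S.erase j, f l| ≤ S.card * δ := by
    calc _ ≤ ∑ l ∈ S.erase j, |f l| := Finset.abs_sum_le_sum_abs _ _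
      _ ≤ ∑ l ∈ S.erase j, δ := Finset.sum_le_sum fun l hl =>
          h l (Finset.mem_of_mem_erase hl) (Finset.ne_of_mem_erase hl)
      _ = (S.erase j).card * δ := by simp
      _ ≤ _ := by
        gcongr
        exact Finset.erase_subset _ _
  have h2 := abs_sub_abs_le_abs_sub (f j) (-(∑ l ∈ S.erase j, f l))
  rw [abs_neg, sub_neg_eq_add] at h2
  linarith

lemma sol_order (k : ℕ) (A : ℝ) (hA : 0 ≤ A) (ζ : ℕ → ℝ)
    (hζ : ∀ j, 1 ≤ j → j < k → A ≤ ζ (j+1) - ζ j) (i : ℕ) (hi : 1 ≤ i) (j : ℕ) (hij : i + 1 ≤ j)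
    (hj : j ≤ k) : ζ i + A ≤ ζ j := by
  induction j, hij using Nat.le_induction with
  | base => linarith [hζ i hi (by omega)]
  | succ n hn ih => linarith [hζ n (by omega) (by omega), ih (by omega)]

lemma sol_cases (k : ℕ) (hk : 1 ≤ k) (A L : ℝ) (hL : 0 < L) (hA : 2 * L ≤ A) (ζ : ℕ → ℝ)
    (hζ : ∀ j, 1 ≤ j → j < k → A ≤ ζ (j+1) - ζ j) (ξ : ℝ) :
    (∃ j ∈ Finset.Icc 1 k, ∀ l ∈ Finset.Icc 1 k, l ≠ j → |ξ - ζ j| + 2 * L ≤ |ξ - ζ l|) ∨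
    (∃ j, 1 ≤ j ∧ j < k ∧ |ξ - (ζ j + ζ (j+1)) / 2| ≤ L) := by
  have ord := sol_order k A (by linarith) ζ hζ
  obtain ⟨j, hj, hmin⟩ := Finset.exists_min_image (Finset.Icc 1 k) (fun l => |ξ - ζ l|)
    ⟨1, by simp [hk]⟩
  by_cases hg : ∀ l ∈ Finset.Icc 1 k, l ≠ j → |ξ - ζ j| + 2 * L ≤ |ξ - ζ l|
  · exact Or.inl ⟨j, hj, hg⟩
  right
  push Not at hg
  obtain ⟨l, hl, hlj, hlt⟩ := hg
  simp only [Finset.mem_Icc] at hj hl hmin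
  rcases lt_or_gt_of_ne hlj with h | h
  · obtain ⟨n, rfl⟩ : ∃ n, j = n + 1 := ⟨j - 1, by omega⟩
    refine ⟨n, by omega, by omega, ?_⟩
    have h1 := hmin n (by omega)
    have h2 := ord n (by omega) (n+1) le_rfl (by omega)
    have h3 : ζ l ≤ ζ n := by
      rcases (show l = n ∨ l + 1 ≤ n by omega) with e | e
      · rw [e]
      · linarith [ord l (by omega) n e (by omega)]
    have h4 := le_abs_self (ξ - ζ l)
    rcases le_total (ζ (n+1)) ξ with c | c
    · rw [abs_of_nonneg (sub_nonneg.2 c)] at hlt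
      linarith
    · rw [abs_of_nonpos (sub_nonpos.2 c)] at hlt h1
      rcases le_total (ζ n) ξ with d | d
      · rw [abs_of_nonneg (sub_nonneg.2 d)] at h1
        rw [abs_le]; constructor <;> linarith
      · rw [abs_of_nonpos (sub_nonpos.2 d)] at h1
        linarith
  · refine ⟨j, by omega, by omega, ?_⟩
    have h1 := hmin (j+1) (by omega)
    have h2 := ord j (by omega) (j+1) le_rfl (by omega)
    have h3 : ζ (j+1) ≤ ζ l := by
      rcases (show l = j+1 ∨ j + 1 + 1 ≤ l by omega) with e | e
      · rw [e]
      · linarith [ord (j+1) (by omega) l e (by omega)]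
    have h4 := neg_abs_le (ξ - ζ l)
    rcases le_total ξ (ζ j) with c | c
    · rw [abs_of_nonpos (sub_nonpos.2 c)] at hlt
      linarith
    · rw [abs_of_nonneg (sub_nonneg.2 c)] at hlt h1
      rcases le_total (ζ (j+1)) ξ with d | d
      · rw [abs_of_nonneg (sub_nonneg.2 d)] at h1
        linarith
      · rw [abs_of_nonpos (sub_nonpos.2 d)] at h1
        rw [abs_le]; constructor <;> linarith

lemma sol_T_abs (y : ℝ) : |sinh y / cosh y| ≤ 1 := by
  rw [abs_div, abs_of_pos (Real.cosh_pos y), div_le_one (Real.cosh_pos y), abs_le]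
  rw [Real.sinh_eq, Real.cosh_eq]
  constructor <;> linarith [Real.exp_pos y, Real.exp_pos (-y)]

lemma sol_T_ge (y : ℝ) (hy : 1 ≤ y) : 1/2 ≤ sinh y / cosh y := by
  rw [le_div_iff₀ (Real.cosh_pos y), Real.sinh_eq, Real.cosh_eq]
  have h1 : (2:ℝ) ≤ exp y := by linarith [Real.add_one_le_exp y]
  have h2 : exp (-y) * exp y = 1 := by rw [← Real.exp_add]; simp
  have := Real.exp_pos (-y)
  nlinarith

lemma sol_deriv (a s t x : ℝ) :
    HasDerivAt (fun x => (cosh (x - s) / cosh (x - t)) ^ a)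
      (a * (cosh (x - s) / cosh (x - t)) ^ a *
        (sinh (x - s) / cosh (x - s) - sinh (x - t) / cosh (x - t))) x := by
  have p1 := Real.cosh_pos (x - s)
  have p2 := Real.cosh_pos (x - t)
  have h1 : HasDerivAt (fun x => cosh (x - s)) (sinh (x - s)) x := by
    simpa using ((hasDerivAt_id x).sub_const s).cosh
  have h2 : HasDerivAt (fun x => cosh (x - t)) (sinh (x - t)) x := by
    simpa using ((hasDerivAt_id x).sub_const t).cosh
  have h3 := (h1.div h2 p2.ne').rpow_const (p := a) (Or.inl (div_pos p1 p2).ne')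
  refine h3.congr_deriv ?_
  simp only [Pi.div_apply]
  rw [Real.rpow_sub_one (div_pos p1 p2).ne']
  field_simp

lemma sol_quot (a x y : ℝ) : (cosh x / cosh y) ^ a = cosh y ^ (-a) / cosh x ^ (-a) := by
  rw [Real.div_rpow (Real.cosh_pos x).le (Real.cosh_pos y).le,
    Real.rpow_neg (Real.cosh_pos x).le, Real.rpow_neg (Real.cosh_pos y).le]
  field_simp

lemma sol_mvt (R R' : ℝ → ℝ) (u v c : ℝ) (huv : u ≤ v) (hR : ∀ x, HasDerivAt R (R' x) x)
    (hc : ∀ x ∈ Set.Icc u v, c ≤ |R' x|) :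
    ∃ x0 ∈ Set.Icc u v, ∀ x ∈ Set.Icc u v, c * |x - x0| ≤ 2 * |R x| := by
  have hcont : Continuous R := continuous_iff_continuousAt.2 fun x => (hR x).continuousAt
  obtain ⟨x0, hx0, hmin⟩ := isCompact_Icc.exists_isMinOn (Set.nonempty_Icc.2 huv)
    (hcont.abs.continuousOn (s := Set.Icc u v))
  refine ⟨x0, hx0, fun x hx => ?_⟩
  have hm : |R x0| ≤ |R x| := hmin hx
  have key : ∀ y z, y ∈ Set.Icc u v → z ∈ Set.Icc u v → y < z → c * |z - y| ≤ |R z - R y| := by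
    intro y z hy hz hyz
    obtain ⟨w, hw, he⟩ := exists_hasDerivAt_eq_slope R R' hyz hcont.continuousOn
      (fun x _ => hR x)
    have h1 := hc w ⟨hy.1.trans hw.1.le, hw.2.le.trans hz.2⟩
    rw [he, abs_div] at h1
    rwa [le_div_iff₀ (abs_pos.2 (sub_pos.2 hyz).ne')] at h1
  have hd : c * |x - x0| ≤ |R x - R x0| := by
    rcases lt_trichotomy x x0 with h | h | h
    · have := key x x0 hx hx0 h
      rwa [abs_sub_comm, abs_sub_comm (R x)]
    · simp [h]
    · exact key x0 x hx0 hx h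
  have := abs_sub (R x) (R x0)
  linarith

lemma sol_bad (k : ℕ) (a L A b : ℝ) (ha : 1 ≤ a) (hL : 0 < L) (hA : 2 * L + 2 ≤ A)
    (hb : b = ((2 * exp (2 * L)) ^ a)⁻¹)
    (hA2 : ∀ t, A - 2 * L ≤ t → (2 * exp (-t)) ^ a ≤ b / (4 * k))
    (ζ e : ℕ → ℝ)
    (hζ : ∀ j, 1 ≤ j → j < k → A ≤ ζ (j+1) - ζ j)
    (he : ∀ j, 1 ≤ j → j ≤ k → e j = 1 ∨ e j = -1) (j : ℕ) (hj : 1 ≤ j) (hjk : j < k) :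
    ∃ x0, ∀ ξ, |ξ - (ζ j + ζ (j+1)) / 2| ≤ L → |ξ - x0| ≤ 2 * L ∧
      (a * b / 2) * |ξ - x0| ≤ 
        2 * |(∑ l ∈ Finset.Icc 1 k, e l * cosh (ξ - ζ l) ^ (-a)) / cosh (ξ - ζ j) ^ (-a)| ∧
      ∀ i ∈ Finset.Icc 1 k, cosh (ξ - ζ i) ^ (-a) ≤ b⁻¹ * cosh (ξ - ζ j) ^ (-a) := by
  have ord := sol_order k A (by linarith) ζ hζ
  have hbpos : 0 < b := by rw [hb]; positivity
  have hkpos : (0:ℝ) < k := by exact_mod_cast (by omega : 0 < k)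
  have hgap := hζ j hj hjk
  set m := (ζ j + ζ (j+1)) / 2 with hm
  have hpos : ∀ x, 0 < cosh x ^ (-a) := fun x => Real.rpow_pos_of_pos (Real.cosh_pos x) _
  have hR : ∀ x, HasDerivAt
      (fun x => ∑ l ∈ Finset.Icc 1 k, e l * (cosh (x - ζ j) / cosh (x - ζ l)) ^ a)
      (∑ l ∈ Finset.Icc 1 k, e l * (a * (cosh (x - ζ j) / cosh (x - ζ l)) ^ a *
        (sinh (x - ζ j) / cosh (x - ζ j) - sinh (x - ζ l) / cosh (x - ζ l)))) x := by
    intro x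
    refine HasDerivAt.fun_sum fun l _ => ?_
    exact (sol_deriv a (ζ j) (ζ l) x).const_mul (e l)
  have habs : ∀ l ∈ Finset.Icc 1 k, |e l| = 1 := by
    intro l hl
    rw [Finset.mem_Icc] at hl
    rcases he l hl.1 hl.2 with h | h <;> simp [h]
  obtain ⟨x0, hx0, hx⟩ := sol_mvt _ _ (m - L) (m + L) (a * b / 2) (by linarith) hR (by
    intro x hx
    obtain ⟨hx1, hx2⟩ := hx
    have y1 : 1 ≤ x - ζ j := by linarith
    have y2 : 1 ≤ ζ (j+1) - x := by linarith
    refine le_trans ?_ (sol_sum (Finset.Icc 1 k) (j+1) (by simp; omega) _ (a * (b / (4 * k)) * 2)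
      (by positivity) ?_)
    · have t1 := sol_T_ge _ y1
      have t2 := sol_T_ge _ y2
      have t3 : sinh (x - ζ (j+1)) / cosh (x - ζ (j+1)) =
          - (sinh (ζ (j+1) - x) / cosh (ζ (j+1) - x)) := by
        rw [← neg_sub, Real.sinh_neg, Real.cosh_neg, neg_div]
      rw [abs_mul, habs _ (by simp; omega), one_mul, t3, sub_neg_eq_add, abs_of_nonneg
        (by positivity)]
      have v1 : b ≤ (cosh (x - ζ j) / cosh (x - ζ (j+1))) ^ a := by
        rw [sol_quot, le_div_iff₀ (hpos _), hb, inv_mul_le_iff₀ (by positivity)]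
        have := sol_ratio a (by linarith) (x - ζ j) (x - ζ (j+1)) (-(2 * L)) (by
          rw [abs_of_nonneg (by linarith : 0 ≤ x - ζ j),
            abs_of_nonpos (by linarith : x - ζ (j+1) ≤ 0)]
          linarith)
        simpa using this
      have : a * b * 1 ≤ a * (cosh (x - ζ j) / cosh (x - ζ (j+1))) ^ a *
          (sinh (x - ζ j) / cosh (x - ζ j) + sinh (ζ (j+1) - x) / cosh (ζ (j+1) - x)) := by
        gcongr
        linarith
      have e : ((Finset.Icc 1 k).card : ℝ) * (a * (b / (4 * k)) * 2) = a * b / 2 := by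
        simp; field_simp; norm_num
      linarith
    · intro l hl hlj
      have hl' := Finset.mem_Icc.1 hl
      rw [abs_mul, habs l hl, one_mul, abs_mul, abs_mul, abs_of_nonneg (by linarith : 0 ≤ a)]
      have t1 := sol_T_abs (x - ζ j)
      have t2 := sol_T_abs (x - ζ l)
      have t3 := (abs_sub (sinh (x - ζ j) / cosh (x - ζ j)) (sinh (x - ζ l) / cosh (x - ζ l)))
      rcases eq_or_ne l j with rfl | hne
      · rw [sub_self, abs_zero, mul_zero]; positivity
      have v : |(cosh (x - ζ j) / cosh (x - ζ l)) ^ a| ≤ b / (4 * k) := by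
        rw [sol_quot, abs_of_pos (div_pos (hpos _) (hpos _)), div_le_iff₀ (hpos _)]
        refine (sol_ratio a (by linarith) (x - ζ l) (x - ζ j) (A - 2 * L) ?_).trans ?_
        · rw [abs_of_nonneg (by linarith : 0 ≤ x - ζ j)]
          rcases lt_or_gt_of_ne hne with h | h
          · have := ord l hl'.1 j h (by omega)
            linarith [le_abs_self (x - ζ l)]
          · have := ord (j+1) (by omega) l (by omega) hl'.2
            linarith [neg_abs_le (x - ζ l)]
        · have := hA2 _ le_rfl
          have := hpos (x - ζ j)
          gcongr
      gcongr
      linarith)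
  refine ⟨x0, fun ξ hξ => ?_⟩
  rw [abs_le] at hξ
  have hξ' : ξ ∈ Set.Icc (m - L) (m + L) := ⟨by linarith, by linarith⟩
  refine ⟨?_, ?_, ?_⟩
  · rw [abs_le]; constructor <;> linarith [hx0.1, hx0.2]
  · refine (hx ξ hξ').trans (le_of_eq ?_)
    congr 2
    rw [Finset.sum_div]
    refine Finset.sum_congr rfl fun l _ => ?_
    rw [sol_quot, mul_div_assoc]
  · intro i hi
    have hi' := Finset.mem_Icc.1 hi
    rw [hb, inv_inv]
    have := sol_ratio a (by linarith) (ξ - ζ i) (ξ - ζ j) (-(2 * L)) (by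
      rw [abs_of_nonneg (by linarith : 0 ≤ ξ - ζ j)]
      rcases lt_trichotomy i j with h | h | h
      · have := ord i hi'.1 j h (by omega)
        linarith [le_abs_self (ξ - ζ i)]
      · rw [h]; linarith [le_abs_self (ξ - ζ j)]
      · have : ζ (j+1) ≤ ζ i := by
          rcases (show i = j+1 ∨ j + 1 + 1 ≤ i by omega) with e | e
          · rw [e]
          · linarith [ord (j+1) (by omega) i e (by omega)]
        linarith [neg_abs_le (ξ - ζ i)])
    simpa using this

lemma sol_h_int (q M : ℝ) (hq : q < 1) (hM : 0 ≤ M) :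
    Integrable (Set.indicator (Set.Icc (-M) M) fun y : ℝ => |y| ^ (-q)) := by
  rw [integrable_indicator_iff measurableSet_Icc]
  have h1 : IntervalIntegrable (fun y : ℝ => |y| ^ (-q)) volume 0 M := by
    refine (intervalIntegral.intervalIntegrable_rpow' (r := -q) (by linarith)).congr ?_
    intro x hx
    rw [Set.uIoc_of_le hM] at hx
    simp only [abs_of_pos hx.1]
  have h2 : IntervalIntegrable (fun y : ℝ => |y| ^ (-q)) volume (-M) 0 := by
    have := ((IntervalIntegrable.iff_comp_neg enorm_ne_top).1 h1).symm
    simpa using this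
  exact (intervalIntegrable_iff_integrableOn_Icc_of_le (by linarith)).1 (h2.trans h1)

lemma sol_good_pt (a p gi gj K y : ℝ) (hp1 : 1 < p) (hp2 : p < 2) (ha : a = 2/(p-1))
    (hgi : gi = cosh y ^ (-a)) (hij : gi ≤ gj) (hK : gj / 2 ≤ |K|) :
    gi * |K| ^ (p-2) ≤ 2 ^ (2-p) * (1 + y^2)⁻¹ := by
  have hc := Real.cosh_pos y
  have hpos : 0 < gi := by rw [hgi]; exact Real.rpow_pos_of_pos hc _
  have h1 : |K| ^ (p-2) ≤ (gi/2) ^ (p-2) :=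
    Real.rpow_le_rpow_of_nonpos (by linarith) (by linarith) (by linarith)
  have h2 : gi * (gi/2) ^ (p-2) = 2 ^ (2-p) * gi ^ (p-1) := by
    rw [Real.div_rpow hpos.le (by norm_num), show p - 1 = 1 + (p-2) by ring,
      Real.rpow_add hpos, Real.rpow_one, show (2:ℝ) - p = -(p-2) by ring,
      Real.rpow_neg (by norm_num)]
    field_simp
  have h3 : gi ^ (p-1) = (cosh y ^ 2)⁻¹ := by
    rw [hgi, ← Real.rpow_mul hc.le, show -a * (p-1) = -((2:ℕ):ℝ) by
      rw [ha]; have : p - 1 ≠ 0 := by linarith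
      field_simp; norm_num, Real.rpow_neg hc.le, Real.rpow_natCast]
  have h4 : 1 + y^2 ≤ cosh y ^ 2 := by
    rw [Real.cosh_sq]
    have : |y| ≤ |sinh y| := by
      rcases le_total 0 y with h | h
      · rw [abs_of_nonneg h, abs_of_nonneg (Real.sinh_nonneg_iff.2 h)]
        exact Real.self_le_sinh_iff.2 h
      · rw [abs_of_nonpos h, abs_of_nonpos (Real.sinh_nonpos_iff.2 h)]
        exact neg_le_neg (Real.sinh_le_self_iff.2 h)
    linarith [sq_le_sq.2 this]
  calc gi * |K| ^ (p-2) ≤ gi * (gi/2) ^ (p-2) := by gcongr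
    _ = 2 ^ (2-p) * (cosh y ^ 2)⁻¹ := by rw [h2, h3]
    _ ≤ _ := by gcongr

lemma sol_bad_pt (p gi gj K B c d : ℝ) (hp1 : 1 < p) (hp2 : p < 2) (hB : 0 < B) (hc : 0 < c)
    (hd : 0 < d) (hgj : 0 < gj) (hgj1 : gj ≤ 1) (hij : gi ≤ B * gj)
    (hK : c * d ≤ 2 * |K / gj|) :
    gi * |K| ^ (p-2) ≤ B * (c/2) ^ (p-2) * d ^ (-(2-p)) := by
  have h1 : gj * (c/2 * d) ≤ |K| := by
    rw [abs_div, abs_of_pos hgj] at hK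
    have : c / 2 * d ≤ |K| / gj := by linarith
    rw [le_div_iff₀ hgj] at this
    linarith
  have h2 : |K| ^ (p-2) ≤ (gj * (c/2 * d)) ^ (p-2) :=
    Real.rpow_le_rpow_of_nonpos (by positivity) h1 (by linarith)
  have h3 : gj ^ (p-1) ≤ 1 := Real.rpow_le_one hgj.le hgj1 (by linarith)
  calc gi * |K| ^ (p-2) ≤ (B * gj) * (gj * (c/2 * d)) ^ (p-2) := by gcongr
    _ = B * (c/2)^(p-2) * d ^ (-(2-p)) * gj ^ (p-1) := by
      rw [Real.mul_rpow hgj.le (by positivity), Real.mul_rpow (by positivity) hd.le,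
        show p - 1 = 1 + (p-2) by ring, Real.rpow_add hgj, Real.rpow_one, neg_sub]
      ring
    _ ≤ B * (c/2)^(p-2) * d ^ (-(2-p)) * 1 := by gcongr
    _ = _ := mul_one _

/-- Uniform bound on the weighted mass of `|K̄|^{p-2}` for `1 < p < 2`, where
`K̄(ξ) = Σ_{j=1}^k e_j cosh(ξ - ζ_j)^{-2/(p-1)}` is a sum of decoupled solitons:
once the centers `ζ₁ < ⋯ < ζ_k` are separated by at least `A`, the integral
`∫ cosh(ξ - ζ_i)^{-2/(p-1)} |K̄(ξ)|^{p-2} dξ` is finite and at most `C`, uniformly in the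
configuration and in the signs. (At the zeros of `K̄`, which form a null set, the
integrand is interpreted as `0`.) -/
theorem soliton_weighted_mass_bound (p : ℝ) (hp1 : 1 < p) (hp2 : p < 2)
    (k : ℕ) (hk : 1 ≤ k) :
    ∃ A > (0:ℝ), ∃ C > (0:ℝ), ∀ ζ : ℕ → ℝ, ∀ e : ℕ → ℝ,
      (∀ j, 1 ≤ j → j < k → A ≤ ζ (j+1) - ζ j) →
      (∀ j, 1 ≤ j → j ≤ k → e j = 1 ∨ e j = -1) →
      ∀ i, 1 ≤ i → i ≤ k →
        Integrable (fun ξ : ℝ =>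
          Real.cosh (ξ - ζ i) ^ (-(2/(p-1))) *
            |∑ j ∈ Finset.Icc 1 k, e j * Real.cosh (ξ - ζ j) ^ (-(2/(p-1)))| ^ (p-2)) ∧
        (∫ ξ : ℝ, Real.cosh (ξ - ζ i) ^ (-(2/(p-1))) *
            |∑ j ∈ Finset.Icc 1 k, e j * Real.cosh (ξ - ζ j) ^ (-(2/(p-1)))| ^ (p-2)) ≤ C := by
  have hp1' : 0 < p - 1 := by linarith
  obtain ⟨a, ha⟩ : ∃ a, a = 2/(p-1) := ⟨_, rfl⟩
  have ha1 : 1 ≤ a := by rw [ha, le_div_iff₀ hp1']; linarith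
  have hk1 : (1:ℝ) ≤ k := by exact_mod_cast hk
  rw [← ha]
  obtain ⟨T, hT0, hT⟩ := sol_small a ha1 (1 / (2 * k)) (by positivity)
    (by rw [div_le_one (by positivity)]; linarith)
  obtain ⟨L, hLdef⟩ : ∃ L, L = T / 2 := ⟨_, rfl⟩
  have hL : 0 < L := by rw [hLdef]; linarith
  obtain ⟨b, hb⟩ : ∃ b, b = ((2 * exp (2 * L)) ^ a)⁻¹ := ⟨_, rfl⟩
  have hbpos : 0 < b := by rw [hb]; positivity
  have hb1 : b ≤ 1 := by
    rw [hb]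
    refine inv_le_one_of_one_le₀ (Real.one_le_rpow ?_ (by linarith))
    linarith [Real.add_one_le_exp (2 * L)]
  obtain ⟨T', hT'0, hT'⟩ := sol_small a ha1 (b / (4 * k)) (by positivity)
    (by rw [div_le_one (by positivity)]; linarith)
  obtain ⟨D, hD⟩ : ∃ D, D = b⁻¹ * (a * b / 2 / 2) ^ (p-2) := ⟨_, rfl⟩
  have hDpos : 0 < D := by rw [hD]; positivity
  obtain ⟨h, hh⟩ : ∃ h : ℝ → ℝ, h = Set.indicator (Set.Icc (-(2*L)) (2*L))
    (fun y : ℝ => |y| ^ (-(2-p))) := ⟨_, rfl⟩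
  have hint : Integrable h := by rw [hh]; exact sol_h_int _ _ (by linarith) (by linarith)
  have hnn : ∀ y, 0 ≤ h y := by
    intro y; rw [hh]; exact Set.indicator_nonneg (fun y _ => by positivity) y
  have hIh : 0 ≤ ∫ y, h y := integral_nonneg hnn
  refine ⟨2 * L + 2 + T', by linarith, 2 ^ (2-p) * π + k * (D * ∫ y, h y), by positivity, ?_⟩
  intro ζ e hζ he i hi hik
  have hpos : ∀ x, 0 < cosh x ^ (-a) := fun x => Real.rpow_pos_of_pos (Real.cosh_pos x) _
  have hle1 : ∀ x, cosh x ^ (-a) ≤ 1 := fun x =>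
    Real.rpow_le_one_of_one_le_of_nonpos (Real.one_le_cosh x) (by linarith)
  have hbad := sol_bad k a L (2 * L + 2 + T') b ha1 hL (by linarith) hb
    (fun t ht => hT' t (by linarith)) ζ e hζ he
  have hbad' : ∀ j, ∃ x0, 1 ≤ j → j < k → ∀ ξ, |ξ - (ζ j + ζ (j+1)) / 2| ≤ L → |ξ - x0| ≤ 2 * L ∧
      (a * b / 2) * |ξ - x0| ≤
        2 * |(∑ l ∈ Finset.Icc 1 k, e l * cosh (ξ - ζ l) ^ (-a)) / cosh (ξ - ζ j) ^ (-a)| ∧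
      ∀ i ∈ Finset.Icc 1 k, cosh (ξ - ζ i) ^ (-a) ≤ b⁻¹ * cosh (ξ - ζ j) ^ (-a) := by
    intro j
    by_cases hj : 1 ≤ j ∧ j < k
    · obtain ⟨x0, h0⟩ := hbad j hj.1 hj.2
      exact ⟨x0, fun _ _ => h0⟩
    · exact ⟨0, fun h1 h2 => absurd ⟨h1, h2⟩ hj⟩
  choose X hX using hbad'
  have hG1 : Integrable (fun ξ : ℝ => 2 ^ (2-p) * (1 + (ξ - ζ i)^2)⁻¹) :=
    (integrable_inv_one_add_sq.comp_sub_right (ζ i)).const_mul _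
  have hG2 : ∀ j ∈ Finset.Icc 1 k, Integrable (fun ξ : ℝ => D * h (ξ - X j)) := fun j _ =>
    (hint.comp_sub_right (X j)).const_mul _
  have hG2' := integrable_finsetSum _ hG2
  have hG := hG1.add hG2'
  have hGint : ∫ ξ, (2 ^ (2-p) * (1 + (ξ - ζ i)^2)⁻¹ + ∑ j ∈ Finset.Icc 1 k, D * h (ξ - X j))
      = 2 ^ (2-p) * π + k * (D * ∫ y, h y) := by
    rw [integral_add hG1 hG2', integral_finsetSum _ hG2, integral_const_mul,
      integral_sub_right_eq_self (fun x : ℝ => (1 + x^2)⁻¹), integral_univ_inv_one_add_sq]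
    simp_rw [integral_const_mul, integral_sub_right_eq_self h]
    simp
  have hae : ∀ᵐ ξ : ℝ, ∀ j ∈ Finset.Icc 1 k, ξ ≠ X j := by
    rw [Filter.eventually_all_finset]
    intro j _
    exact Measure.ae_ne volume (X j)
  have hdom : ∀ᵐ ξ : ℝ, cosh (ξ - ζ i) ^ (-a) *
      |∑ j ∈ Finset.Icc 1 k, e j * cosh (ξ - ζ j) ^ (-a)| ^ (p-2) ≤
      2 ^ (2-p) * (1 + (ξ - ζ i)^2)⁻¹ + ∑ j ∈ Finset.Icc 1 k, D * h (ξ - X j) := by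
    filter_upwards [hae] with ξ hξ
    have hsn : ∀ j ∈ Finset.Icc 1 k, 0 ≤ D * h (ξ - X j) := fun j _ =>
      mul_nonneg hDpos.le (hnn _)
    rcases sol_cases k hk (2 * L + 2 + T') L hL (by linarith) ζ hζ ξ with
      ⟨j, hj, hg⟩ | ⟨j, hj1, hjk, hg⟩
    · have hsmall : ∀ l ∈ Finset.Icc 1 k, l ≠ j →
          cosh (ξ - ζ l) ^ (-a) ≤ 1 / (2 * k) * cosh (ξ - ζ j) ^ (-a) := by
        intro l hl hlj
        refine (sol_ratio a (by linarith) _ _ _ (hg l hl hlj)).trans ?_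
        exact mul_le_mul_of_nonneg_right (hT _ (by linarith)) (hpos _).le
      have habs : ∀ l ∈ Finset.Icc 1 k, |e l * cosh (ξ - ζ l) ^ (-a)| = cosh (ξ - ζ l) ^ (-a) := by
        intro l hl
        rw [Finset.mem_Icc] at hl
        rw [abs_mul, abs_of_pos (hpos _)]
        rcases he l hl.1 hl.2 with h | h <;> simp [h]
      have hK := sol_sum (Finset.Icc 1 k) j hj (fun l => e l * cosh (ξ - ζ l) ^ (-a))
        (1 / (2 * k) * cosh (ξ - ζ j) ^ (-a)) (mul_nonneg (by positivity) (hpos _).le)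
        (fun l hl hlj => by rw [habs l hl]; exact hsmall l hl hlj)
      simp only [habs j hj] at hK
      have hcard : ((Finset.Icc 1 k).card : ℝ) * (1 / (2 * k) * cosh (ξ - ζ j) ^ (-a)) =
          cosh (ξ - ζ j) ^ (-a) / 2 := by
        simp only [Nat.card_Icc, Nat.add_sub_cancel]
        field_simp
      have hij : cosh (ξ - ζ i) ^ (-a) ≤ cosh (ξ - ζ j) ^ (-a) := by
        rcases eq_or_ne i j with h | h
        · rw [h]
        · refine (hsmall i (Finset.mem_Icc.2 ⟨hi, hik⟩) h).trans ?_
          refine mul_le_of_le_one_left (hpos _).le ?_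
          rw [div_le_one (by positivity)]; linarith
      have := sol_good_pt a p _ _ (y := ξ - ζ i) hp1 hp2 ha rfl hij
        (K := ∑ j ∈ Finset.Icc 1 k, e j * cosh (ξ - ζ j) ^ (-a)) (by linarith)
      linarith [Finset.sum_nonneg hsn]
    · have hjm : j ∈ Finset.Icc 1 k := Finset.mem_Icc.2 ⟨hj1, hjk.le⟩
      obtain ⟨h1, h2, h3⟩ := hX j hj1 hjk ξ hg
      have hd : 0 < |ξ - X j| := abs_pos.2 (sub_ne_zero.2 (hξ j hjm))
      have := sol_bad_pt p _ _ _ _ _ _ hp1 hp2 (inv_pos.2 hbpos) (by positivity) hd (hpos _)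
        (hle1 _) (h3 i (Finset.mem_Icc.2 ⟨hi, hik⟩)) h2
      have hval : h (ξ - X j) = |ξ - X j| ^ (-(2-p)) := by
        rw [hh, Set.indicator_of_mem]
        exact abs_le.1 h1
      rw [← hD, ← hval] at this
      have h4 := Finset.single_le_sum hsn hjm
      have h5 : 0 ≤ (2:ℝ) ^ (2-p) * (1 + (ξ - ζ i)^2)⁻¹ := by positivity
      linarith
  have hmeas : Measurable (fun ξ : ℝ => cosh (ξ - ζ i) ^ (-a) *
      |∑ j ∈ Finset.Icc 1 k, e j * cosh (ξ - ζ j) ^ (-a)| ^ (p-2)) := by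
    have hc : ∀ j, Measurable (fun ξ : ℝ => cosh (ξ - ζ j) ^ (-a)) := fun j =>
      (Real.continuous_cosh.measurable.comp (measurable_id.sub_const (ζ j))).pow_const _
    have hs : Measurable (fun ξ : ℝ => ∑ j ∈ Finset.Icc 1 k, e j * cosh (ξ - ζ j) ^ (-a)) :=
      Finset.measurable_fun_sum _ fun j _ => (hc j).const_mul (e j)
    exact (hc i).mul ((_root_.continuous_abs.measurable.comp hs).pow_const _)
  have hF : Integrable (fun ξ : ℝ => cosh (ξ - ζ i) ^ (-a) *
      |∑ j ∈ Finset.Icc 1 k, e j * cosh (ξ - ζ j) ^ (-a)| ^ (p-2)) := by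
    refine hG.mono' hmeas.aestronglyMeasurable ?_
    filter_upwards [hdom] with ξ hξ
    rw [Real.norm_of_nonneg (mul_nonneg (hpos _).le (Real.rpow_nonneg (abs_nonneg _) _))]
    exact hξ
  refine ⟨hF, ?_⟩
  rw [← hGint]
  exact integral_mono_ae hF hG hdom
end
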